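/- Let α ≥ 0, let n ≥ 1 be an integer, let B be the open unit disc of ℝ², and let β > 0 satisfy z_1(β) = z_2(0). Assume n < (2+α)β/2 and set ν = 2n/(2+α). Let (U_p)_{p∈(1,p_0)} be a family of least energy n-invariant nodal solutions of the Hénon problem. Then ‖U_p‖_∞^{p−1} → ((2+α)/2 · z_1(ν))² as p → 1, and for every sequence p_k → 1 there exist a subsequence and a sign ε ∈ {−1, +1} such that along the subsequence U_{p_k}/‖U_{p_k}‖_∞ converges uniformly on B̄ to the function given in polar coordinates by ε · (sup_{s≥0} |J_ν(s)|)^{−1} · J_ν( z_1(ν) r^{(2+α)/2} ) cos(nθ). -/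

import Mathlib

open Real MeasureTheory Metric Filter Topology

noncomputable section

/-- The Euclidean plane. -/
abbrev E2 := EuclideanSpace ℝ (Fin 2)

/-- The Laplacian of `u : ℝ² → ℝ`. -/
def lap (u : E2 → ℝ) (x : E2) : ℝ :=
  ∑ i : Fin 2, fderiv ℝ (fun y => fderiv ℝ u y (EuclideanSpace.single i 1)) x
    (EuclideanSpace.single i 1)

/-- The sup norm `‖u‖_∞` of `u` over the closed unit disc. -/
def supN (u : E2 → ℝ) : ℝ := sSup ((fun x => |u x|) '' closedBall 0 1)

/-- A classical solution of the planar Hénon problem with parameter `α` and exponent `p`. -/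
def IsHenonSol (α p : ℝ) (u : E2 → ℝ) : Prop :=
  ContDiffOn ℝ 2 u (ball 0 1) ∧ ContinuousOn u (closedBall 0 1) ∧
  (∀ x ∈ ball (0 : E2) 1, -lap u x = ‖x‖ ^ α * |u x| ^ (p - 1) * u x) ∧
  (∀ x : E2, ‖x‖ = 1 → u x = 0)

/-- Rotation of the plane by the angle `φ` about the origin. -/
def rot2 (φ : ℝ) (q : E2) : E2 :=
  (EuclideanSpace.equiv (Fin 2) ℝ).symm
    ![Real.cos φ * q 0 - Real.sin φ * q 1, Real.sin φ * q 0 + Real.cos φ * q 1]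

/-- Reflection of the plane across the horizontal axis. -/
def reflX (q : E2) : E2 :=
  (EuclideanSpace.equiv (Fin 2) ℝ).symm ![q 0, -q 1]

/-- `u` is `n`-invariant: invariant under reflection across the horizontal axis and
rotation by `2π/n`. -/
def nInvariant (n : ℕ) (u : E2 → ℝ) : Prop :=
  (∀ q : E2, u (reflX q) = u q) ∧ (∀ q : E2, u (rot2 (2 * π / n) q) = u q)

/-- The quadratic form associated with the linearization of the Hénon problem at `U`. -/
def quadForm (α p : ℝ) (U ψ : E2 → ℝ) : ℝ :=
  (∫ x in ball (0 : E2) 1, ‖fderiv ℝ ψ x‖ ^ 2) -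
    p * ∫ x in ball (0 : E2) 1, ‖x‖ ^ α * |U x| ^ (p - 1) * ψ x ^ 2

/-- The energy functional of the Hénon problem. -/
def energy (α p : ℝ) (u : E2 → ℝ) : ℝ :=
  (1 / 2) * (∫ x in ball (0 : E2) 1, ‖fderiv ℝ u x‖ ^ 2) -
    (1 / (p + 1)) * ∫ x in ball (0 : E2) 1, ‖x‖ ^ α * |u x| ^ (p + 1)

/-- An `n`-invariant Lipschitz competitor in the nodal Nehari set: it vanishes on `∂B`,
has nontrivial positive and negative parts, and both parts satisfy the Nehari constraint. -/
def IsNehariCompetitor (α p : ℝ) (n : ℕ) (v : E2 → ℝ) : Prop :=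
  nInvariant n v ∧ (∃ K : NNReal, LipschitzOnWith K v (closedBall 0 1)) ∧
  (∀ x : E2, ‖x‖ = 1 → v x = 0) ∧
  (∃ x ∈ ball (0 : E2) 1, 0 < v x) ∧ (∃ x ∈ ball (0 : E2) 1, v x < 0) ∧
  (∫ x in ball (0 : E2) 1, ‖fderiv ℝ (fun y => max (v y) 0) x‖ ^ 2)
    = (∫ x in ball (0 : E2) 1, ‖x‖ ^ α * (max (v x) 0) ^ (p + 1)) ∧
  (∫ x in ball (0 : E2) 1, ‖fderiv ℝ (fun y => max (-v y) 0) x‖ ^ 2)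
    = (∫ x in ball (0 : E2) 1, ‖x‖ ^ α * (max (-v x) 0) ^ (p + 1))

/-- A least energy `n`-invariant nodal solution of the Hénon problem:
an `n`-invariant sign-changing classical solution whose `n`-Morse index is exactly 2 and
which minimizes the energy among `n`-invariant nodal Nehari competitors. -/
def IsLeastEnergyNInvNodal (α p : ℝ) (n : ℕ) (U : E2 → ℝ) : Prop :=
  IsHenonSol α p U ∧ nInvariant n U ∧
  (∃ x ∈ ball (0 : E2) 1, 0 < U x) ∧ (∃ x ∈ ball (0 : E2) 1, U x < 0) ∧
  IsGreatest {d : ℕ | ∃ V : Submodule ℝ (E2 → ℝ), Module.finrank ℝ V = d ∧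
    (∀ ψ ∈ V, ContDiff ℝ 1 ψ ∧ HasCompactSupport ψ ∧ tsupport ψ ⊆ ball 0 1 ∧
      nInvariant n ψ) ∧
    (∀ ψ ∈ V, ψ ≠ 0 → quadForm α p U ψ < 0)} 2 ∧
  (∀ v : E2 → ℝ, IsNehariCompetitor α p n v → energy α p U ≤ energy α p v)

/-- The Bessel function of the first kind of order `β`. -/
def besselJ (β r : ℝ) : ℝ :=
  r ^ β * ∑' k : ℕ,
    ((-1 : ℝ) ^ k / (Nat.factorial k * Real.Gamma ((k : ℝ) + 1 + β))) * (r / 2) ^ (2 * k)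

/-- `z` is the `i`-th positive zero of `J_β`. -/
def IsNthZero (β : ℝ) (i : ℕ) (z : ℝ) : Prop :=
  0 < z ∧ besselJ β z = 0 ∧ {r ∈ Set.Ioo 0 z | besselJ β r = 0}.encard = ((i - 1 : ℕ) : ℕ∞)

/-- The point of the plane with polar coordinates `(r, θ)`. -/
def polar (r θ : ℝ) : E2 :=
  (EuclideanSpace.equiv (Fin 2) ℝ).symm ![r * Real.cos θ, r * Real.sin θ]

/-- The second derivative of a function on the plane. -/
def hess (u : E2 → ℝ) (x : E2) : E2 →L[ℝ] E2 →L[ℝ] ℝ := fderiv ℝ (fderiv ℝ u) x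

/-- The counterclockwise rotation of a vector by a right angle. -/
def perp (e : E2) : E2 := !₂[-e 1, e 0]

lemma E2_eq (x : E2) : x = x 0 • EuclideanSpace.single 0 (1 : ℝ) + x 1 • EuclideanSpace.single 1 (1 : ℝ) := by
  ext i; fin_cases i <;> simp

lemma norm_sq_E2 (x : E2) : ‖x‖ ^ 2 = x 0 ^ 2 + x 1 ^ 2 := by
  simp [EuclideanSpace.norm_sq_eq, Fin.sum_univ_two]

lemma hasFDerivAt_fderiv {u : E2 → ℝ} {x : E2} (hu : ContDiffAt ℝ 2 u x) :
    HasFDerivAt (fderiv ℝ u) (hess u x) x := by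
  have h : ContDiffAt ℝ 1 (fderiv ℝ u) x := hu.fderiv_right (by norm_num)
  exact (h.differentiableAt (by norm_num)).hasFDerivAt

lemma hasFDerivAt_fderiv_apply {u : E2 → ℝ} {x : E2} (hu : ContDiffAt ℝ 2 u x) (a : E2) :
    HasFDerivAt (fun y => fderiv ℝ u y a) ((hess u x).flip a) x := by
  have := (hasFDerivAt_fderiv hu).clm_apply (hasFDerivAt_const a x)
  simp only [ContinuousLinearMap.comp_zero, zero_add] at this
  exact this

lemma lap_eq_hess {u : E2 → ℝ} {x : E2} (hu : ContDiffAt ℝ 2 u x) {e : E2} (he : ‖e‖ = 1) :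
    lap u x = hess u x e e + hess u x (perp e) (perp e) := by
  have h1 : e 0 ^ 2 + e 1 ^ 2 = 1 := by rw [← norm_sq_E2, he]; norm_num
  have hp : perp e = (-e 1) • EuclideanSpace.single 0 (1 : ℝ) + e 0 • EuclideanSpace.single 1 (1 : ℝ) := by
    ext i; fin_cases i <;> simp [perp]
  simp only [lap, Fin.sum_univ_two, (hasFDerivAt_fderiv_apply hu _).fderiv,
    ContinuousLinearMap.flip_apply]
  have hE := E2_eq e
  set a := e 0
  set b := e 1
  rw [hp, hE]
  simp only [map_add, map_smul, _root_.add_apply, _root_.smul_apply, smul_eq_mul]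
  linear_combination (-(hess u x (EuclideanSpace.single 0 1) (EuclideanSpace.single 0 1)) - hess u x (EuclideanSpace.single 1 1) (EuclideanSpace.single 1 1)) * h1

lemma hasDerivAt_line {u : E2 → ℝ} {x e : E2} {t : ℝ} (hu : DifferentiableAt ℝ u (x + t • e)) :
    HasDerivAt (fun s : ℝ => u (x + s • e)) (fderiv ℝ u (x + t • e) e) t := by
  have h2 : HasDerivAt (fun s : ℝ => x + s • e) e t := by
    simpa using ((hasDerivAt_id t).smul_const e).const_add x
  exact hu.hasFDerivAt.comp_hasDerivAt t h2

lemma hasDerivAt_fderiv_line {u : E2 → ℝ} {x e : E2} (hu : ContDiffAt ℝ 2 u x) :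
    HasDerivAt (fun s : ℝ => fderiv ℝ u (x + s • e) e) (hess u x e e) 0 := by
  have h2 : HasDerivAt (fun s : ℝ => x + s • e) e 0 := by
    simpa using ((hasDerivAt_id (0 : ℝ)).smul_const e).const_add x
  have h3 : HasFDerivAt (fun y => fderiv ℝ u y e) ((hess u x).flip e) (x + (0 : ℝ) • e) := by
    simpa using hasFDerivAt_fderiv_apply hu e
  exact h3.comp_hasDerivAt (0 : ℝ) h2

lemma eventually_differentiableAt {u : E2 → ℝ} {x : E2} (e : E2) (hu : ContDiffAt ℝ 2 u x) :
    ∀ᶠ t : ℝ in 𝓝 0, DifferentiableAt ℝ u (x + t • e) := by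
  have h1 : ∀ᶠ y in 𝓝 x, DifferentiableAt ℝ u y := by
    filter_upwards [hu.eventually (by simp)] with y hy
    exact hy.differentiableAt (by norm_num)
  have h2 : Tendsto (fun t : ℝ => x + t • e) (𝓝 0) (𝓝 x) := by
    have : Continuous (fun t : ℝ => x + t • e) := by fun_prop
    simpa using this.tendsto 0
  exact h2.eventually h1

/-- The second derivative is nonpositive at a local maximum. -/
lemma second_deriv_nonpos {g g' : ℝ → ℝ} {c : ℝ} (hmax : IsLocalMax g 0)
    (hg : ∀ᶠ t in 𝓝 0, HasDerivAt g (g' t) t) (hg' : HasDerivAt g' c 0) : c ≤ 0 := by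
  by_contra! hc
  have hd : deriv g =ᶠ[𝓝 0] g' := by filter_upwards [hg] with t ht using ht.deriv
  have h2 : deriv (deriv g) 0 = c := by rw [hd.deriv_eq, hg'.deriv]
  have hmin : IsLocalMin g 0 := isLocalMin_of_deriv_deriv_pos (by rw [h2]; exact hc)
    hmax.deriv_eq_zero hg.self_of_nhds.continuousAt
  have hconst : g =ᶠ[𝓝 0] fun _ => g 0 := by
    filter_upwards [hmax, hmin] with t h3 h4 using le_antisymm h3 h4
  have h5 : deriv (deriv g) 0 = 0 := by
    rw [(hconst.deriv).deriv_eq]; simp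
  linarith

lemma lap_nonpos_of_isLocalMax {u : E2 → ℝ} {x : E2} (hu : ContDiffAt ℝ 2 u x)
    (h : IsLocalMax u x) : lap u x ≤ 0 := by
  have key : ∀ e : E2, hess u x e e ≤ 0 := by
    intro e
    refine second_deriv_nonpos (g := fun s : ℝ => u (x + s • e))
      (g' := fun s => fderiv ℝ u (x + s • e) e) ?_ ?_ (hasDerivAt_fderiv_line hu)
    · have h2 : Tendsto (fun t : ℝ => x + t • e) (𝓝 0) (𝓝 x) := by
        have : Continuous (fun t : ℝ => x + t • e) := by fun_prop
        simpa using this.tendsto 0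
      have := h2.eventually h
      simpa [IsLocalMax, IsMaxFilter] using this
    · filter_upwards [eventually_differentiableAt e hu] with t ht using hasDerivAt_line ht
  have he : ‖(EuclideanSpace.single 0 (1 : ℝ) : E2)‖ = 1 := by simp
  rw [lap_eq_hess hu he]
  linarith [key (EuclideanSpace.single 0 (1 : ℝ)), key (perp (EuclideanSpace.single 0 (1 : ℝ)))]

lemma lap_add {u v : E2 → ℝ} {x : E2} (hu : ContDiffAt ℝ 2 u x) (hv : ContDiffAt ℝ 2 v x) :
    lap (fun y => u y + v y) x = lap u x + lap v x := by
  simp only [lap, ← Finset.sum_add_distrib]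
  refine Finset.sum_congr rfl fun i _ => ?_
  have h1 : (fun y => fderiv ℝ (fun y => u y + v y) y (EuclideanSpace.single i 1)) =ᶠ[𝓝 x]
      fun y => fderiv ℝ u y (EuclideanSpace.single i 1) + fderiv ℝ v y (EuclideanSpace.single i 1) := by
    filter_upwards [hu.eventually (by simp), hv.eventually (by simp)] with y h1 h2
    rw [fderiv_fun_add (h1.differentiableAt (by norm_num)) (h2.differentiableAt (by norm_num))]; rfl
  rw [h1.fderiv_eq, fderiv_fun_add (hasFDerivAt_fderiv_apply hu _).differentiableAt
    (hasFDerivAt_fderiv_apply hv _).differentiableAt]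
  rfl

lemma lap_const_mul (c : ℝ) (u : E2 → ℝ) (x : E2) :
    lap (fun y => c * u y) x = c * lap u x := by
  simp only [lap, Finset.mul_sum]
  refine Finset.sum_congr rfl fun i _ => ?_
  have key : ∀ (f : E2 → ℝ) (y : E2), fderiv ℝ (fun y => c * f y) y = c • fderiv ℝ f y := by
    intro f y
    have := congrFun (fderiv_const_smul_field (𝕜 := ℝ) (f := f) c) y
    exact this
  simp only [key, _root_.smul_apply, smul_eq_mul]

lemma lap_radial {g g' : ℝ → ℝ} {c : ℝ} {x : E2}
    (hg : ∀ᶠ t in 𝓝 (‖x‖ ^ 2), HasDerivAt g (g' t) t) (hg' : HasDerivAt g' c (‖x‖ ^ 2)) :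
    lap (fun y => g (‖y‖ ^ 2)) x = 4 * ‖x‖ ^ 2 * c + 4 * g' (‖x‖ ^ 2) := by
  have hn : ∀ y : E2, HasFDerivAt (fun y : E2 => ‖y‖ ^ 2) (2 • innerSL ℝ y) y := fun y =>
    (hasStrictFDerivAt_norm_sq y).hasFDerivAt
  have hin : ∀ (y : E2) (i : Fin 2), inner ℝ y (EuclideanSpace.single i (1 : ℝ)) = y i := by
    intro y i
    simp [EuclideanSpace.inner_single_right]
  have hev : ∀ i : Fin 2, (fun y => fderiv ℝ (fun y : E2 => g (‖y‖ ^ 2)) y (EuclideanSpace.single i 1)) =ᶠ[𝓝 x]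
      fun y => g' (‖y‖ ^ 2) * (2 * y i) := by
    intro i
    have hc : ContinuousAt (fun y : E2 => ‖y‖ ^ 2) x := by fun_prop
    filter_upwards [hc.eventually hg] with y hy
    have := (HasDerivAt.comp_hasFDerivAt y hy (hn y)).fderiv
    simp only [Function.comp_def] at this
    rw [this]; simp [hin]
  have hcoord : ∀ i : Fin 2, HasFDerivAt (fun y : E2 => 2 * y i) ((2 : ℝ) • (EuclideanSpace.proj i : E2 →L[ℝ] ℝ)) x := by
    intro i
    exact ((EuclideanSpace.proj i : E2 →L[ℝ] ℝ).hasFDerivAt).const_mul 2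
  simp only [lap]
  have : ∀ i : Fin 2, fderiv ℝ (fun y => fderiv ℝ (fun y : E2 => g (‖y‖ ^ 2)) y (EuclideanSpace.single i 1)) x
      (EuclideanSpace.single i 1) = 2 * g' (‖x‖ ^ 2) + 4 * c * x i ^ 2 := by
    intro i
    rw [(hev i).fderiv_eq]
    have h := ((HasDerivAt.comp_hasFDerivAt x hg' (hn x)).mul (hcoord i)).fderiv
    simp only [Function.comp_def] at h
    have h' : (fun y : E2 => g' (‖y‖ ^ 2) * (2 * y i)) = (fun y : E2 => g' (‖y‖ ^ 2)) * fun y : E2 => 2 * y i := rfl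
    rw [h', h]
    simp [hin]; ring
  simp only [this, Fin.sum_univ_two]
  rw [norm_sq_E2]
  ring

lemma le_barrier {u : E2 → ℝ} {L : ℝ} (hL : 0 < L) (hu : ContDiffOn ℝ 2 u (ball 0 1))
    (hc : ContinuousOn u (closedBall 0 1)) (h0 : ∀ x : E2, ‖x‖ = 1 → u x = 0)
    (hlap : ∀ x ∈ ball (0 : E2) 1, |lap u x| ≤ L) {x : E2} (hx : x ∈ closedBall (0 : E2) 1) :
    u x ≤ L / 2 * (1 - ‖x‖ ^ 2) := by
  set F : E2 → ℝ := fun y => u y + L / 2 * (‖y‖ ^ 2 - 1) with hF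
  have hFc : ContinuousOn F (closedBall 0 1) := hc.add (by fun_prop)
  obtain ⟨z, hz, hmax⟩ := (isCompact_closedBall (0 : E2) 1).exists_isMaxOn ⟨x, hx⟩ hFc
  suffices h : F z ≤ 0 by
    have h1 : F x ≤ F z := hmax hx
    simp only [hF] at h1 h ⊢
    linarith
  by_contra! hpos
  have hzb : z ∈ ball (0 : E2) 1 := by
    rw [mem_ball_zero_iff]
    refine lt_of_le_of_ne (mem_closedBall_zero_iff.1 hz) fun h1 => ?_
    simp [hF, h1, h0 z h1] at hpos
  have hloc : IsLocalMax F z :=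
    (hmax.on_subset ball_subset_closedBall).isLocalMax (isOpen_ball.mem_nhds hzb)
  have hu2 : ContDiffAt ℝ 2 u z := hu.contDiffAt (isOpen_ball.mem_nhds hzb)
  have hg2 : ContDiffAt ℝ 2 (fun y : E2 => L / 2 * (‖y‖ ^ 2 - 1)) z := by
    have : ContDiff ℝ 2 (fun y : E2 => ‖y‖ ^ 2) := contDiff_norm_sq ℝ
    exact ((this.sub contDiff_const).const_smul (L / 2)).contDiffAt
  have h1 := lap_nonpos_of_isLocalMax (hu2.add hg2) hloc
  rw [lap_add hu2 hg2, lap_radial (g := fun t => L / 2 * (t - 1)) (g' := fun _ => L / 2) (c := 0)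
    (Eventually.of_forall fun t => by
      simpa using ((hasDerivAt_id t).sub_const 1).const_mul (L / 2)) (hasDerivAt_const _ _)] at h1
  have := (abs_le.1 (hlap z hzb)).1
  linarith

/-- Doubling of variables: a function with bounded Laplacian vanishing on the unit circle is
globally Lipschitz. -/
lemma sub_le_of_abs_lap_le {u : E2 → ℝ} {L : ℝ} (hL : 0 < L) (hu : ContDiffOn ℝ 2 u (ball 0 1))
    (hc : ContinuousOn u (closedBall 0 1)) (h0 : ∀ x : E2, ‖x‖ = 1 → u x = 0)
    (hlap : ∀ x ∈ ball (0 : E2) 1, |lap u x| ≤ L) {x y : E2} (hx : x ∈ closedBall (0 : E2) 1)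
    (hy : y ∈ closedBall (0 : E2) 1) : u x - u y ≤ 3 * L * ‖x - y‖ := by
  have hb1 : ∀ z ∈ closedBall (0 : E2) 1, u z ≤ L / 2 * (1 - ‖z‖ ^ 2) := fun z hz =>
    le_barrier hL hu hc h0 hlap hz
  have hb2 : ∀ z ∈ closedBall (0 : E2) 1, -u z ≤ L / 2 * (1 - ‖z‖ ^ 2) := fun z hz => by
    have h1 : ∀ x, lap (fun y => -u y) x = -lap u x := fun x => by
      have := lap_const_mul (-1) u x
      simpa using this
    exact le_barrier (u := fun y => -u y) hL hu.neg hc.neg (fun x hx => by simp [h0 x hx])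
      (fun x hx => by rw [h1, abs_neg]; exact hlap x hx) hz
  set G : E2 × E2 → ℝ := fun q => u q.1 - u q.2 - (3 * L * ‖q.1 - q.2‖ - L / 2 * ‖q.1 - q.2‖ ^ 2)
    with hG
  have hGc : ContinuousOn G (closedBall 0 1 ×ˢ closedBall 0 1) := by
    refine ((hc.comp continuousOn_fst fun q hq => hq.1).sub
      (hc.comp continuousOn_snd fun q hq => hq.2)).sub ?_
    exact Continuous.continuousOn (by fun_prop)
  obtain ⟨⟨a, b⟩, hab, hmax⟩ := ((isCompact_closedBall (0 : E2) 1).prod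
    (isCompact_closedBall (0 : E2) 1)).exists_isMaxOn ⟨(x, y), hx, hy⟩ hGc
  obtain ⟨ha, hb⟩ : a ∈ closedBall (0 : E2) 1 ∧ b ∈ closedBall (0 : E2) 1 := hab
  suffices h : G (a, b) ≤ 0 by
    have h1 : G (x, y) ≤ G (a, b) := hmax (Set.mk_mem_prod hx hy)
    simp only [hG] at h1 h
    nlinarith [sq_nonneg ‖x - y‖]
  by_contra! hpos
  have ha1 := mem_closedBall_zero_iff.1 ha
  have hb1' := mem_closedBall_zero_iff.1 hb
  set t := ‖a - b‖ with ht
  have ht2 : t ≤ 2 := (norm_sub_le a b).trans (by linarith)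
  have htn : 0 ≤ t := norm_nonneg _
  have htpos : 0 < t := by
    refine lt_of_le_of_ne htn fun h => ?_
    have : a = b := by rw [← sub_eq_zero, ← norm_eq_zero]; exact h.symm
    simp [hG, this] at hpos
  have hG' : 0 < u a - u b - (3 * L * t - L / 2 * t ^ 2) := hpos
  have hPhi : 2 * L * t ≤ 3 * L * t - L / 2 * t ^ 2 := by nlinarith [mul_nonneg hL.le htn]
  have hLt := mul_pos hL htpos
  have hab' : |‖a‖ - ‖b‖| ≤ t := abs_norm_sub_norm_le a b
  have hai : a ∈ ball (0 : E2) 1 := by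
    rw [mem_ball_zero_iff]
    refine lt_of_le_of_ne ha1 fun h1 => ?_
    have h2 := hb2 b hb
    have h3 := (abs_le.1 hab').2
    rw [h0 a h1] at hG'
    have h5 : 1 - ‖b‖ ^ 2 ≤ 2 * t := by nlinarith [norm_nonneg b]
    have h6 := mul_le_mul_of_nonneg_left h5 hL.le
    linarith
  have hbi : b ∈ ball (0 : E2) 1 := by
    rw [mem_ball_zero_iff]
    refine lt_of_le_of_ne hb1' fun h1 => ?_
    have h2 := hb1 a ha
    have h3 := (abs_le.1 hab').1
    rw [h0 b h1] at hG'
    have h5 : 1 - ‖a‖ ^ 2 ≤ 2 * t := by nlinarith [norm_nonneg a]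
    have h6 := mul_le_mul_of_nonneg_left h5 hL.le
    linarith
  have hua : ContDiffAt ℝ 2 u a := hu.contDiffAt (isOpen_ball.mem_nhds hai)
  have hub : ContDiffAt ℝ 2 u b := hu.contDiffAt (isOpen_ball.mem_nhds hbi)
  have hloc : IsLocalMax G (a, b) := by
    refine (hmax.on_subset (Set.prod_mono ball_subset_closedBall ball_subset_closedBall)).isLocalMax ?_
    exact prod_mem_nhds (isOpen_ball.mem_nhds hai) (isOpen_ball.mem_nhds hbi)
  set e : E2 := t⁻¹ • (a - b) with he
  have hen : ‖e‖ = 1 := by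
    rw [he, norm_smul, ← ht, norm_inv, Real.norm_of_nonneg htn, inv_mul_cancel₀ htpos.ne']
  have hte : a - b = t • e := by rw [he, smul_smul, mul_inv_cancel₀ htpos.ne', one_smul]
  have key1 : hess u a e e - hess u b e e ≤ -4 * L := by
    have hcurve : Tendsto (fun s : ℝ => (a + s • e, b + s • (-e))) (𝓝 0) (𝓝 (a, b)) := by
      have : Continuous (fun s : ℝ => (a + s • e, b + s • (-e))) := by fun_prop
      simpa using this.tendsto 0
    have hnorm : ∀ᶠ s : ℝ in 𝓝 0, ‖(a + s • e) - (b + s • (-e))‖ = t + 2 * s := by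
      filter_upwards [eventually_gt_nhds (show -t / 2 < (0 : ℝ) by linarith)] with s hs
      have : (a + s • e) - (b + s • (-e)) = (t + 2 * s) • e := by
        rw [add_smul, ← hte]; module
      rw [this, norm_smul, hen, mul_one, Real.norm_of_nonneg (by linarith)]
    have hneg : ∀ z, hess u z (-e) (-e) = hess u z e e := fun z => by simp
    have := second_deriv_nonpos
      (g := fun s : ℝ => u (a + s • e) - u (b + s • (-e)) - (3 * L * (t + 2 * s) - L / 2 * (t + 2 * s) ^ 2))
      (g' := fun s => fderiv ℝ u (a + s • e) e - fderiv ℝ u (b + s • (-e)) (-e)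
        - (3 * L * 2 - L / 2 * (2 * (t + 2 * s) * 2)))
      (c := hess u a e e - hess u b (-e) (-e) - (0 - L / 2 * (2 * 2 * 2))) ?_ ?_ ?_
    · rw [hneg] at this; linarith
    · have h1 := hcurve.eventually hloc
      filter_upwards [h1, hnorm] with s h2 h3
      simp only [hG, h3] at h2
      simpa [hG, ← ht] using h2
    · filter_upwards [eventually_differentiableAt e hua, eventually_differentiableAt (-e) hub] with s h1 h2
      have h3 : HasDerivAt (fun s : ℝ => t + 2 * s) 2 s := by
        simpa using ((hasDerivAt_id s).const_mul 2).const_add t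
      refine ((hasDerivAt_line h1).sub (hasDerivAt_line h2)).sub ?_
      refine (h3.const_mul (3 * L)).sub ?_
      have := (h3.pow 2).const_mul (L / 2)
      simpa using this
    · have h3 : HasDerivAt (fun s : ℝ => t + 2 * s) 2 0 := by
        simpa using ((hasDerivAt_id (0 : ℝ)).const_mul 2).const_add t
      refine ((hasDerivAt_fderiv_line hua).sub (hasDerivAt_fderiv_line hub)).sub ?_
      refine (hasDerivAt_const _ _).sub ?_
      have := ((h3.const_mul 2).mul_const 2).const_mul (L / 2)
      exact this
  have key2 : hess u a (perp e) (perp e) - hess u b (perp e) (perp e) ≤ 0 := by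
    set d := perp e
    have hcurve : Tendsto (fun s : ℝ => (a + s • d, b + s • d)) (𝓝 0) (𝓝 (a, b)) := by
      have : Continuous (fun s : ℝ => (a + s • d, b + s • d)) := by fun_prop
      simpa using this.tendsto 0
    refine second_deriv_nonpos (g := fun s : ℝ => u (a + s • d) - u (b + s • d))
      (g' := fun s => fderiv ℝ u (a + s • d) d - fderiv ℝ u (b + s • d) d) ?_ ?_
      ((hasDerivAt_fderiv_line hua).sub (hasDerivAt_fderiv_line hub))
    · have h1 := hcurve.eventually hloc
      filter_upwards [h1] with s h2
      simp only [hG, add_sub_add_right_eq_sub] at h2 ⊢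
      simpa using h2
    · filter_upwards [eventually_differentiableAt d hua, eventually_differentiableAt d hub] with s h1 h2
      exact (hasDerivAt_line h1).sub (hasDerivAt_line h2)
  have h1 := lap_eq_hess hua hen
  have h2 := lap_eq_hess hub hen
  have h3 := (abs_le.1 (hlap a hai)).1
  have h4 := (abs_le.1 (hlap b hbi)).2
  linarith

lemma abs_sub_le_of_abs_lap_le {u : E2 → ℝ} {L : ℝ} (hL : 0 < L) (hu : ContDiffOn ℝ 2 u (ball 0 1))
    (hc : ContinuousOn u (closedBall 0 1)) (h0 : ∀ x : E2, ‖x‖ = 1 → u x = 0)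
    (hlap : ∀ x ∈ ball (0 : E2) 1, |lap u x| ≤ L) {x y : E2} (hx : x ∈ closedBall (0 : E2) 1)
    (hy : y ∈ closedBall (0 : E2) 1) : |u x - u y| ≤ 3 * L * ‖x - y‖ := by
  rw [abs_le]
  have h1 := sub_le_of_abs_lap_le hL hu hc h0 hlap hx hy
  have h2 := sub_le_of_abs_lap_le hL hu hc h0 hlap hy hx
  rw [norm_sub_rev] at h2
  constructor <;> linarith

/-- Maximum principle in thin annuli. -/
lemma nonneg_of_thin_annulus {u V : E2 → ℝ} {L s : ℝ} (hL : 1 ≤ L) (hs0 : 0 ≤ s)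
    (hs : (1 - s ^ 2) ^ 2 < 1 / (2 * L)) (hs2 : 3 / 4 ≤ s ^ 2)
    (hu : ContDiffOn ℝ 2 u (ball 0 1))
    (hc : ContinuousOn u (closedBall 0 1)) (h0 : ∀ x : E2, ‖x‖ = 1 → u x = 0)
    (hV : ∀ x ∈ ball (0 : E2) 1, 0 ≤ V x ∧ V x ≤ L)
    (heq : ∀ x ∈ ball (0 : E2) 1, -lap u x = V x * u x)
    (hin : ∀ x : E2, ‖x‖ = s → 0 ≤ u x) {x : E2} (hx : x ∈ closedBall (0 : E2) 1) (hxs : s ≤ ‖x‖) :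
    0 ≤ u x := by
  set A : Set E2 := closedBall 0 1 ∩ {x | s ≤ ‖x‖} with hA
  have hAc : IsCompact A := (isCompact_closedBall (0 : E2) 1).inter_right
    (isClosed_le continuous_const continuous_norm)
  set g : ℝ → ℝ := fun q => 1 - L * (q - 1) ^ 2 with hg
  have hgpos : ∀ z ∈ A, 0 < g (‖z‖ ^ 2) := by
    intro z hz
    have h1 : ‖z‖ ≤ 1 := mem_closedBall_zero_iff.1 hz.1
    have h2 : s ≤ ‖z‖ := hz.2
    have h3 : (‖z‖ ^ 2 - 1) ^ 2 ≤ (1 - s ^ 2) ^ 2 := by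
      have : s ^ 2 ≤ ‖z‖ ^ 2 := by gcongr
      have : ‖z‖ ^ 2 ≤ 1 := by nlinarith [norm_nonneg z]
      nlinarith
    rw [lt_div_iff₀ (by linarith)] at hs
    simp only [hg]
    nlinarith
  have hcont : ContinuousOn (fun z => u z / g (‖z‖ ^ 2)) A := by
    refine (hc.mono Set.inter_subset_left).div (Continuous.continuousOn (by fun_prop)) fun z hz =>
      (hgpos z hz).ne'
  obtain ⟨z, hz, hmin⟩ := hAc.exists_isMinOn ⟨x, hx, hxs⟩ hcont
  by_contra! hneg
  have hqx : u x / g (‖x‖ ^ 2) < 0 := div_neg_of_neg_of_pos hneg (hgpos x ⟨hx, hxs⟩)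
  have hqz : u z / g (‖z‖ ^ 2) ≤ u x / g (‖x‖ ^ 2) := hmin ⟨hx, hxs⟩
  set c := u z / g (‖z‖ ^ 2) with hcdef
  have hcneg : c < 0 := by linarith
  have huz : u z = c * g (‖z‖ ^ 2) := by rw [hcdef, div_mul_cancel₀ _ (hgpos z hz).ne']
  have huzneg : u z < 0 := by rw [huz]; exact mul_neg_of_neg_of_pos hcneg (hgpos z hz)
  have hz1 : ‖z‖ < 1 := lt_of_le_of_ne (mem_closedBall_zero_iff.1 hz.1) fun h => by
    rw [h0 z h] at huzneg; exact lt_irrefl _ huzneg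
  have hzs : s < ‖z‖ := lt_of_le_of_ne hz.2 fun h => by
    linarith [hin z h.symm]
  have hzb : z ∈ ball (0 : E2) 1 := mem_ball_zero_iff.2 hz1
  have hnh : A ∈ 𝓝 z := by
    refine inter_mem (mem_of_superset (isOpen_ball.mem_nhds hzb) ball_subset_closedBall) ?_
    exact mem_of_superset ((isOpen_lt continuous_const continuous_norm).mem_nhds hzs)
      fun y hy => show s ≤ ‖y‖ from le_of_lt hy
  have hu2 : ContDiffAt ℝ 2 u z := hu.contDiffAt (isOpen_ball.mem_nhds hzb)
  have hg2 : ContDiffAt ℝ 2 (fun y : E2 => c * g (‖y‖ ^ 2)) z := by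
    have h1 : ContDiff ℝ 2 (fun y : E2 => ‖y‖ ^ 2) := contDiff_norm_sq ℝ
    have h2 : ContDiff ℝ 2 g := by fun_prop
    exact (contDiff_const.mul (h2.comp h1)).contDiffAt
  have hg2' : ContDiffAt ℝ 2 (fun y : E2 => (-1) * u y) z := contDiffAt_const.mul hu2
  have hloc : IsLocalMax (fun y => c * g (‖y‖ ^ 2) + (-1) * u y) z := by
    filter_upwards [hnh] with y hy
    have h1 : c ≤ u y / g (‖y‖ ^ 2) := hmin hy
    rw [le_div_iff₀ (hgpos y hy)] at h1
    simp only [huz]; linarith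
  have h1 := lap_nonpos_of_isLocalMax (hg2.add hg2') hloc
  rw [lap_add hg2 hg2', lap_const_mul, lap_const_mul,
    lap_radial (g := g) (g' := fun q => -(L * (2 * (q - 1)))) (c := -(L * (2 * 1)))] at h1
  · have h2 := heq z hzb
    obtain ⟨hV0, hVL⟩ := hV z hzb
    have h3 : 0 ≤ u z * (V z - L) := by nlinarith
    have hgle : g (‖z‖ ^ 2) ≤ 1 := by simp only [hg]; nlinarith [sq_nonneg (‖z‖ ^ 2 - 1)]
    have hq : 3 / 4 ≤ ‖z‖ ^ 2 := hs2.trans (by gcongr)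
    have h4 : -1 * lap u z = V z * u z := by linarith
    rw [h4] at h1
    have h5 : V z * u z = u z * (V z - L) + L * (c * g (‖z‖ ^ 2)) := by rw [huz]; ring
    rw [h5] at h1
    have h6 : c * (4 * ‖z‖ ^ 2 * -(L * (2 * 1)) + 4 * -(L * (2 * (‖z‖ ^ 2 - 1)))) + L * (c * g (‖z‖ ^ 2)) ≤ 0 := by
      linarith
    have h7 : (-c) * L * (16 * ‖z‖ ^ 2 - 8 - g (‖z‖ ^ 2)) ≤ 0 := by linarith
    have h8 : 0 < (-c) * L * (16 * ‖z‖ ^ 2 - 8 - g (‖z‖ ^ 2)) :=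
      mul_pos (mul_pos (by linarith) (by linarith)) (by linarith)
    linarith
  · refine Eventually.of_forall fun t => ?_
    have h2 := ((((hasDerivAt_id t).sub_const 1).pow 2).const_mul L).const_sub 1
    simpa using h2
  · have h2 := ((((hasDerivAt_id (‖z‖ ^ 2)).sub_const 1).const_mul 2).const_mul L).neg
    exact h2

lemma norm_sq_clm (A : E2 →L[ℝ] ℝ) :
    ‖A‖ ^ 2 = ∑ i : Fin 2, A (EuclideanSpace.single i 1) ^ 2 := by
  obtain ⟨y, rfl⟩ := (InnerProductSpace.toDual ℝ E2).surjective A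
  rw [LinearIsometryEquiv.norm_map, norm_sq_E2, Fin.sum_univ_two]
  simp [InnerProductSpace.toDual_apply_apply, EuclideanSpace.inner_single_right]

lemma continuous_mul_of_tsupport_subset {g ψ : E2 → ℝ} {Ω : Set E2} (hΩ : IsOpen Ω)
    (hg : ContinuousOn g Ω) (hψ : Continuous ψ) (hs : tsupport ψ ⊆ Ω) :
    Continuous fun x => g x * ψ x := by
  refine continuous_of_tsupport fun x hx => ?_
  have : x ∈ tsupport ψ := closure_mono (fun y hy => right_ne_zero_of_mul hy) hx
  exact (hg.continuousAt (hΩ.mem_nhds (hs this))).mul hψ.continuousAt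

/-- Green's formula against a compactly supported test function. -/
lemma integral_fderiv_mul_fderiv {u ψ : E2 → ℝ} {Ω : Set E2} (hΩ : IsOpen Ω)
    (hu : ContDiffOn ℝ 2 u Ω) (hψ : ContDiff ℝ 1 ψ) (hcs : HasCompactSupport ψ)
    (hs : tsupport ψ ⊆ Ω) :
    ∫ x, ∑ i : Fin 2, fderiv ℝ u x (EuclideanSpace.single i 1) *
      fderiv ℝ ψ x (EuclideanSpace.single i 1) = -∫ x, lap u x * ψ x := by
  have hat : ∀ x ∈ Ω, ContDiffAt ℝ 2 u x := fun x hx => hu.contDiffAt (hΩ.mem_nhds hx)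
  have hc1 : ∀ v : E2, ContinuousOn (fun x => fderiv ℝ u x v) Ω := fun v x hx =>
    (hasFDerivAt_fderiv_apply (hat x hx) v).continuousAt.continuousWithinAt
  have hc2 : ∀ v w : E2, ContinuousOn (fun x => fderiv ℝ (fun y => fderiv ℝ u y v) x w) Ω := by
    intro v w x hx
    have h1 : ContDiffAt ℝ 1 (fun y => fderiv ℝ u y v) x :=
      ((hat x hx).fderiv_right (m := 1) (by norm_num)).clm_apply contDiffAt_const
    have h2 : ContDiffAt ℝ 0 (fderiv ℝ (fun y => fderiv ℝ u y v)) x :=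
      h1.fderiv_right (m := 0) (by norm_num)
    exact (h2.clm_apply contDiffAt_const).continuousAt.continuousWithinAt
  have hd : ∀ v : E2, Continuous (fun x => fderiv ℝ ψ x v) := fun v =>
    (hψ.continuous_fderiv (by norm_num)).clm_apply continuous_const
  have hts : ∀ v : E2, tsupport (fun x => fderiv ℝ ψ x v) ⊆ tsupport ψ := fun v =>
    (closure_minimal (fun x hx => by
      refine support_fderiv_subset ℝ (f := ψ) fun h => hx ?_
      simp [h]) (isClosed_tsupport ψ))
  have hcs' : ∀ v : E2, HasCompactSupport (fun x => fderiv ℝ ψ x v) := fun v =>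
    hcs.of_isClosed_subset (isClosed_tsupport _) (hts v)
  have hi1 : ∀ v : E2, Integrable (fun x => fderiv ℝ u x v * fderiv ℝ ψ x v) := fun v =>
    (continuous_mul_of_tsupport_subset hΩ (hc1 v) (hd v)
      ((hts v).trans hs)).integrable_of_hasCompactSupport (hcs' v).mul_left
  have hi2 : ∀ v : E2, Integrable (fun x => fderiv ℝ (fun y => fderiv ℝ u y v) x v * ψ x) := fun v =>
    (continuous_mul_of_tsupport_subset hΩ (hc2 v v) hψ.continuous hs).integrable_of_hasCompactSupport
      hcs.mul_left
  have hi3 : ∀ v : E2, Integrable (fun x => fderiv ℝ u x v * ψ x) := fun v =>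
    (continuous_mul_of_tsupport_subset hΩ (hc1 v) hψ.continuous hs).integrable_of_hasCompactSupport
      hcs.mul_left
  have key : ∀ v : E2, ∫ x, fderiv ℝ u x v * fderiv ℝ ψ x v
      = -∫ x, fderiv ℝ (fun y => fderiv ℝ u y v) x v * ψ x := by
    intro v
    exact integral_bilinear_fderiv_right_eq_neg_left_of_integrable
      (B := ContinuousLinearMap.mul ℝ ℝ) (f := fun y => fderiv ℝ u y v) (g := ψ)
      (hi2 v) (hi1 v) (hi3 v)
      (fun x hx => (hasFDerivAt_fderiv_apply (hat x (hs hx)) v).differentiableAt)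
      (fun x _ => hψ.differentiable (by norm_num) x)
  rw [integral_finsetSum _ fun i _ => hi1 _]
  simp only [lap, Finset.sum_mul]
  rw [integral_finsetSum _ fun i _ => hi2 _, ← Finset.sum_neg_distrib]
  exact Finset.sum_congr rfl fun i _ => key _

/-- A smooth truncation of the identity, vanishing on `(-∞, 1]`. -/
def softId (s : ℝ) : ℝ := s * Real.smoothTransition (s - 1)

lemma softId_contDiff : ContDiff ℝ 2 softId := by
  unfold softId
  exact contDiff_id.mul (Real.smoothTransition.contDiff.comp (contDiff_id.sub contDiff_const))

lemma softId_of_le {s : ℝ} (hs : s ≤ 1) : softId s = 0 := by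
  simp [softId, Real.smoothTransition.zero_of_nonpos (sub_nonpos.2 hs)]

lemma softId_of_ge {s : ℝ} (hs : 2 ≤ s) : softId s = s := by
  simp [softId, Real.smoothTransition.one_of_one_le (by linarith : 1 ≤ s - 1)]

lemma abs_softId_le (s : ℝ) : |softId s| ≤ |s| := by
  rw [softId, abs_mul, abs_of_nonneg (Real.smoothTransition.nonneg _)]
  exact mul_le_of_le_one_right (abs_nonneg _) (Real.smoothTransition.le_one _)

lemma deriv_softId_of_lt {s : ℝ} (hs : s < 1) : deriv softId s = 0 := by
  have : softId =ᶠ[𝓝 s] fun _ => 0 := by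
    filter_upwards [eventually_lt_nhds hs] with t ht using softId_of_le ht.le
  rw [this.deriv_eq]; simp

lemma deriv_softId_of_gt {s : ℝ} (hs : 2 < s) : deriv softId s = 1 := by
  have : softId =ᶠ[𝓝 s] fun t => t := by
    filter_upwards [eventually_gt_nhds hs] with t ht using softId_of_ge ht.le
  rw [this.deriv_eq]; simp

lemma exists_abs_deriv_softId_le : ∃ C, 0 ≤ C ∧ ∀ s, |deriv softId s| ≤ C := by
  have hc : Continuous (deriv softId) := softId_contDiff.continuous_deriv (by norm_num)
  obtain ⟨C, hC⟩ := isCompact_Icc.exists_bound_of_continuousOn (hc.continuousOn (s := Set.Icc 1 2))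
  refine ⟨max C 1, by positivity, fun s => ?_⟩
  rcases lt_or_ge s 1 with h | h
  · rw [deriv_softId_of_lt h]; simp
  rcases lt_or_ge 2 s with h2 | h2
  · rw [deriv_softId_of_gt h2]; simp
  · exact (hC s ⟨h, h2⟩).trans (le_max_left _ _)

lemma fderiv_max_of_nonpos {u : E2 → ℝ} {x : E2} (h : u x ≤ 0) :
    fderiv ℝ (fun y => max (u y) 0) x = 0 := by
  refine IsLocalMin.fderiv_eq_zero (Eventually.of_forall fun y => ?_)
  simp [h]

lemma fderiv_max_of_pos {u : E2 → ℝ} {x : E2} (hc : ContinuousAt u x) (h : 0 < u x) :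
    fderiv ℝ (fun y => max (u y) 0) x = fderiv ℝ u x := by
  have : (fun y => max (u y) 0) =ᶠ[𝓝 x] u := by
    filter_upwards [hc.eventually (eventually_gt_nhds h)] with y hy
    exact max_eq_left hy.le
  exact this.fderiv_eq

lemma isFiniteMeasure_restrict_ball : IsFiniteMeasure (volume.restrict (ball (0 : E2) 1)) :=
  ⟨by simp⟩

/-- Testing the equation with the positive part. -/
lemma integral_norm_fderiv_posPart {u f : E2 → ℝ} {Ω : Set E2} {K : NNReal} (hΩ : IsOpen Ω)
    (hΩb : Ω ⊆ ball 0 1) (hu : ContDiffOn ℝ 2 u Ω) (hlip : LipschitzOnWith K u (closedBall 0 1))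
    (h0 : ∀ x : E2, ‖x‖ = 1 → u x = 0) (hpos : ∀ x ∈ ball (0 : E2) 1, 0 < u x → x ∈ Ω)
    (hf : ∀ x ∈ Ω, -lap u x = f x) (hfc : ContinuousOn f (closedBall 0 1)) :
    ∫ x in ball (0 : E2) 1, ‖fderiv ℝ (fun y => max (u y) 0) x‖ ^ 2
      = ∫ x in ball (0 : E2) 1, f x * max (u x) 0 := by
  have hc : ContinuousOn u (closedBall 0 1) := hlip.continuousOn
  have hcat : ∀ x ∈ ball (0 : E2) 1, ContinuousAt u x := fun x hx =>
    hc.continuousAt (mem_of_superset (isOpen_ball.mem_nhds hx) ball_subset_closedBall)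
  have hat : ∀ x ∈ Ω, ContDiffAt ℝ 2 u x := fun x hx => hu.contDiffAt (hΩ.mem_nhds hx)
  obtain ⟨CS, hCS0, hCS⟩ := exists_abs_deriv_softId_le
  obtain ⟨Cf, hCf⟩ := (isCompact_closedBall (0 : E2) 1).exists_bound_of_continuousOn hfc
  obtain ⟨Cu, hCu⟩ := (isCompact_closedBall (0 : E2) 1).exists_bound_of_continuousOn hc
  have := isFiniteMeasure_restrict_ball
  set N : ℕ → ℝ := fun k => (k : ℝ) + 1 with hN
  have hNpos : ∀ k, 0 < N k := fun k => by positivity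
  set G : ℕ → ℝ → ℝ := fun k t => (N k)⁻¹ * softId (N k * t) with hG
  have hGd : ∀ k t, HasDerivAt (G k) (deriv softId (N k * t)) t := by
    intro k t
    have h1 : HasDerivAt softId (deriv softId (N k * t)) (N k * t) :=
      (softId_contDiff.differentiable (by norm_num) _).hasDerivAt
    have h2 : HasDerivAt (fun t : ℝ => N k * t) (N k) t := by
      simpa using (hasDerivAt_id t).const_mul (N k)
    have h3 := (h1.comp t h2).const_mul (N k)⁻¹
    have h4 : (N k)⁻¹ * (deriv softId (N k * t) * N k) = deriv softId (N k * t) := by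
      field_simp [(hNpos k).ne']
    rw [h4] at h3
    exact h3
  have hGc : ∀ k, ContDiff ℝ 2 (G k) := fun k =>
    contDiff_const.mul (softId_contDiff.comp (contDiff_const.mul contDiff_id))
  set ψ : ℕ → E2 → ℝ := fun k x => by
    classical exact if x ∈ closedBall (0 : E2) 1 then G k (u x) else 0 with hψdef
  have hψin : ∀ k, ∀ x ∈ closedBall (0 : E2) 1, ψ k x = G k (u x) := fun k x hx => by
    simp only [hψdef]; exact if_pos hx
  have hψout : ∀ k, ∀ x ∉ closedBall (0 : E2) 1, ψ k x = 0 := fun k x hx => by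
    simp only [hψdef]; exact if_neg hx
  set Kc : ℕ → Set E2 := fun k => closedBall 0 1 ∩ u ⁻¹' Set.Ici (N k)⁻¹ with hKc
  have hKclosed : ∀ k, IsClosed (Kc k) := fun k =>
    hc.preimage_isClosed_of_isClosed isClosed_closedBall isClosed_Ici
  have hKcomp : ∀ k, IsCompact (Kc k) := fun k =>
    (isCompact_closedBall (0 : E2) 1).of_isClosed_subset (hKclosed k) Set.inter_subset_left
  have hKΩ : ∀ k, Kc k ⊆ Ω := by
    intro k x hx
    have h1 : 0 < u x := (inv_pos.2 (hNpos k)).trans_le hx.2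
    refine hpos x ?_ h1
    rw [mem_ball_zero_iff]
    refine lt_of_le_of_ne (mem_closedBall_zero_iff.1 hx.1) fun h => ?_
    rw [h0 x h] at h1; exact lt_irrefl _ h1
  have hψz : ∀ k, ∀ x ∉ Kc k, ψ k x = 0 := by
    intro k x hx
    by_cases h : x ∈ closedBall (0 : E2) 1
    · rw [hψin k x h]
      have h2 : u x < (N k)⁻¹ := by
        by_contra! h3; exact hx ⟨h, h3⟩
      have h3 : N k * u x ≤ 1 := by
        have := mul_le_mul_of_nonneg_left h2.le (hNpos k).le
        rwa [mul_inv_cancel₀ (hNpos k).ne'] at this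
      simp only [hG, softId_of_le h3, mul_zero]
    · exact hψout k x h
  have hts : ∀ k, tsupport (ψ k) ⊆ Kc k := fun k =>
    closure_minimal (fun x hx => by by_contra h; exact hx (hψz k x h)) (hKclosed k)
  have hcs : ∀ k, HasCompactSupport (ψ k) := fun k =>
    (hKcomp k).of_isClosed_subset (isClosed_tsupport _) (hts k)
  have hψe : ∀ k, ∀ x ∈ Ω, ψ k =ᶠ[𝓝 x] fun y => G k (u y) := fun k x hx => by
    filter_upwards [hΩ.mem_nhds hx] with y hy
    exact hψin k y (ball_subset_closedBall (hΩb hy))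
  have hψ1 : ∀ k, ContDiff ℝ 1 (ψ k) := by
    intro k
    rw [contDiff_iff_contDiffAt]
    intro x
    by_cases hx : x ∈ Ω
    · refine ContDiffAt.congr_of_eventuallyEq ?_ (hψe k x hx)
      exact (((hGc k).contDiffAt.comp x (hat x hx))).of_le (by norm_num)
    · have : ψ k =ᶠ[𝓝 x] fun _ => 0 := by
        filter_upwards [(hKclosed k).isOpen_compl.mem_nhds fun h => hx (hKΩ k h)] with y hy
        exact hψz k y hy
      exact contDiffAt_const.congr_of_eventuallyEq this
  have hψd : ∀ k, ∀ x ∈ Ω, fderiv ℝ (ψ k) x = deriv softId (N k * u x) • fderiv ℝ u x := by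
    intro k x hx
    rw [(hψe k x hx).fderiv_eq]
    exact ((hGd k (u x)).comp_hasFDerivAt x
      ((hat x hx).differentiableAt (by norm_num)).hasFDerivAt).fderiv
  have hψd0 : ∀ k, ∀ x ∉ Ω, fderiv ℝ (ψ k) x = 0 := by
    intro k x hx
    have : ψ k =ᶠ[𝓝 x] fun _ => 0 := by
      filter_upwards [(hKclosed k).isOpen_compl.mem_nhds fun h => hx (hKΩ k h)] with y hy
      exact hψz k y hy
    rw [this.fderiv_eq]; simp
  set F : ℕ → E2 → ℝ := fun k x => ∑ i : Fin 2, fderiv ℝ u x (EuclideanSpace.single i 1) *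
      fderiv ℝ (ψ k) x (EuclideanSpace.single i 1) with hF
  have hFin : ∀ k, ∀ x ∈ Ω, F k x = deriv softId (N k * u x) * ‖fderiv ℝ u x‖ ^ 2 := by
    intro k x hx
    rw [norm_sq_clm, Finset.mul_sum]
    simp only [hF, hψd k x hx]
    refine Finset.sum_congr rfl fun i _ => ?_
    simp only [_root_.smul_apply, smul_eq_mul]; ring
  have hFout : ∀ k, ∀ x ∉ Ω, F k x = 0 := by
    intro k x hx
    simp [hF, hψd0 k x hx]
  have hgrad : ∀ x ∈ Ω, ‖fderiv ℝ u x‖ ≤ K := fun x hx =>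
    norm_fderiv_le_of_lipschitzOn ℝ (mem_of_superset (hΩ.mem_nhds hx)
      (hΩb.trans ball_subset_closedBall)) hlip
  have hgreen : ∀ k, ∫ x in ball (0 : E2) 1, F k x = ∫ x in ball (0 : E2) 1, f x * ψ k x := by
    intro k
    rw [setIntegral_eq_integral_of_forall_compl_eq_zero fun x hx => hFout k x fun h => hx (hΩb h),
      setIntegral_eq_integral_of_forall_compl_eq_zero fun x hx => by
        rw [hψz k x fun h => hx (hΩb (hKΩ k h)), mul_zero],
      integral_fderiv_mul_fderiv hΩ hu (hψ1 k) (hcs k) ((hts k).trans (hKΩ k)), ← integral_neg]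
    refine integral_congr_ae (Eventually.of_forall fun x => ?_)
    by_cases hx : x ∈ Ω
    · simp only [← hf x hx]; ring
    · simp [hψz k x fun h => hx (hKΩ k h)]
  have hFm : ∀ k, AEStronglyMeasurable (F k) (volume.restrict (ball (0 : E2) 1)) := by
    intro k
    refine Continuous.aestronglyMeasurable ?_
    refine continuous_finsetSum _ fun i _ => ?_
    refine continuous_mul_of_tsupport_subset hΩ (fun x hx =>
      (hasFDerivAt_fderiv_apply (hat x hx) _).continuousAt.continuousWithinAt)
      (((hψ1 k).continuous_fderiv (by norm_num)).clm_apply continuous_const) ?_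
    refine (closure_minimal (fun x hx => ?_) (hKclosed k)).trans (hKΩ k)
    refine hts k (support_fderiv_subset ℝ (f := ψ k) fun h => hx ?_)
    simp [h]
  have hNt : Tendsto N atTop atTop := tendsto_atTop_add_const_right _ _ tendsto_natCast_atTop_atTop
  have lim1 : Tendsto (fun k => ∫ x in ball (0 : E2) 1, F k x) atTop
      (𝓝 (∫ x in ball (0 : E2) 1, ‖fderiv ℝ (fun y => max (u y) 0) x‖ ^ 2)) := by
    refine tendsto_integral_of_dominated_convergence (fun _ => CS * (K : ℝ) ^ 2) hFm
      (integrable_const _) (fun k => Eventually.of_forall fun x => ?_) ?_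
    · by_cases hx : x ∈ Ω
      · rw [hFin k x hx, Real.norm_eq_abs, abs_mul, abs_of_nonneg (sq_nonneg ‖fderiv ℝ u x‖)]
        gcongr
        · exact hCS _
        · exact hgrad x hx
      · rw [hFout k x hx, norm_zero]; positivity
    · filter_upwards [ae_restrict_mem measurableSet_ball] with x hx
      rcases lt_or_ge 0 (u x) with h | h
      · rw [fderiv_max_of_pos (hcat x hx) h]
        have h2 : ∀ᶠ k in atTop, 2 / u x < N k := hNt.eventually (eventually_gt_atTop _)
        refine tendsto_const_nhds.congr' ?_
        filter_upwards [h2] with k hk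
        rw [hFin k x (hpos x hx h), deriv_softId_of_gt (by rwa [div_lt_iff₀ h] at hk), one_mul]
      · rw [fderiv_max_of_nonpos h]
        refine tendsto_const_nhds.congr fun k => ?_
        by_cases hxΩ : x ∈ Ω
        · rw [hFin k x hxΩ, deriv_softId_of_lt (by nlinarith [hNpos k])]; simp
        · rw [hFout k x hxΩ]; simp
  have lim2 : Tendsto (fun k => ∫ x in ball (0 : E2) 1, f x * ψ k x) atTop
      (𝓝 (∫ x in ball (0 : E2) 1, f x * max (u x) 0)) := by
    refine tendsto_integral_of_dominated_convergence (fun _ => Cf * Cu) (fun k => ?_)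
      (integrable_const _) (fun k => ?_) ?_
    · exact ((hfc.mono ball_subset_closedBall).aestronglyMeasurable measurableSet_ball).mul
        (hψ1 k).continuous.aestronglyMeasurable
    · filter_upwards [ae_restrict_mem measurableSet_ball] with x hx
      have hx' := ball_subset_closedBall hx
      rw [norm_mul, hψin k x hx']
      have h1 : |softId (N k * u x)| ≤ N k * |u x| := by
        refine (abs_softId_le _).trans ?_
        rw [abs_mul, abs_of_pos (hNpos k)]
      have h2 : ‖G k (u x)‖ ≤ Cu := by
        refine le_trans ?_ (hCu x hx')
        simp only [hG, Real.norm_eq_abs, abs_mul, abs_inv, abs_of_pos (hNpos k)]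
        rwa [inv_mul_le_iff₀ (hNpos k)]
      exact mul_le_mul (hCf x hx') h2 (norm_nonneg _) ((norm_nonneg _).trans (hCf x hx'))
    · filter_upwards [ae_restrict_mem measurableSet_ball] with x hx
      refine Tendsto.const_mul _ ?_
      have hx' := ball_subset_closedBall hx
      rcases lt_or_ge 0 (u x) with h | h
      · rw [max_eq_left h.le]
        have h2 : ∀ᶠ k in atTop, 2 / u x < N k := hNt.eventually (eventually_gt_atTop _)
        refine tendsto_const_nhds.congr' ?_
        filter_upwards [h2] with k hk
        rw [hψin k x hx']
        simp only [hG]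
        rw [softId_of_ge (by rw [div_lt_iff₀ h] at hk; exact hk.le), inv_mul_cancel_left₀ (hNpos k).ne']
      · rw [max_eq_right h]
        refine tendsto_const_nhds.congr fun k => ?_
        rw [hψin k x hx']
        simp only [hG]
        rw [softId_of_le (by nlinarith [hNpos k]), mul_zero]
  exact tendsto_nhds_unique (lim1.congr hgreen) lim2

/-- The Dirichlet integral splits along positive and negative parts. -/
lemma integral_norm_fderiv_split {v : E2 → ℝ} {K : NNReal}
    (hlip : LipschitzOnWith K v (closedBall 0 1)) :
    ∫ x in ball (0 : E2) 1, ‖fderiv ℝ v x‖ ^ 2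
      = (∫ x in ball (0 : E2) 1, ‖fderiv ℝ (fun y => max (v y) 0) x‖ ^ 2)
        + ∫ x in ball (0 : E2) 1, ‖fderiv ℝ (fun y => max (-v y) 0) x‖ ^ 2 := by
  have := isFiniteMeasure_restrict_ball
  have hl : LipschitzOnWith K v (ball 0 1) := hlip.mono ball_subset_closedBall
  have hp : LipschitzOnWith K (fun y => max (v y) 0) (ball 0 1) := fun x hx y hy =>
    (LipschitzWith.id.max_const 0 (v x) (v y)).trans (by simpa using hl hx hy)
  have hl' : LipschitzOnWith K (fun y => -v y) (ball 0 1) := fun x hx y hy => by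
    simpa [edist_neg_neg] using hl hx hy
  have hm : LipschitzOnWith K (fun y => max (-v y) 0) (ball 0 1) := fun x hx y hy =>
    (LipschitzWith.id.max_const 0 (-v x) (-v y)).trans (by simpa using hl' hx hy)
  have hInt : ∀ {w : E2 → ℝ}, LipschitzOnWith K w (ball 0 1) →
      IntegrableOn (fun x => ‖fderiv ℝ w x‖ ^ 2) (ball (0 : E2) 1) := by
    intro w hw
    refine Integrable.of_bound (C := (K : ℝ) ^ 2)
      ((measurable_fderiv ℝ w).norm.pow_const 2).aestronglyMeasurable ?_
    filter_upwards [ae_restrict_mem measurableSet_ball] with x hx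
    rw [Real.norm_of_nonneg (sq_nonneg _)]
    gcongr
    exact norm_fderiv_le_of_lipschitzOn ℝ (isOpen_ball.mem_nhds hx) hw
  rw [← integral_add (hInt hp) (hInt hm)]
  refine integral_congr_ae ?_
  filter_upwards [ae_restrict_of_ae (hp.ae_differentiableWithinAt_of_mem (μ := volume)),
    ae_restrict_of_ae (hm.ae_differentiableWithinAt_of_mem (μ := volume)),
    ae_restrict_mem measurableSet_ball] with x h1 h2 hx
  have hc : ContinuousAt v x := hl.continuousOn.continuousAt (isOpen_ball.mem_nhds hx)
  have d1 := (h1 hx).differentiableAt (isOpen_ball.mem_nhds hx)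
  have d2 := (h2 hx).differentiableAt (isOpen_ball.mem_nhds hx)
  have hv : fderiv ℝ v x = fderiv ℝ (fun y => max (v y) 0) x - fderiv ℝ (fun y => max (-v y) 0) x := by
    rw [← fderiv_fun_sub d1 d2]
    congr 1
    ext y
    rcases le_total (v y) 0 with h | h <;> simp [h]
  rw [hv]
  rcases le_total (v x) 0 with h | h
  · rw [fderiv_max_of_nonpos h]; simp
  · rw [fderiv_max_of_nonpos (u := fun y => -v y) (by simpa using h)]; simp

/-- The coefficients of the entire function `besselH`. -/
def besselC (ν : ℝ) (k : ℕ) : ℝ := (-1 : ℝ) ^ k / (Nat.factorial k * Real.Gamma ((k : ℝ) + 1 + ν))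

/-- The entire function `h_ν` such that `J_ν(r) = r ^ ν h_ν(r² / 4)`. -/
def besselH (ν s : ℝ) : ℝ := ∑' k : ℕ, besselC ν k * s ^ k

lemma Gamma_one_add_le {ν : ℝ} (hν : 0 ≤ ν) (k : ℕ) :
    Real.Gamma (1 + ν) ≤ Real.Gamma ((k : ℝ) + 1 + ν) := by
  induction k with
  | zero => simp
  | succ k ih =>
    have h1 : ((k + 1 : ℕ) : ℝ) + 1 + ν = ((k : ℝ) + 1 + ν) + 1 := by push_cast; ring
    have hpos : (0 : ℝ) < (k : ℝ) + 1 + ν := by positivity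
    rw [h1, Real.Gamma_add_one hpos.ne']
    have h2 := Real.Gamma_pos_of_pos hpos
    have h3 : (1 : ℝ) ≤ (k : ℝ) + 1 + ν := by
      have : (0 : ℝ) ≤ k := k.cast_nonneg
      linarith
    nlinarith

lemma abs_besselC_le {ν : ℝ} (hν : 0 ≤ ν) (k : ℕ) :
    |besselC ν k| ≤ (Real.Gamma (1 + ν))⁻¹ * (Nat.factorial k : ℝ)⁻¹ := by
  have h0 : 0 < Real.Gamma (1 + ν) := Real.Gamma_pos_of_pos (by linarith)
  have h1 := Gamma_one_add_le hν k
  have h2 : (0 : ℝ) < Nat.factorial k := by exact_mod_cast Nat.factorial_pos k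
  rw [besselC, abs_div, abs_pow, abs_neg, abs_one, one_pow, abs_of_pos (by positivity),
    ← mul_inv, one_div, mul_comm (Real.Gamma (1 + ν))]
  gcongr

lemma summable_besselC {ν : ℝ} (hν : 0 ≤ ν) (s : ℝ) : Summable fun k => |besselC ν k| * |s| ^ k := by
  refine Summable.of_nonneg_of_le (fun k => by positivity) (fun k => ?_)
    ((Real.summable_pow_div_factorial |s|).mul_left (Real.Gamma (1 + ν))⁻¹)
  calc |besselC ν k| * |s| ^ k ≤ ((Real.Gamma (1 + ν))⁻¹ * (Nat.factorial k : ℝ)⁻¹) * |s| ^ k := by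
        gcongr; exact abs_besselC_le hν k
    _ = _ := by rw [div_eq_mul_inv]; ring

lemma summable_besselH {ν : ℝ} (hν : 0 ≤ ν) (s : ℝ) : Summable fun k => besselC ν k * s ^ k := by
  refine Summable.of_norm ?_
  simpa [norm_mul, Real.norm_eq_abs] using summable_besselC hν s

lemma besselC_succ {ν : ℝ} (hν : 0 ≤ ν) (k : ℕ) :
    besselC ν (k + 1) * ((k : ℝ) + 1) = -besselC (ν + 1) k := by
  have h1 : ((k + 1 : ℕ) : ℝ) + 1 + ν = (k : ℝ) + 1 + (ν + 1) := by push_cast; ring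
  have h3 : Real.Gamma ((k : ℝ) + 1 + (ν + 1)) ≠ 0 := (Real.Gamma_pos_of_pos (by positivity)).ne'
  rw [besselC, besselC, h1, Nat.factorial_succ]
  have h2 : (0 : ℝ) < Nat.factorial k := by exact_mod_cast Nat.factorial_pos k
  push_cast
  field_simp
  ring

lemma besselC_rec {ν : ℝ} (hν : 0 ≤ ν) (k : ℕ) :
    besselC ν k = (ν + 1 + k) * besselC (ν + 1) k := by
  have h1 : (k : ℝ) + 1 + (ν + 1) = ((k : ℝ) + 1 + ν) + 1 := by ring
  have hp : (0 : ℝ) < (k : ℝ) + 1 + ν := by positivity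
  have h3 : Real.Gamma ((k : ℝ) + 1 + ν) ≠ 0 := (Real.Gamma_pos_of_pos hp).ne'
  rw [besselC, besselC, h1, Real.Gamma_add_one hp.ne']
  have h2 : (0 : ℝ) < Nat.factorial k := by exact_mod_cast Nat.factorial_pos k
  have h4 : ν + 1 + (k : ℝ) = (k : ℝ) + 1 + ν := by ring
  rw [h4]
  field_simp

lemma hasDerivAt_besselH {ν : ℝ} (hν : 0 ≤ ν) (s : ℝ) :
    HasDerivAt (besselH ν) (-besselH (ν + 1) s) s := by
  have hν1 : 0 ≤ ν + 1 := by linarith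
  set M := |s| + 1
  set g' : ℕ → ℝ → ℝ := fun k t => besselC ν k * (k * t ^ (k - 1)) with hg'
  have hsucc : ∀ k t, g' (k + 1) t = -(besselC (ν + 1) k * t ^ k) := by
    intro k t
    have := besselC_succ hν k
    simp only [hg', Nat.add_sub_cancel]; push_cast
    linear_combination t ^ k * this
  have hsum : Summable fun k : ℕ => |besselC ν k| * (k * M ^ (k - 1)) := by
    rw [← summable_nat_add_iff 1]
    refine (summable_besselC hν1 M).congr fun k => ?_
    have := besselC_succ hν k
    have h2 : |besselC ν (k + 1)| * ((k : ℝ) + 1) = |besselC (ν + 1) k| := by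
      rw [← abs_of_nonneg (by positivity : (0 : ℝ) ≤ (k : ℝ) + 1), ← abs_mul, this, abs_neg]
    have hM : |M| = M := abs_of_nonneg (by positivity)
    rw [← h2, hM]; push_cast; ring
  have h := hasDerivAt_tsum_of_isPreconnected (u := fun k : ℕ => |besselC ν k| * (k * M ^ (k - 1)))
    (g := fun k t => besselC ν k * t ^ k) (g' := g') (t := ball 0 M) (y₀ := 0) (y := s) hsum
    isOpen_ball (convex_ball (0 : ℝ) M).isPreconnected
    (fun k t _ => (hasDerivAt_pow k t).const_mul _)
    (fun k t ht => by
      have h3 : |t| ≤ M := by simpa using (mem_ball_zero_iff.1 ht).le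
      simp only [hg', norm_mul, norm_pow, Real.norm_eq_abs, Nat.abs_cast]
      gcongr) (mem_ball_self (by positivity)) (summable_besselH hν 0)
    (by simp [M])
  have h2 : ∑' k, g' k s = -besselH (ν + 1) s := by
    have hs : Summable fun k => g' k s := by
      rw [← summable_nat_add_iff 1]
      exact ((summable_besselH hν1 s).neg).congr fun k => (hsucc k s).symm
    rw [hs.tsum_eq_zero_add]
    simp only [hsucc, tsum_neg]
    simp [hg', besselH]
  rw [h2] at h
  exact h

lemma besselH_rec {ν : ℝ} (hν : 0 ≤ ν) (s : ℝ) :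
    besselH ν s = (ν + 1) * besselH (ν + 1) s - s * besselH (ν + 2) s := by
  have hν1 : 0 ≤ ν + 1 := by linarith
  have hν2 : 0 ≤ ν + 2 := by linarith
  have e2 : ν + 1 + 1 = ν + 2 := by ring
  have h1 := summable_besselH hν s
  have h2 := (summable_besselH hν1 s).mul_left (ν + 1)
  have h3 := (summable_besselH hν2 s).mul_left s
  have h5 : ∀ k, besselC ν (k + 1) * s ^ (k + 1)
      = (ν + 1) * (besselC (ν + 1) (k + 1) * s ^ (k + 1)) - s * (besselC (ν + 2) k * s ^ k) := by
    intro k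
    have a1 := besselC_rec hν (k + 1)
    have a2 := besselC_succ hν1 k
    rw [e2] at a2
    rw [a1]; push_cast
    linear_combination s ^ (k + 1) * a2
  unfold besselH
  rw [← tsum_mul_left, ← tsum_mul_left, h1.tsum_eq_zero_add, h2.tsum_eq_zero_add]
  simp only [h5]
  rw [((summable_nat_add_iff 1).2 h2).tsum_sub h3, besselC_rec hν 0]
  simp
  ring

lemma besselH_zero_pos {ν : ℝ} (hν : 0 ≤ ν) : 0 < besselH ν 0 := by
  have : besselH ν 0 = besselC ν 0 := by
    unfold besselH
    rw [tsum_eq_single 0 fun k hk => by simp [hk]]; simp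
  rw [this, besselC]
  have := Real.Gamma_pos_of_pos (by linarith : 0 < 0 + 1 + ν)
  simp only [Nat.cast_zero]
  simpa using this

lemma continuous_besselH {ν : ℝ} (hν : 0 ≤ ν) : Continuous (besselH ν) :=
  continuous_iff_continuousAt.2 fun s => (hasDerivAt_besselH hν s).continuousAt

lemma contDiff_besselH {ν : ℝ} (hν : 0 ≤ ν) : ContDiff ℝ 2 (besselH ν) := by
  have hd : ∀ {ν : ℝ}, 0 ≤ ν → deriv (besselH ν) = fun s => -besselH (ν + 1) s := fun hν =>
    funext fun s => (hasDerivAt_besselH hν s).deriv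
  have h0 : ∀ {ν : ℝ}, 0 ≤ ν → ContDiff ℝ 1 (besselH ν) := fun {ν} hν => by
    rw [contDiff_one_iff_deriv]
    refine ⟨fun s => (hasDerivAt_besselH hν s).differentiableAt, ?_⟩
    rw [hd hν]; exact (continuous_besselH (by linarith)).neg
  rw [show (2 : WithTop ℕ∞) = 1 + 1 by norm_num, contDiff_succ_iff_deriv]
  refine ⟨fun s => (hasDerivAt_besselH hν s).differentiableAt, by simp, ?_⟩
  rw [hd hν]; exact (h0 (by linarith)).neg

lemma besselJ_eq (ν r : ℝ) : besselJ ν r = r ^ ν * besselH ν (r ^ 2 / 4) := by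
  unfold besselJ besselH besselC
  congr 1
  refine tsum_congr fun k => ?_
  rw [pow_mul]; congr 2; ring

/-- The radial factor `r ^ (γν) h_ν(μ r ^ (2γ))`. -/
def radR (γ μ ν r : ℝ) : ℝ := r ^ (γ * ν) * besselH ν (μ * r ^ (2 * γ))

/-- The function `r R'(r)` for `R = radR γ μ ν`. -/
def radQ (γ μ ν r : ℝ) : ℝ := γ * ν * radR γ μ ν r
  - 2 * γ * (μ * r ^ (2 * γ)) * (r ^ (γ * ν) * besselH (ν + 1) (μ * r ^ (2 * γ)))

lemma continuous_radR {γ ν : ℝ} (hγ : 0 < γ) (hν : 0 ≤ ν) (μ : ℝ) : Continuous (radR γ μ ν) := by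
  unfold radR
  refine (continuous_id.rpow_const fun _ => Or.inr (by positivity)).mul
    ((continuous_besselH hν).comp (continuous_const.mul
      (continuous_id.rpow_const fun _ => Or.inr (by positivity))))

lemma continuous_radQ {γ ν : ℝ} (hγ : 0 < γ) (hν : 0 ≤ ν) (μ : ℝ) : Continuous (radQ γ μ ν) := by
  unfold radQ
  have h1 : Continuous fun r : ℝ => r ^ (2 * γ) :=
    continuous_id.rpow_const fun _ => Or.inr (by positivity)
  have h2 : Continuous fun r : ℝ => r ^ (γ * ν) :=
    continuous_id.rpow_const fun _ => Or.inr (by positivity)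
  have h3 := (continuous_besselH (by linarith : 0 ≤ ν + 1)).comp (continuous_const.mul h1 : Continuous fun r : ℝ => μ * r ^ (2 * γ))
  exact (continuous_const.mul (continuous_radR hγ hν μ)).sub
    ((continuous_const.mul (continuous_const.mul h1)).mul (h2.mul h3))

lemma radQ_zero {γ ν : ℝ} (hγ : 0 < γ) (hν : 0 ≤ ν) (μ : ℝ) : radQ γ μ ν 0 = 0 := by
  unfold radQ radR
  rw [Real.zero_rpow (by positivity : 2 * γ ≠ 0)]
  rcases hν.eq_or_lt with h | h
  · simp [← h]
  · rw [Real.zero_rpow (by positivity : γ * ν ≠ 0)]; simp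

lemma hasDerivAt_rpow_mul_besselH {γ ν : ℝ} (hν : 0 ≤ ν) (μ a : ℝ) {r : ℝ} (hr : 0 < r) :
    HasDerivAt (fun r : ℝ => r ^ a * besselH ν (μ * r ^ (2 * γ)))
      ((a * (r ^ a * besselH ν (μ * r ^ (2 * γ)))
        - 2 * γ * (μ * r ^ (2 * γ)) * (r ^ a * besselH (ν + 1) (μ * r ^ (2 * γ)))) / r) r := by
  have h1 : HasDerivAt (fun r : ℝ => μ * r ^ (2 * γ)) (μ * (2 * γ * r ^ (2 * γ - 1))) r :=
    (Real.hasDerivAt_rpow_const (Or.inl hr.ne')).const_mul μ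
  have h2 : HasDerivAt (fun r : ℝ => r ^ a) (a * r ^ (a - 1)) r :=
    Real.hasDerivAt_rpow_const (Or.inl hr.ne')
  have h3 := h2.mul ((hasDerivAt_besselH hν (μ * r ^ (2 * γ))).comp r h1)
  refine h3.congr_deriv ?_
  simp only [Function.comp_apply]
  rw [Real.rpow_sub_one hr.ne', Real.rpow_sub_one hr.ne']
  field_simp
  ring

lemma hasDerivAt_radR {γ ν : ℝ} (hν : 0 ≤ ν) (μ : ℝ) {r : ℝ} (hr : 0 < r) :
    HasDerivAt (radR γ μ ν) (radQ γ μ ν r / r) r :=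
  hasDerivAt_rpow_mul_besselH hν μ (γ * ν) hr

lemma hasDerivAt_radQ {γ ν : ℝ} (hν : 0 ≤ ν) (μ : ℝ) {r : ℝ} (hr : 0 < r) :
    HasDerivAt (radQ γ μ ν)
      (((γ * ν) ^ 2 - (2 * γ) ^ 2 * μ * r ^ (2 * γ)) * radR γ μ ν r / r) r := by
  have h0 : HasDerivAt (fun r : ℝ => 2 * γ * (μ * r ^ (2 * γ)))
      (2 * γ * (μ * (2 * γ * r ^ (2 * γ - 1)))) r :=
    ((Real.hasDerivAt_rpow_const (Or.inl hr.ne')).const_mul μ).const_mul (2 * γ)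
  have h1 := hasDerivAt_rpow_mul_besselH (γ := γ) (by linarith : 0 ≤ ν + 1) μ (γ * ν) hr
  have h2 := ((hasDerivAt_radR (γ := γ) hν μ hr).const_mul (γ * ν)).sub (h0.mul h1)
  refine h2.congr_deriv ?_
  have hrec := besselH_rec hν (μ * r ^ (2 * γ))
  have e2 : ν + 1 + 1 = ν + 2 := by ring
  rw [e2, Real.rpow_sub_one hr.ne']
  simp only [radQ, radR]
  rw [hrec]
  field_simp
  ring

lemma besselJ_eq_radR {ν r : ℝ} : besselJ ν r = radR 1 (1 / 4) ν r := by
  rw [besselJ_eq, radR, one_mul, mul_one, Real.rpow_two]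
  congr 2; ring

/-- First zero of a continuous function that is positive at the origin. -/
lemma exists_first_zero {f : ℝ → ℝ} (hf : Continuous f) (h0 : 0 < f 0) {b : ℝ} (hb0 : 0 ≤ b)
    (hb : f b ≤ 0) : ∃ z ∈ Set.Ioc 0 b, f z = 0 ∧ ∀ s ∈ Set.Ico 0 z, 0 < f s := by
  have hcomp : IsCompact (Set.Icc 0 b ∩ f ⁻¹' Set.Iic 0) :=
    isCompact_Icc.inter_right (isClosed_Iic.preimage hf)
  obtain ⟨z, ⟨hz1, hz2⟩, hmin⟩ := hcomp.exists_isLeast ⟨b, ⟨hb0, le_rfl⟩, hb⟩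
  have hz0 : 0 < z := lt_of_le_of_ne hz1.1 fun h => by
    have h3 : f z ≤ 0 := hz2
    rw [← h] at h3; linarith
  have hlt : ∀ s ∈ Set.Ico 0 z, 0 < f s := fun s hs => by
    by_contra! h
    have := hmin ⟨⟨hs.1, hs.2.le.trans hz1.2⟩, h⟩
    linarith [hs.2]
  refine ⟨z, ⟨hz0, hz1.2⟩, le_antisymm hz2 ?_, hlt⟩
  refine ge_of_tendsto (hf.continuousAt.tendsto.mono_left (nhdsWithin_le_nhds (s := Set.Iio z))) ?_
  filter_upwards [Ioo_mem_nhdsLT hz0] with s hs using (hlt s ⟨hs.1.le, hs.2⟩).le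

/-- Sturm comparison between Bessel functions of different orders. -/
lemma sturm_bessel {μ ν Z : ℝ} (hμ : 0 ≤ μ) (hμν : μ < ν) (hZ : 0 < Z) (hz : besselH ν Z = 0)
    (hpos : ∀ s ∈ Set.Ico 0 Z, 0 < besselH ν s) : ∃ s ∈ Set.Ioo 0 Z, besselH μ s = 0 := by
  by_contra! hne
  have hν : 0 ≤ ν := hμ.trans hμν.le
  have hposμ : ∀ s ∈ Set.Ico 0 Z, 0 < besselH μ s := by
    intro s hs
    by_contra! h
    obtain ⟨z, hz1, hz2, -⟩ := exists_first_zero (continuous_besselH hμ) (besselH_zero_pos hμ) hs.1 h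
    exact hne z ⟨hz1.1, hz1.2.trans_lt hs.2⟩ hz2
  set b := 2 * √Z with hb
  have hb0 : 0 < b := by positivity
  have hbZ : 1 / 4 * b ^ 2 = Z := by rw [hb, mul_pow, Real.sq_sqrt hZ.le]; ring
  have harg : ∀ r ∈ Set.Ioo 0 b, (1 / 4 : ℝ) * r ^ (2 * (1 : ℝ)) ∈ Set.Ico 0 Z := by
    intro r hr
    rw [mul_one, Real.rpow_two, ← hbZ]
    refine ⟨by positivity, ?_⟩
    have := hr.1; have := hr.2
    gcongr
  have hRpos : ∀ r ∈ Set.Ioo 0 b, 0 < radR 1 (1 / 4) ν r ∧ 0 < radR 1 (1 / 4) μ r := fun r hr =>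
    ⟨mul_pos (Real.rpow_pos_of_pos hr.1 _) (hpos _ (harg r hr)),
      mul_pos (Real.rpow_pos_of_pos hr.1 _) (hposμ _ (harg r hr))⟩
  set T : ℝ → ℝ := fun r => radQ 1 (1 / 4) μ r * radR 1 (1 / 4) ν r
    - radR 1 (1 / 4) μ r * radQ 1 (1 / 4) ν r with hT
  have hTc : Continuous T :=
    ((continuous_radQ one_pos hμ _).mul (continuous_radR one_pos hν _)).sub
      ((continuous_radR one_pos hμ _).mul (continuous_radQ one_pos hν _))
  have hTd : ∀ r ∈ Set.Ioo 0 b, HasDerivAt T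
      ((μ ^ 2 - ν ^ 2) * (radR 1 (1 / 4) μ r * radR 1 (1 / 4) ν r) / r) r := by
    intro r hr
    have h := ((hasDerivAt_radQ (γ := 1) hμ (1 / 4) hr.1).mul (hasDerivAt_radR (γ := 1) hν (1 / 4) hr.1)).sub
      ((hasDerivAt_radR (γ := 1) hμ (1 / 4) hr.1).mul (hasDerivAt_radQ (γ := 1) hν (1 / 4) hr.1))
    refine h.congr_deriv ?_
    field_simp
    ring
  have hanti : StrictAntiOn T (Set.Icc 0 b) := by
    refine strictAntiOn_of_deriv_neg (convex_Icc 0 b) hTc.continuousOn fun r hr => ?_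
    rw [interior_Icc] at hr
    rw [(hTd r hr).deriv]
    obtain ⟨h1, h2⟩ := hRpos r hr
    have h3 : μ ^ 2 - ν ^ 2 < 0 := by nlinarith
    exact div_neg_of_neg_of_pos (mul_neg_of_neg_of_pos h3 (mul_pos h2 h1)) hr.1
  have hT0 : T 0 = 0 := by simp only [hT, radQ_zero one_pos hμ, radQ_zero one_pos hν]; ring
  have hTb : T b < 0 := by
    rw [← hT0]
    exact hanti ⟨le_rfl, hb0.le⟩ ⟨hb0.le, le_rfl⟩ hb0
  have hRb : radR 1 (1 / 4) ν b = 0 := by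
    rw [radR, mul_one, Real.rpow_two, hbZ, hz, mul_zero]
  have hRμ : 0 ≤ radR 1 (1 / 4) μ b := by
    refine ge_of_tendsto ((continuous_radR one_pos hμ _).continuousAt.tendsto.mono_left
      (nhdsWithin_le_nhds (s := Set.Iio b))) ?_
    filter_upwards [Ioo_mem_nhdsLT hb0] with s hs using (hRpos s hs).2.le
  have hQb : radQ 1 (1 / 4) ν b ≤ 0 := by
    have hd := (hasDerivAt_radR (γ := 1) hν (1 / 4) hb0)
    have hle : radQ 1 (1 / 4) ν b / b ≤ 0 := by
      have h1 := hd.hasDerivWithinAt (s := Set.Iio b)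
      rw [hasDerivWithinAt_iff_tendsto_slope' (by simp)] at h1
      refine le_of_tendsto h1 ?_
      filter_upwards [Ioo_mem_nhdsLT hb0] with s hs
      rw [slope_def_field, hRb]
      exact div_nonpos_of_nonneg_of_nonpos (by linarith [(hRpos s hs).1]) (by linarith [hs.2])
    rw [div_le_iff₀ hb0] at hle
    linarith
  have : T b = -(radR 1 (1 / 4) μ b * radQ 1 (1 / 4) ν b) := by simp only [hT, hRb]; ring
  nlinarith [mul_nonneg hRμ (neg_nonneg.2 hQb)]

/-- Larger order Bessel functions have no zero up to the first zero of a smaller order one. -/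
lemma besselH_pos_of_lt {ν κ Z : ℝ} (hν : 0 ≤ ν) (hκ : ν < κ)
    (hpos : ∀ s ∈ Set.Ico 0 Z, 0 < besselH ν s) {s : ℝ} (hs : s ∈ Set.Icc 0 Z) :
    0 < besselH κ s := by
  by_contra! h
  have hκ0 := hν.trans hκ.le
  obtain ⟨z, hz1, hz2, hz3⟩ := exists_first_zero (continuous_besselH hκ0) (besselH_zero_pos hκ0) hs.1 h
  obtain ⟨y, hy, hy2⟩ := sturm_bessel hν hκ hz1.1 hz2 hz3
  have := hpos y ⟨hy.1.le, hy.2.trans_le (hz1.2.trans hs.2)⟩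
  linarith

lemma isNthZero_one {ν z : ℝ} (hν : 0 ≤ ν) (h : IsNthZero ν 1 z) :
    besselH ν (z ^ 2 / 4) = 0 ∧ ∀ s ∈ Set.Ico 0 (z ^ 2 / 4), 0 < besselH ν s := by
  obtain ⟨hz, h0, hc⟩ := h
  have he : ∀ r, r ∈ Set.Ioo 0 z → besselJ ν r ≠ 0 := by
    simp only [Nat.sub_self, Nat.cast_zero, Set.encard_eq_zero, Set.eq_empty_iff_forall_notMem,
      Set.mem_ofPred_eq, not_and] at hc
    exact hc
  rw [besselJ_eq, mul_eq_zero, or_iff_right (Real.rpow_pos_of_pos hz _).ne'] at h0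
  refine ⟨h0, fun s hs => ?_⟩
  by_contra! hneg
  obtain ⟨y, hy, hy2, -⟩ := exists_first_zero (continuous_besselH hν) (besselH_zero_pos hν) hs.1 hneg
  refine he (2 * √y) ⟨by have := hy.1; positivity, ?_⟩ ?_
  · have h1 : y < (z / 2) ^ 2 := by
      have := hy.2.trans_lt hs.2
      rw [div_pow]; norm_num; linarith
    have := (Real.sqrt_lt' (by linarith)).2 h1
    linarith
  · rw [besselJ_eq, mul_pow, Real.sq_sqrt hy.1.le]
    rw [show (2 : ℝ) ^ 2 * y / 4 = y by ring, hy2, mul_zero]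

/-- The zeros of `J_0` below the first zero of `J_ν`, when this lies below the second zero
of `J_0`. -/
lemma exists_first_zero_besselH_zero {ν β z20 z : ℝ} (hν : 0 < ν) (hνβ : ν < β)
    (hz20 : IsNthZero 0 2 z20) (hβz : IsNthZero β 1 z20) (hz : IsNthZero ν 1 z) :
    ∃ Z0 ∈ Set.Ioo 0 (z ^ 2 / 4), besselH 0 Z0 = 0 ∧
      ∀ s ∈ Set.Icc 0 (z ^ 2 / 4), besselH 0 s = 0 → s = Z0 := by
  have hβ0 : 0 ≤ β := (hν.trans hνβ).le
  obtain ⟨b1, b2⟩ := isNthZero_one hβ0 hβz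
  obtain ⟨a1, a2⟩ := isNthZero_one hν.le hz
  have hz20' := hz20.1
  have hzpos := hz.1
  obtain ⟨Z0, hZ0, hZ0'⟩ := sturm_bessel le_rfl hν (by positivity) a1 a2
  obtain ⟨y, hy, hy'⟩ := sturm_bessel hν.le hνβ (by positivity) b1 b2
  have hle : z ^ 2 / 4 ≤ y := by
    by_contra! h
    have := a2 y ⟨hy.1.le, h⟩
    linarith
  have hlt : z ^ 2 / 4 < z20 ^ 2 / 4 := hle.trans_lt hy.2
  obtain ⟨-, -, hcard⟩ := hz20
  obtain ⟨w, hw⟩ := Set.encard_eq_one.1 (hcard.trans (by norm_num))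
  have huniq : ∀ s ∈ Set.Icc 0 (z ^ 2 / 4), besselH 0 s = 0 → 2 * √s = w := by
    intro s hs hs0
    have hspos : 0 < s := lt_of_le_of_ne hs.1 fun h => by
      rw [← h] at hs0; exact (besselH_zero_pos le_rfl).ne' hs0
    have : 2 * √s ∈ {r ∈ Set.Ioo 0 z20 | besselJ 0 r = 0} := by
      refine ⟨⟨by positivity, ?_⟩, ?_⟩
      · have h1 : s < (z20 / 2) ^ 2 := by
          have := hs.2.trans_lt hlt
          rw [div_pow]; norm_num; linarith
        have := (Real.sqrt_lt' (by linarith)).2 h1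
        linarith
      · rw [besselJ_eq, mul_pow, Real.sq_sqrt hs.1, show (2 : ℝ) ^ 2 * s / 4 = s by ring, hs0, mul_zero]
    rw [hw] at this
    exact this
  refine ⟨Z0, hZ0, hZ0', fun s hs hs0 => ?_⟩
  have h1 := huniq s hs hs0
  have h2 := huniq Z0 ⟨hZ0.1.le, hZ0.2.le⟩ hZ0'
  have h3 : √s = √Z0 := by linarith
  exact (Real.sqrt_inj hs.1 hZ0.1.le).1 h3

/-- The supremum of `|J_ν|` is attained before the first zero. -/
lemma exists_max_besselJ {ν z : ℝ} (hν : 0 < ν) (hz : IsNthZero ν 1 z) :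
    ∃ t ∈ Set.Ioo 0 z, 0 < besselJ ν t ∧ ∀ s, 0 ≤ s → |besselJ ν s| ≤ besselJ ν t := by
  obtain ⟨a1, a2⟩ := isNthZero_one hν.le hz
  have hz0 := hz.1
  have hJz := hz.2.1
  simp only [besselJ_eq_radR] at hJz ⊢
  set R := radR 1 (1 / 4) ν with hR
  set Q := radQ 1 (1 / 4) ν with hQ
  have hRc : Continuous R := continuous_radR one_pos hν.le _
  have hQc : Continuous Q := continuous_radQ one_pos hν.le _
  have hRd : ∀ r, 0 < r → HasDerivAt R (Q r / r) r := fun r hr => hasDerivAt_radR hν.le _ hr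
  have hQd : ∀ r, 0 < r → HasDerivAt Q ((ν ^ 2 - r ^ 2) * R r / r) r := fun r hr =>
    (hasDerivAt_radQ hν.le _ hr).congr_deriv (by
      rw [mul_one, Real.rpow_two]; ring)
  have hRpos : ∀ r ∈ Set.Ioo 0 z, 0 < R r := fun r hr => by
    refine mul_pos (Real.rpow_pos_of_pos hr.1 _) (a2 _ ?_)
    rw [mul_one, Real.rpow_two]
    have := hr.1; have := hr.2
    refine ⟨by positivity, ?_⟩
    have : r ^ 2 < z ^ 2 := by gcongr
    linarith
  have hR0 : R 0 = 0 := by simp [hR, radR, Real.zero_rpow hν.ne']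
  obtain ⟨t, ht, hmax⟩ := isCompact_Icc.exists_isMaxOn ⟨z / 2, by constructor <;> linarith⟩
    (hRc.continuousOn (s := Set.Icc 0 z))
  have hRt : 0 < R t :=
    (hRpos (z / 2) ⟨by linarith, by linarith⟩).trans_le (hmax ⟨by linarith, by linarith⟩)
  have ht0 : 0 < t := lt_of_le_of_ne ht.1 fun h => by rw [← h, hR0] at hRt; exact lt_irrefl _ hRt
  have htz : t < z := lt_of_le_of_ne ht.2 fun h => by rw [h, hJz] at hRt; exact lt_irrefl _ hRt
  have hloc : IsLocalMax R t := hmax.isLocalMax (Icc_mem_nhds ht0 htz)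
  have hQt : Q t = 0 := by
    have := hloc.hasDerivAt_eq_zero (hRd t ht0)
    rw [div_eq_zero_iff] at this
    exact this.resolve_right ht0.ne'
  have hνt : ν < t := by
    by_contra! h
    have hmono : StrictMonoOn Q (Set.Icc 0 t) := by
      refine strictMonoOn_of_deriv_pos (convex_Icc 0 t) hQc.continuousOn fun r hr => ?_
      rw [interior_Icc] at hr
      rw [(hQd r hr.1).deriv]
      have h1 := hRpos r ⟨hr.1, hr.2.trans htz⟩
      have h2 : 0 < ν ^ 2 - r ^ 2 := by nlinarith [hr.1, hr.2]
      have := hr.1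
      positivity
    have h3 := hmono ⟨le_rfl, ht0.le⟩ ⟨ht0.le, le_rfl⟩ ht0
    rw [hQt, hQ, radQ_zero one_pos hν.le] at h3
    exact lt_irrefl _ h3
  refine ⟨t, ⟨ht0, htz⟩, hRt, fun s hs => ?_⟩
  rcases le_total s t with hst | hst
  · have h1 : 0 ≤ R s := by
      rcases hs.eq_or_lt with h | h
      · rw [← h, hR0]
      · exact (hRpos s ⟨h, hst.trans_lt htz⟩).le
    rw [abs_of_nonneg h1]
    exact hmax ⟨hs, hst.trans htz.le⟩
  · set E : ℝ → ℝ := fun r => R r ^ 2 + Q r ^ 2 / (r ^ 2 - ν ^ 2) with hE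
    have hden : ∀ r, t ≤ r → 0 < r ^ 2 - ν ^ 2 := fun r hr => by nlinarith
    have hEd : ∀ r, t ≤ r → HasDerivAt E (-(2 * r * Q r ^ 2 / (r ^ 2 - ν ^ 2) ^ 2)) r := by
      intro r hr
      have hr0 := ht0.trans_le hr
      have h1 : HasDerivAt (fun r : ℝ => r ^ 2 - ν ^ 2) (2 * r) r := by
        simpa using (hasDerivAt_pow 2 r).sub_const (ν ^ 2)
      have h2 := ((hRd r hr0).pow 2).add (((hQd r hr0).pow 2).div h1 (hden r hr).ne')
      refine h2.congr_deriv ?_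
      have := (hden r hr).ne'
      simp only [Nat.add_one_sub_one, pow_one, Nat.cast_ofNat, Pi.pow_apply]
      field_simp
      ring
    have hanti : AntitoneOn E (Set.Ici t) := by
      refine antitoneOn_of_deriv_nonpos (convex_Ici t)
        (fun r hr => (hEd r hr).continuousAt.continuousWithinAt)
        (fun r hr => ?_) fun r hr => ?_
      · rw [interior_Ici] at hr
        exact (hEd r (le_of_lt hr)).differentiableAt.differentiableWithinAt
      · rw [interior_Ici] at hr
        rw [(hEd r (le_of_lt hr)).deriv]
        have : 0 < r := ht0.trans hr
        have : 0 ≤ 2 * r * Q r ^ 2 / (r ^ 2 - ν ^ 2) ^ 2 := by positivity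
        linarith
    have h1 : E s ≤ E t := hanti (Set.mem_Ici.2 le_rfl) hst hst
    have h2 : E t = R t ^ 2 := by simp [hE, hQt]
    have h3 : R s ^ 2 ≤ E s := by
      have := hden s hst
      simp only [hE]
      have : 0 ≤ Q s ^ 2 / (s ^ 2 - ν ^ 2) := by positivity
      linarith
    exact abs_le_of_sq_le_sq (by linarith) hRt.le

/-- The identification of the Euclidean plane with the complex plane. -/
def toC : E2 →L[ℝ] ℂ :=
  (EuclideanSpace.proj 0 : E2 →L[ℝ] ℝ).smulRight (1 : ℂ) +
    (EuclideanSpace.proj 1 : E2 →L[ℝ] ℝ).smulRight Complex.I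

lemma toC_apply (x : E2) : toC x = (x 0 : ℂ) + (x 1 : ℂ) * Complex.I := by
  simp [toC, Complex.real_smul]

lemma polar_zero (r θ : ℝ) : polar r θ 0 = r * Real.cos θ := by simp [polar]

lemma polar_one (r θ : ℝ) : polar r θ 1 = r * Real.sin θ := by simp [polar]

lemma toC_polar (r θ : ℝ) : toC (polar r θ) = r * Complex.exp (θ * Complex.I) := by
  rw [toC_apply, polar_zero, polar_one, Complex.exp_mul_I]
  push_cast; ring

lemma norm_polar (r θ : ℝ) : ‖polar r θ‖ = |r| := by
  have h : ‖polar r θ‖ ^ 2 = |r| ^ 2 := by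
    rw [norm_sq_E2, polar_zero, polar_one, sq_abs]
    linear_combination r ^ 2 * Real.sin_sq_add_cos_sq θ
  exact (sq_eq_sq₀ (norm_nonneg _) (abs_nonneg _)).1 h

lemma exists_eq_polar (x : E2) : ∃ θ, x = polar ‖x‖ θ := by
  refine ⟨Complex.arg (toC x), ?_⟩
  have hn : ‖toC x‖ = ‖x‖ := by
    have h : ‖toC x‖ ^ 2 = ‖x‖ ^ 2 := by
      rw [norm_sq_E2, toC_apply, ← Complex.normSq_eq_norm_sq, Complex.normSq_add_mul_I]
    exact (sq_eq_sq₀ (norm_nonneg _) (norm_nonneg _)).1 h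
  have h := Complex.norm_mul_exp_arg_mul_I (toC x)
  rw [hn, ← toC_polar] at h
  generalize Complex.arg (toC x) = φ at h ⊢
  rw [toC_apply, toC_apply] at h
  have h0 := congrArg Complex.re h
  have h1 := congrArg Complex.im h
  simp at h0 h1
  ext i
  fin_cases i
  · exact h0.symm
  · exact h1.symm

/-- The harmonic polynomial `r ^ n cos (nθ)`. -/
def harmRe (n : ℕ) (x : E2) : ℝ := (toC x ^ n).re

/-- The harmonic polynomial `r ^ n sin (nθ)`. -/
def harmIm (n : ℕ) (x : E2) : ℝ := (toC x ^ n).im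

lemma harmRe_polar (n : ℕ) (r θ : ℝ) : harmRe n (polar r θ) = r ^ n * Real.cos (n * θ) := by
  rw [harmRe, toC_polar, mul_pow, ← Complex.exp_nat_mul, ← Complex.ofReal_pow, Complex.re_ofReal_mul]
  congr 1
  rw [show (n : ℂ) * (θ * Complex.I) = ((n * θ : ℝ) : ℂ) * Complex.I by push_cast; ring,
    Complex.exp_ofReal_mul_I_re]

lemma contDiff_toC_pow (n : ℕ) {m : WithTop ℕ∞} : ContDiff ℝ m fun x : E2 => toC x ^ n :=
  toC.contDiff.pow n

lemma contDiff_harmRe (n : ℕ) {m : WithTop ℕ∞} : ContDiff ℝ m (harmRe n) :=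
  Complex.reCLM.contDiff.comp (contDiff_toC_pow n)

lemma hasFDerivAt_toC_pow (n : ℕ) (x : E2) :
    HasFDerivAt (fun x : E2 => toC x ^ n) (((n : ℂ) * toC x ^ (n - 1)) • toC) x := by
  have h := (hasDerivAt_pow n (toC x)).complexToReal_fderiv
  have h2 := HasFDerivAt.comp x h toC.hasFDerivAt
  refine h2.congr_fderiv ?_
  ext v
  simp [mul_comm]

lemma fderiv_harmRe_zero (n : ℕ) (x : E2) :
    fderiv ℝ (harmRe n) x (EuclideanSpace.single 0 1) = n * harmRe (n - 1) x := by
  have h := (Complex.reCLM.hasFDerivAt.comp x (hasFDerivAt_toC_pow n x)).fderiv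
  change fderiv ℝ (harmRe n) x = _ at h
  rw [h]
  simp [toC_apply, harmRe]

lemma fderiv_harmRe_one (n : ℕ) (x : E2) :
    fderiv ℝ (harmRe n) x (EuclideanSpace.single 1 1) = -(n * harmIm (n - 1) x) := by
  have h := (Complex.reCLM.hasFDerivAt.comp x (hasFDerivAt_toC_pow n x)).fderiv
  change fderiv ℝ (harmRe n) x = _ at h
  rw [h]
  simp [toC_apply, harmIm]

lemma fderiv_harmIm_one (n : ℕ) (x : E2) :
    fderiv ℝ (harmIm n) x (EuclideanSpace.single 1 1) = n * harmRe (n - 1) x := by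
  have h := (Complex.imCLM.hasFDerivAt.comp x (hasFDerivAt_toC_pow n x)).fderiv
  change fderiv ℝ (harmIm n) x = _ at h
  rw [h]
  simp [toC_apply, harmRe]

lemma lap_harmRe (n : ℕ) (x : E2) : lap (harmRe n) x = 0 := by
  rw [lap, Fin.sum_univ_two]
  simp only [fderiv_harmRe_zero, fderiv_harmRe_one]
  have h1 : fderiv ℝ (fun y => (n : ℝ) * harmRe (n - 1) y) x = (n : ℝ) • fderiv ℝ (harmRe (n - 1)) x :=
    congrFun (fderiv_const_smul_field (𝕜 := ℝ) (f := harmRe (n - 1)) (n : ℝ)) x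
  have h2 : fderiv ℝ (fun y => -((n : ℝ) * harmIm (n - 1) y)) x
      = (-(n : ℝ)) • fderiv ℝ (harmIm (n - 1)) x := by
    have := congrFun (fderiv_const_smul_field (𝕜 := ℝ) (f := harmIm (n - 1)) (-(n : ℝ))) x
    have e : (fun y => -((n : ℝ) * harmIm (n - 1) y)) = (-(n : ℝ)) • harmIm (n - 1) := by
      ext y; simp
    rw [e]; exact this
  rw [h1, h2]
  simp only [_root_.smul_apply, smul_eq_mul, fderiv_harmRe_zero, fderiv_harmIm_one]
  ring

lemma euler_harmRe {n : ℕ} (hn : 1 ≤ n) (x : E2) :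
    ∑ i : Fin 2, fderiv ℝ (harmRe n) x (EuclideanSpace.single i 1) * x i = n * harmRe n x := by
  rw [Fin.sum_univ_two, fderiv_harmRe_zero, fderiv_harmRe_one]
  obtain ⟨m, rfl⟩ : ∃ m, n = m + 1 := ⟨n - 1, by omega⟩
  simp only [Nat.add_sub_cancel, harmRe, harmIm, pow_succ, toC_apply, Complex.mul_re]
  simp
  ring

/-- The Laplacian of the product of a harmonic polynomial with a radial function. -/
lemma lap_harmRe_mul_radial {n : ℕ} (hn : 1 ≤ n) {g g' : ℝ → ℝ} {c : ℝ} {x : E2}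
    (hg : ∀ᶠ t in 𝓝 (‖x‖ ^ 2), HasDerivAt g (g' t) t) (hg' : HasDerivAt g' c (‖x‖ ^ 2)) :
    lap (fun y => harmRe n y * g (‖y‖ ^ 2)) x
      = harmRe n x * (4 * ‖x‖ ^ 2 * c + 4 * g' (‖x‖ ^ 2) + 4 * n * g' (‖x‖ ^ 2)) := by
  have hnd : ∀ y : E2, HasFDerivAt (fun y : E2 => ‖y‖ ^ 2) (2 • innerSL ℝ y) y := fun y =>
    (hasStrictFDerivAt_norm_sq y).hasFDerivAt
  have hin : ∀ (y : E2) (i : Fin 2), inner ℝ y (EuclideanSpace.single i (1 : ℝ)) = y i := by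
    intro y i
    simp [EuclideanSpace.inner_single_right]
  have hP : ∀ y, HasFDerivAt (harmRe n) (fderiv ℝ (harmRe n) y) y := fun y =>
    (((contDiff_harmRe n (m := 1)).differentiable (by norm_num)) y).hasFDerivAt
  have hcomp : ∀ y : E2, HasDerivAt g (g' (‖y‖ ^ 2)) (‖y‖ ^ 2) →
      HasFDerivAt (fun y : E2 => g (‖y‖ ^ 2)) (g' (‖y‖ ^ 2) • (2 • innerSL ℝ y)) y := fun y hy =>
    HasDerivAt.comp_hasFDerivAt y hy (hnd y)
  have hev : ∀ i : Fin 2, (fun y => fderiv ℝ (fun y : E2 => harmRe n y * g (‖y‖ ^ 2)) y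
      (EuclideanSpace.single i 1)) =ᶠ[𝓝 x]
      fun y => fderiv ℝ (harmRe n) y (EuclideanSpace.single i 1) * g (‖y‖ ^ 2)
        + harmRe n y * (g' (‖y‖ ^ 2) * (2 * y i)) := by
    intro i
    have hc : ContinuousAt (fun y : E2 => ‖y‖ ^ 2) x := by fun_prop
    filter_upwards [hc.eventually hg] with y hy
    have := ((hP y).mul (hcomp y hy)).fderiv
    have e : (harmRe n * fun y : E2 => g (‖y‖ ^ 2)) = fun y : E2 => harmRe n y * g (‖y‖ ^ 2) := rfl
    rw [e] at this
    rw [this]; simp [hin]; ring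
  have hcoord : ∀ i : Fin 2, HasFDerivAt (fun y : E2 => 2 * y i) ((2 : ℝ) • (EuclideanSpace.proj i : E2 →L[ℝ] ℝ)) x := by
    intro i
    exact ((EuclideanSpace.proj i : E2 →L[ℝ] ℝ).hasFDerivAt).const_mul 2
  have hg'c : HasFDerivAt (fun y : E2 => g' (‖y‖ ^ 2)) (c • (2 • innerSL ℝ x)) x :=
    HasDerivAt.comp_hasFDerivAt x hg' (hnd x)
  have hgx := hcomp x hg.self_of_nhds
  have key : ∀ i : Fin 2, fderiv ℝ (fun y => fderiv ℝ (fun y : E2 => harmRe n y * g (‖y‖ ^ 2)) y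
      (EuclideanSpace.single i 1)) x (EuclideanSpace.single i 1)
      = fderiv ℝ (fun y => fderiv ℝ (harmRe n) y (EuclideanSpace.single i 1)) x (EuclideanSpace.single i 1)
          * g (‖x‖ ^ 2)
        + 4 * g' (‖x‖ ^ 2) * (fderiv ℝ (harmRe n) x (EuclideanSpace.single i 1) * x i)
        + harmRe n x * (2 * g' (‖x‖ ^ 2) + 4 * c * x i ^ 2) := by
    intro i
    have hD : HasFDerivAt (fun y => fderiv ℝ (harmRe n) y (EuclideanSpace.single i 1))
        (fderiv ℝ (fun y => fderiv ℝ (harmRe n) y (EuclideanSpace.single i 1)) x) x :=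
      (hasFDerivAt_fderiv_apply (contDiff_harmRe n).contDiffAt _).differentiableAt.hasFDerivAt
    rw [(hev i).fderiv_eq]
    have h := ((hD.mul hgx).add ((hP x).mul (hg'c.mul (hcoord i)))).fderiv
    have e : ((fun y => fderiv ℝ (harmRe n) y (EuclideanSpace.single i 1)) * (fun y : E2 => g (‖y‖ ^ 2))
        + harmRe n * ((fun y : E2 => g' (‖y‖ ^ 2)) * fun y : E2 => 2 * y i))
        = fun y => fderiv ℝ (harmRe n) y (EuclideanSpace.single i 1) * g (‖y‖ ^ 2)
        + harmRe n y * (g' (‖y‖ ^ 2) * (2 * y i)) := rfl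
    rw [e] at h
    rw [h]
    simp [hin]
    ring
  have h1 := lap_harmRe n x
  have h2 := euler_harmRe hn x
  rw [lap, Fin.sum_univ_two] at h1 ⊢
  rw [Fin.sum_univ_two] at h2
  rw [key, key, norm_sq_E2]
  linear_combination g (x 0 ^ 2 + x 1 ^ 2) * h1 + 4 * g' (x 0 ^ 2 + x 1 ^ 2) * h2

/-- The model eigenfunction `R(r) cos (nθ)`. -/
def eigPhi (γ μ ν : ℝ) (n : ℕ) (x : E2) : ℝ :=
  harmRe n x * besselH ν (μ * (‖x‖ ^ 2) ^ γ)

section eigPhi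

variable {γ μ ν : ℝ} {n : ℕ}

lemma eigPhi_polar (hγν : γ * ν = n) {r : ℝ} (hr : 0 ≤ r) (θ : ℝ) :
    eigPhi γ μ ν n (polar r θ) = radR γ μ ν r * Real.cos (n * θ) := by
  rw [eigPhi, harmRe_polar, norm_polar, abs_of_nonneg hr, radR, hγν, Real.rpow_natCast,
    ← Real.rpow_natCast r 2, ← Real.rpow_mul hr]
  push_cast; ring

lemma contDiff_eigPhi (hγ : 1 ≤ γ) (hν : 0 ≤ ν) : ContDiff ℝ 1 (eigPhi γ μ ν n) := by
  refine (contDiff_harmRe n).mul (((contDiff_besselH hν).of_le (by norm_num)).comp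
    (contDiff_const.mul ?_))
  have : ContDiff ℝ 1 fun t : ℝ => t ^ γ := by
    exact_mod_cast Real.contDiff_rpow_const_of_le (n := 1) (by exact_mod_cast hγ)
  exact this.comp (contDiff_norm_sq ℝ)

lemma contDiffAt_eigPhi (hν : 0 ≤ ν) {x : E2} (hx : x ≠ 0) :
    ContDiffAt ℝ 2 (eigPhi γ μ ν n) x := by
  refine (contDiff_harmRe n).contDiffAt.mul ((contDiff_besselH hν).contDiffAt.comp x
    (contDiffAt_const.mul ?_))
  refine ContDiffAt.rpow_const_of_ne (contDiff_norm_sq ℝ).contDiffAt ?_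
  simpa using hx

lemma lap_eigPhi (hn : 1 ≤ n) (hγ : 0 < γ) (hν : 0 ≤ ν) (hγν : γ * ν = n) {x : E2} (hx : x ≠ 0) :
    -lap (eigPhi γ μ ν n) x = (2 * γ) ^ 2 * μ * ‖x‖ ^ (2 * γ - 2) * eigPhi γ μ ν n x := by
  have hq0 : 0 < ‖x‖ ^ 2 := by
    have := norm_pos_iff.2 hx
    positivity
  set g : ℝ → ℝ := fun q => besselH ν (μ * q ^ γ) with hg
  set g' : ℝ → ℝ := fun q => -besselH (ν + 1) (μ * q ^ γ) * (μ * (γ * q ^ (γ - 1))) with hg'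
  have hd1 : ∀ q : ℝ, 0 < q → HasDerivAt (fun q : ℝ => μ * q ^ γ) (μ * (γ * q ^ (γ - 1))) q :=
    fun q hq => (Real.hasDerivAt_rpow_const (Or.inl hq.ne')).const_mul μ
  have h1 : ∀ q, 0 < q → HasDerivAt g (g' q) q := fun q hq =>
    (hasDerivAt_besselH hν _).comp q (hd1 q hq)
  set q := ‖x‖ ^ 2 with hq
  have h2 : HasDerivAt g' (besselH (ν + 2) (μ * q ^ γ) * (μ * (γ * q ^ (γ - 1))) * (μ * (γ * q ^ (γ - 1)))
      + -besselH (ν + 1) (μ * q ^ γ) * (μ * (γ * ((γ - 1) * q ^ (γ - 1 - 1))))) q := by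
    have e2 : ν + 1 + 1 = ν + 2 := by ring
    have hd2 : HasDerivAt (fun q : ℝ => μ * (γ * q ^ (γ - 1))) (μ * (γ * ((γ - 1) * q ^ (γ - 1 - 1)))) q :=
      ((Real.hasDerivAt_rpow_const (Or.inl hq0.ne')).const_mul γ).const_mul μ
    have := (((hasDerivAt_besselH (by linarith : 0 ≤ ν + 1) (μ * q ^ γ)).comp q (hd1 q hq0)).neg).mul hd2
    rw [e2] at this
    refine this.congr_deriv ?_
    simp [Function.comp]
  have h3 := lap_harmRe_mul_radial hn (x := x)
    ((eventually_gt_nhds hq0).mono fun q hq => h1 q hq) h2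
  have e1 : ‖x‖ ^ (2 * γ - 2) = q ^ γ / q := by
    rw [Real.rpow_sub (norm_pos_iff.2 hx), hq, ← Real.rpow_natCast ‖x‖ 2, ← Real.rpow_mul (norm_nonneg _)]
    norm_num
  have hrec := besselH_rec hν (μ * q ^ γ)
  change lap (eigPhi γ μ ν n) x = _ at h3
  rw [h3, e1, ← hq, eigPhi, ← hq, hrec, ← hγν]
  simp only [hg']
  simp only [Real.rpow_sub_one hq0.ne']
  field_simp
  ring

lemma nInvariant_eigPhi (hn : 1 ≤ n) : nInvariant n (eigPhi γ μ ν n) := by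
  have hn0 : (n : ℂ) ≠ 0 := by exact_mod_cast (by omega : n ≠ 0)
  constructor
  · intro q
    have h1 : toC (reflX q) = starRingEnd ℂ (toC q) := by
      rw [toC_apply, toC_apply]
      simp [reflX]
    have h2 : ‖reflX q‖ ^ 2 = ‖q‖ ^ 2 := by
      rw [norm_sq_E2, norm_sq_E2]; simp [reflX]
    rw [eigPhi, eigPhi, h2, harmRe, harmRe, h1, ← map_pow, Complex.conj_re]
  · intro q
    have h1 : toC (rot2 (2 * π / n) q) = Complex.exp ((2 * π / n : ℝ) * Complex.I) * toC q := by
      generalize 2 * π / (n : ℝ) = φ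
      rw [toC_apply, toC_apply, Complex.exp_mul_I, ← Complex.ofReal_cos, ← Complex.ofReal_sin]
      simp only [rot2]
      apply Complex.ext <;> simp
      ring
    have h2 : ‖rot2 (2 * π / n) q‖ ^ 2 = ‖q‖ ^ 2 := by
      rw [norm_sq_E2, norm_sq_E2]; simp [rot2]
      linear_combination (q 0 ^ 2 + q 1 ^ 2) * Real.sin_sq_add_cos_sq (2 * π / n)
    rw [eigPhi, eigPhi, h2, harmRe, harmRe, h1, mul_pow, ← Complex.exp_nat_mul]
    have h3 : (n : ℂ) * ((2 * π / n : ℝ) * Complex.I) = 2 * π * Complex.I := by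
      push_cast; field_simp
    rw [h3, Complex.exp_two_pi_mul_I, one_mul]

lemma lipschitzOnWith_eigPhi (hγ : 1 ≤ γ) (hν : 0 ≤ ν) :
    ∃ K : NNReal, LipschitzOnWith K (eigPhi γ μ ν n) (closedBall 0 1) :=
  (contDiff_eigPhi hγ hν).contDiffOn.exists_lipschitzOnWith (by norm_num)
    (convex_closedBall 0 1) (isCompact_closedBall 0 1)

end eigPhi

lemma integrableOn_ball {f : E2 → ℝ} (hf : ContinuousOn f (closedBall 0 1)) :
    IntegrableOn f (ball 0 1) :=
  (hf.integrableOn_compact (isCompact_closedBall 0 1)).mono_set ball_subset_closedBall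

lemma continuous_norm_rpow {α : ℝ} (hα : 0 ≤ α) : Continuous fun x : E2 => ‖x‖ ^ α :=
  continuous_norm.rpow_const fun _ => Or.inr hα

lemma continuousOn_max_zero {g : E2 → ℝ} {s : Set E2} (hg : ContinuousOn g s) :
    ContinuousOn (fun x => max (g x) 0) s :=
  (continuous_id.max continuous_const).comp_continuousOn hg

lemma continuousOn_weight_mul_rpow {α q : ℝ} (hα : 0 ≤ α) (hq : 0 ≤ q) {g : E2 → ℝ} {s : Set E2}
    (hg : ContinuousOn g s) : ContinuousOn (fun x => ‖x‖ ^ α * g x ^ q) s :=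
  (continuous_norm_rpow hα).continuousOn.mul (hg.rpow_const fun _ _ => Or.inr hq)

lemma integral_ball_pos {f : E2 → ℝ} (hf : ContinuousOn f (closedBall 0 1))
    (h0 : ∀ x ∈ ball (0 : E2) 1, 0 ≤ f x) {x : E2} (hx : x ∈ ball (0 : E2) 1) (hfx : 0 < f x) :
    0 < ∫ x in ball (0 : E2) 1, f x := by
  rw [setIntegral_pos_iff_support_of_nonneg_ae
    ((ae_restrict_iff' measurableSet_ball).2 (Eventually.of_forall h0)) (integrableOn_ball hf)]
  have hcx : ContinuousAt f x :=
    hf.continuousAt (mem_of_superset (isOpen_ball.mem_nhds hx) ball_subset_closedBall)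
  have hn : Function.support f ∩ ball 0 1 ∈ 𝓝 x := by
    filter_upwards [hcx.eventually (eventually_gt_nhds hfx), isOpen_ball.mem_nhds hx] with y h1 h2
    exact ⟨h1.ne', h2⟩
  exact Measure.measure_pos_of_mem_nhds volume hn

lemma weight_integral_pos {α q : ℝ} (hα : 0 ≤ α) (hq : 0 ≤ q) {g : E2 → ℝ}
    (hg : ContinuousOn g (closedBall 0 1)) (h0 : ∀ x, 0 ≤ g x) {x : E2}
    (hx : x ∈ ball (0 : E2) 1) (hx0 : x ≠ 0) (hgx : 0 < g x) :
    0 < ∫ x in ball (0 : E2) 1, ‖x‖ ^ α * g x ^ q :=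
  integral_ball_pos (continuousOn_weight_mul_rpow hα hq hg)
    (fun y _ => mul_nonneg (Real.rpow_nonneg (norm_nonneg _) _) (Real.rpow_nonneg (h0 y) _)) hx
    (mul_pos (Real.rpow_pos_of_pos (norm_pos_iff.2 hx0) _) (Real.rpow_pos_of_pos hgx _))

lemma tendsto_weight_integral {α : ℝ} (hα : 0 ≤ α) {g : E2 → ℝ}
    (hg : ContinuousOn g (closedBall 0 1)) (h0 : ∀ x, 0 ≤ g x) :
    Tendsto (fun p : ℝ => ∫ x in ball (0 : E2) 1, ‖x‖ ^ α * g x ^ (p + 1)) (𝓝[>] 1)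
      (𝓝 (∫ x in ball (0 : E2) 1, ‖x‖ ^ α * g x ^ ((1 : ℝ) + 1))) := by
  have := isFiniteMeasure_restrict_ball
  obtain ⟨M, hM⟩ := (isCompact_closedBall (0 : E2) 1).exists_bound_of_continuousOn hg
  have hev : ∀ᶠ p : ℝ in 𝓝[>] 1, 1 < p ∧ p < 2 := by
    filter_upwards [self_mem_nhdsWithin, nhdsWithin_le_nhds (eventually_lt_nhds (by norm_num : (1:ℝ) < 2))]
      with p h1 h2
    exact ⟨h1, h2⟩
  refine tendsto_integral_filter_of_dominated_convergence (fun _ => (max M 1) ^ (3 : ℝ)) ?_ ?_ ?_ ?_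
  · filter_upwards [hev] with p hp
    exact ((continuousOn_weight_mul_rpow hα (by linarith : 0 ≤ p + 1) hg).mono
      ball_subset_closedBall).aestronglyMeasurable measurableSet_ball
  · filter_upwards [hev] with p hp
    refine (ae_restrict_iff' measurableSet_ball).2 (Eventually.of_forall fun x hx => ?_)
    have hx1 : ‖x‖ ≤ 1 := (mem_ball_zero_iff.1 hx).le
    have hgM : g x ≤ max M 1 :=
      ((le_abs_self _).trans (hM x (ball_subset_closedBall hx))).trans (le_max_left _ _)
    rw [Real.norm_of_nonneg (mul_nonneg (Real.rpow_nonneg (norm_nonneg _) _) (Real.rpow_nonneg (h0 x) _))]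
    calc ‖x‖ ^ α * g x ^ (p + 1) ≤ 1 * (max M 1) ^ (p + 1) := by
          refine mul_le_mul (Real.rpow_le_one (norm_nonneg _) hx1 hα)
            (Real.rpow_le_rpow (h0 x) hgM (by linarith)) (Real.rpow_nonneg (h0 x) _) zero_le_one
      _ ≤ (max M 1) ^ (3 : ℝ) := by
          rw [one_mul]
          exact Real.rpow_le_rpow_of_exponent_le (le_max_right _ _) (by linarith)
  · exact integrable_const _
  · refine Eventually.of_forall fun x => ?_
    have hc : Tendsto (fun p : ℝ => p + 1) (𝓝[>] 1) (𝓝 (1 + 1)) :=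
      tendsto_nhdsWithin_of_tendsto_nhds ((continuous_id.add continuous_const).tendsto 1)
    refine Tendsto.const_mul _ ?_
    exact (Real.continuousAt_const_rpow' (by norm_num : (1 : ℝ) + 1 ≠ 0)).tendsto.comp hc

/-- A solution of the Hénon problem is Lipschitz on the closed disc. -/
lemma IsHenonSol.lipschitz {α p : ℝ} (hα : 0 ≤ α) (hp : 1 ≤ p) {u : E2 → ℝ} (hu : IsHenonSol α p u) :
    ∃ K : NNReal, LipschitzOnWith K u (closedBall 0 1) := by
  obtain ⟨h2, hc, heq, h0⟩ := hu
  have hfc : ContinuousOn (fun x => ‖x‖ ^ α * |u x| ^ (p - 1) * u x) (closedBall 0 1) :=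
    (continuousOn_weight_mul_rpow hα (by linarith) hc.abs).mul hc
  obtain ⟨M, hM⟩ := (isCompact_closedBall (0 : E2) 1).exists_bound_of_continuousOn hfc
  have hL : 0 < max M 1 := by positivity
  have hlap : ∀ x ∈ ball (0 : E2) 1, |lap u x| ≤ max M 1 := fun x hx => by
    rw [← abs_neg, heq x hx]
    exact (hM x (ball_subset_closedBall hx)).trans (le_max_left _ _)
  refine ⟨(3 * max M 1).toNNReal, LipschitzOnWith.of_dist_le_mul fun x hx y hy => ?_⟩
  rw [Real.dist_eq, dist_eq_norm, Real.coe_toNNReal _ (by positivity)]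
  exact abs_sub_le_of_abs_lap_le hL h2 hc h0 hlap hx hy

lemma lap_neg (u : E2 → ℝ) (x : E2) : lap (fun y => -u y) x = -lap u x := by
  have := lap_const_mul (-1) u x
  simpa using this

lemma IsHenonSol.neg {α p : ℝ} {u : E2 → ℝ} (hu : IsHenonSol α p u) :
    IsHenonSol α p (fun x => -u x) := by
  obtain ⟨h2, hc, heq, h0⟩ := hu
  refine ⟨h2.neg, hc.neg, fun x hx => ?_, fun x hx => by simp [h0 x hx]⟩
  rw [lap_neg, heq x hx, abs_neg]; ring

lemma IsHenonSol.nehari_pos {α p : ℝ} (hα : 0 ≤ α) (hp : 1 ≤ p) {u : E2 → ℝ} (hu : IsHenonSol α p u) :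
    (∫ x in ball (0 : E2) 1, ‖fderiv ℝ (fun y => max (u y) 0) x‖ ^ 2)
      = ∫ x in ball (0 : E2) 1, ‖x‖ ^ α * (max (u x) 0) ^ (p + 1) := by
  obtain ⟨K, hK⟩ := hu.lipschitz hα hp
  obtain ⟨h2, hc, heq, h0⟩ := hu
  have hfc : ContinuousOn (fun x => ‖x‖ ^ α * |u x| ^ (p - 1) * u x) (closedBall 0 1) :=
    (continuousOn_weight_mul_rpow hα (by linarith) hc.abs).mul hc
  rw [integral_norm_fderiv_posPart isOpen_ball subset_rfl h2 hK h0 (fun x hx _ => hx) heq hfc]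
  refine integral_congr_ae (Eventually.of_forall fun x => ?_)
  simp only
  rcases le_or_gt (u x) 0 with h | h
  · rw [max_eq_right h, Real.zero_rpow (by linarith)]; ring
  · rw [max_eq_left h.le, abs_of_pos h, mul_assoc, mul_assoc]
    congr 1
    rw [show p + 1 = (p - 1) + 1 + 1 by ring, Real.rpow_add_one h.ne', Real.rpow_add_one h.ne']
    ring

/-- On the nodal Nehari set the energy is a multiple of the weighted norm. -/
lemma energy_eq_of_nehari {α p : ℝ} (hα : 0 ≤ α) (hp : 1 < p) {v : E2 → ℝ} {K : NNReal}
    (hlip : LipschitzOnWith K v (closedBall 0 1))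
    (h1 : (∫ x in ball (0 : E2) 1, ‖fderiv ℝ (fun y => max (v y) 0) x‖ ^ 2)
      = ∫ x in ball (0 : E2) 1, ‖x‖ ^ α * (max (v x) 0) ^ (p + 1))
    (h2 : (∫ x in ball (0 : E2) 1, ‖fderiv ℝ (fun y => max (-v y) 0) x‖ ^ 2)
      = ∫ x in ball (0 : E2) 1, ‖x‖ ^ α * (max (-v x) 0) ^ (p + 1)) :
    (∫ x in ball (0 : E2) 1, ‖x‖ ^ α * |v x| ^ (p + 1)) =
      (∫ x in ball (0 : E2) 1, ‖x‖ ^ α * (max (v x) 0) ^ (p + 1)) +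
        (∫ x in ball (0 : E2) 1, ‖x‖ ^ α * (max (-v x) 0) ^ (p + 1)) ∧
    energy α p v = (1 / 2 - 1 / (p + 1)) * ∫ x in ball (0 : E2) 1, ‖x‖ ^ α * |v x| ^ (p + 1) := by
  have hc := hlip.continuousOn
  have e : (∫ x in ball (0 : E2) 1, ‖x‖ ^ α * |v x| ^ (p + 1)) =
      (∫ x in ball (0 : E2) 1, ‖x‖ ^ α * (max (v x) 0) ^ (p + 1)) +
        (∫ x in ball (0 : E2) 1, ‖x‖ ^ α * (max (-v x) 0) ^ (p + 1)) := by
    have hq : 0 ≤ p + 1 := by linarith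
    have hcn : ContinuousOn (fun x => -v x) (closedBall 0 1) := hc.neg
    rw [← integral_add
      (integrableOn_ball (continuousOn_weight_mul_rpow hα hq (continuousOn_max_zero hc)))
      (integrableOn_ball (continuousOn_weight_mul_rpow hα hq (continuousOn_max_zero hcn)))]
    refine integral_congr_ae (Eventually.of_forall fun x => ?_)
    have hz : (0 : ℝ) ^ (p + 1) = 0 := Real.zero_rpow (by linarith)
    simp only
    rcases le_total (v x) 0 with h | h
    · rw [max_eq_right h, max_eq_left (by linarith), abs_of_nonpos h, hz]; ring
    · rw [max_eq_left h, max_eq_right (by linarith), abs_of_nonneg h, hz]; ring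
  refine ⟨e, ?_⟩
  rw [energy, integral_norm_fderiv_split hlip, h1, h2, ← e]
  ring

lemma nInvariant.comp {n : ℕ} {u : E2 → ℝ} (hu : nInvariant n u) (f : ℝ → ℝ) :
    nInvariant n (fun x => f (u x)) :=
  ⟨fun q => congrArg f (hu.1 q), fun q => congrArg f (hu.2 q)⟩

lemma max_combination {a s t : ℝ} (hs : 0 < s) (ht : 0 < t) :
    max (t * max a 0 - s * max (-a) 0) 0 = t * max a 0 := by
  rcases le_total a 0 with h | h
  · rw [max_eq_right h, max_eq_left (by linarith : 0 ≤ -a)]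
    have : 0 ≤ s * -a := mul_nonneg hs.le (by linarith)
    rw [max_eq_right (by linarith)]; ring
  · rw [max_eq_left h, max_eq_right (by linarith : -a ≤ 0)]
    have : 0 ≤ t * a := mul_nonneg ht.le h
    rw [max_eq_left (by linarith)]; ring

/-- Scaling the positive part of an eigenfunction onto the Nehari set. -/
lemma nehari_scale {α p lam A A1 t : ℝ} (ht : 0 < t) {u : E2 → ℝ}
    (hu : ∫ x in ball (0 : E2) 1, ‖fderiv ℝ (fun y => max (u y) 0) x‖ ^ 2 = lam * A1)
    (hA : A = ∫ x in ball (0 : E2) 1, ‖x‖ ^ α * (max (u x) 0) ^ (p + 1))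
    (htA : t ^ (p - 1) * A = lam * A1) :
    (∫ x in ball (0 : E2) 1, ‖fderiv ℝ (fun y => t * max (u y) 0) x‖ ^ 2)
      = t ^ 2 * (lam * A1) ∧
    (∫ x in ball (0 : E2) 1, ‖x‖ ^ α * (t * max (u x) 0) ^ (p + 1)) = t ^ 2 * (lam * A1) := by
  constructor
  · rw [← hu, ← integral_const_mul]
    refine integral_congr_ae (Eventually.of_forall fun x => ?_)
    have : fderiv ℝ (fun y => t * max (u y) 0) x = t • fderiv ℝ (fun y => max (u y) 0) x :=
      congrFun (fderiv_const_smul_field (𝕜 := ℝ) (f := fun y => max (u y) 0) t) x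
    simp only [this, norm_smul, mul_pow, Real.norm_eq_abs, sq_abs]
  · rw [← htA, hA, ← integral_const_mul, ← integral_const_mul]
    refine integral_congr_ae (Eventually.of_forall fun x => ?_)
    simp only
    rw [Real.mul_rpow ht.le (le_max_right _ _), show p + 1 = (p - 1) + 2 by ring, Real.rpow_add ht]
    norm_num
    ring

set_option maxHeartbeats 400000 in
/-- Least energy nodal solutions have asymptotically controlled weighted norm. -/
lemma weight_integral_le {α γ ν Z : ℝ} {n : ℕ} (hα : 0 ≤ α) (hαγ : α = 2 * γ - 2) (hn : 1 ≤ n)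
    (hν : 0 ≤ ν) (hγν : γ * ν = n) (hZ : 0 < Z) (hZ0 : besselH ν Z = 0)
    (hpos : ∀ s ∈ Set.Ico 0 Z, 0 < besselH ν s) :
    ∃ C : ℝ, 0 < C ∧ ∃ ρ : ℝ → ℝ, Tendsto ρ (𝓝[>] 1) (𝓝 ((2 * γ) ^ 2 * Z)) ∧
      ∀ p, 1 < p → 0 < ρ p ∧ ∀ U, IsLeastEnergyNInvNodal α p n U →
        (∫ x in ball (0 : E2) 1, ‖x‖ ^ α * |U x| ^ (p + 1)) ≤ C * ρ p ^ (2 / (p - 1)) := by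
  have hγ : 1 ≤ γ := by linarith
  obtain ⟨Φ, hΦ⟩ : ∃ Φ, Φ = eigPhi γ Z ν n := ⟨_, rfl⟩
  set lam := (2 * γ) ^ 2 * Z with hlam
  have hlam0 : 0 < lam := by positivity
  obtain ⟨K, hK⟩ := lipschitzOnWith_eigPhi (γ := γ) (μ := Z) (n := n) hγ hν
  rw [← hΦ] at hK
  have hK' : LipschitzOnWith K (fun x => -Φ x) (closedBall 0 1) := fun x hx y hy => by
    simpa [edist_neg_neg] using hK hx hy
  have hc := hK.continuousOn
  have hcn : ContinuousOn (fun x => -Φ x) (closedBall 0 1) := hK'.continuousOn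
  have hbdry : ∀ x : E2, ‖x‖ = 1 → Φ x = 0 := fun x hx => by
    rw [hΦ, eigPhi, hx]; simp [hZ0]
  have hΩ : IsOpen (ball (0 : E2) 1 \ {0}) := isOpen_ball.sdiff isClosed_singleton
  have hzero : Φ 0 = 0 := by
    have h0 : toC 0 = 0 := map_zero _
    rw [hΦ, eigPhi, harmRe, h0, zero_pow (by omega)]; simp
  have hgrad : ∀ v : E2 → ℝ, (v = Φ ∨ v = fun x => -Φ x) →
      ∫ x in ball (0 : E2) 1, ‖fderiv ℝ (fun y => max (v y) 0) x‖ ^ 2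
        = lam * ∫ x in ball (0 : E2) 1, ‖x‖ ^ α * (max (v x) 0) ^ ((1 : ℝ) + 1) := by
    intro v hv
    have hvK : LipschitzOnWith K v (closedBall 0 1) := by
      rcases hv with rfl | rfl
      exacts [hK, hK']
    have hv0 : ∀ x : E2, ‖x‖ = 1 → v x = 0 := by
      rcases hv with rfl | rfl
      exacts [hbdry, fun x hx => by simp [hbdry x hx]]
    have hvz : v 0 = 0 := by
      rcases hv with rfl | rfl
      exacts [hzero, by simp [hzero]]
    have hv2 : ContDiffOn ℝ 2 v (ball (0 : E2) 1 \ {0}) := by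
      intro x hx
      rcases hv with rfl | rfl
      · exact (hΦ ▸ contDiffAt_eigPhi hν hx.2 : ContDiffAt ℝ 2 v x).contDiffWithinAt
      · exact (hΦ ▸ contDiffAt_eigPhi hν hx.2 : ContDiffAt ℝ 2 Φ x).neg.contDiffWithinAt
    have hveq : ∀ x ∈ ball (0 : E2) 1 \ {0}, -lap v x = lam * ‖x‖ ^ α * v x := by
      intro x hx
      have h := lap_eigPhi (μ := Z) hn (by linarith) hν hγν hx.2
      rw [← hαγ, ← hΦ] at h
      rcases hv with rfl | rfl
      · exact h
      · rw [lap_neg, h]; ring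
    rw [integral_norm_fderiv_posPart (f := fun x => lam * ‖x‖ ^ α * v x) hΩ Set.sdiff_subset hv2 hvK hv0
      (fun x hx hp => ⟨hx, fun h => by rw [Set.mem_singleton_iff.1 h, hvz] at hp; exact hp.false⟩) hveq
      ((continuous_const.mul (continuous_norm_rpow hα)).continuousOn.mul hvK.continuousOn),
      ← integral_const_mul]
    refine integral_congr_ae (Eventually.of_forall fun x => ?_)
    simp only
    have e : max (v x) 0 ^ ((1 : ℝ) + 1) = v x * max (v x) 0 := by
      rw [show (1 : ℝ) + 1 = ((2 : ℕ) : ℝ) by norm_num, Real.rpow_natCast]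
      rcases le_total (v x) 0 with h | h
      · rw [max_eq_right h]; ring
      · rw [max_eq_left h]; ring
    rw [e]; ring
  have hhalf : 0 < radR γ Z ν (1 / 2) := by
    refine mul_pos (by positivity) (hpos _ ⟨by positivity, ?_⟩)
    have : ((1 : ℝ) / 2) ^ (2 * γ) < 1 := Real.rpow_lt_one (by norm_num) (by norm_num) (by linarith)
    nlinarith
  have hxp : 0 < Φ (polar (1 / 2) 0) := by
    rw [hΦ, eigPhi_polar hγν (by norm_num)]; simpa using hhalf
  have hxn : 0 < -Φ (polar (1 / 2) (π / n)) := by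
    have : (n : ℝ) * (π / n) = π := by
      have : (n : ℝ) ≠ 0 := by exact_mod_cast (by omega : n ≠ 0)
      field_simp
    rw [hΦ, eigPhi_polar hγν (by norm_num), this]; simpa using hhalf
  have hmem : ∀ θ, polar (1 / 2) θ ∈ ball (0 : E2) 1 := fun θ => by
    rw [mem_ball_zero_iff, norm_polar]; norm_num [abs_of_pos]
  have hne : ∀ θ, polar (1 / 2) θ ≠ 0 := fun θ => by
    rw [← norm_pos_iff, norm_polar]; norm_num
  set Ap : ℝ → ℝ := fun p => ∫ x in ball (0 : E2) 1, ‖x‖ ^ α * (max (Φ x) 0) ^ (p + 1) with hAp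
  set Am : ℝ → ℝ := fun p => ∫ x in ball (0 : E2) 1, ‖x‖ ^ α * (max (-Φ x) 0) ^ (p + 1) with hAm
  have hAp0 : ∀ p, 1 ≤ p → 0 < Ap p := fun p hp =>
    weight_integral_pos (g := fun x => max (Φ x) 0) hα (by linarith) (continuousOn_max_zero hc) (fun _ => le_max_right _ _)
      (hmem 0) (hne 0) (lt_max_of_lt_left hxp)
  have hAm0 : ∀ p, 1 ≤ p → 0 < Am p := fun p hp =>
    weight_integral_pos (g := fun x => max (-Φ x) 0) hα (by linarith) (continuousOn_max_zero hcn) (fun _ => le_max_right _ _)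
      (hmem (π / n)) (hne _) (lt_max_of_lt_left hxn)
  have hApt : Tendsto Ap (𝓝[>] 1) (𝓝 (Ap 1)) :=
    tendsto_weight_integral hα (continuousOn_max_zero hc) (fun _ => le_max_right _ _)
  have hAmt : Tendsto Am (𝓝[>] 1) (𝓝 (Am 1)) :=
    tendsto_weight_integral hα (continuousOn_max_zero hcn) (fun _ => le_max_right _ _)
  set ρp : ℝ → ℝ := fun p => lam * Ap 1 / Ap p with hρp
  set ρm : ℝ → ℝ := fun p => lam * Am 1 / Am p with hρm
  have hρpt : Tendsto ρp (𝓝[>] 1) (𝓝 lam) := by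
    have := (tendsto_const_nhds (x := lam * Ap 1)).div hApt (hAp0 1 le_rfl).ne'
    rwa [mul_div_cancel_right₀ _ (hAp0 1 le_rfl).ne'] at this
  have hρmt : Tendsto ρm (𝓝[>] 1) (𝓝 lam) := by
    have := (tendsto_const_nhds (x := lam * Am 1)).div hAmt (hAm0 1 le_rfl).ne'
    rwa [mul_div_cancel_right₀ _ (hAm0 1 le_rfl).ne'] at this
  have hA1 := hAp0 1 le_rfl
  have hA2 := hAm0 1 le_rfl
  refine ⟨lam * (Ap 1 + Am 1), by positivity, fun p => max (ρp p) (ρm p), ?_, fun p hp => ?_⟩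
  · simpa using hρpt.max hρmt
  have hp1 := hAp0 p hp.le
  have hm1 := hAm0 p hp.le
  have hρp0 : 0 < ρp p := by positivity
  have hρm0 : 0 < ρm p := by positivity
  have hp' : p - 1 ≠ 0 := by linarith
  refine ⟨lt_max_of_lt_left hρp0, fun U hU => ?_⟩
  obtain ⟨hsol, -, -, -, -, hmin⟩ := hU
  set t := ρp p ^ (1 / (p - 1)) with ht
  set s := ρm p ^ (1 / (p - 1)) with hs
  have ht0 : 0 < t := by positivity
  have hs0 : 0 < s := by positivity
  have htp : t ^ (p - 1) = ρp p := by
    rw [ht, ← Real.rpow_mul hρp0.le, one_div_mul_cancel hp', Real.rpow_one]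
  have hsp : s ^ (p - 1) = ρm p := by
    rw [hs, ← Real.rpow_mul hρm0.le, one_div_mul_cancel hp', Real.rpow_one]
  obtain ⟨hp2, hp3⟩ := nehari_scale (α := α) (A := Ap p) ht0 (hgrad Φ (Or.inl rfl)) rfl
    (by rw [htp]; exact div_mul_cancel₀ _ hp1.ne')
  obtain ⟨hm2, hm3⟩ := nehari_scale (α := α) (A := Am p) hs0 (hgrad (fun x => -Φ x) (Or.inr rfl)) rfl
    (by rw [hsp]; exact div_mul_cancel₀ _ hm1.ne')
  set v : E2 → ℝ := fun x => t * max (Φ x) 0 - s * max (-Φ x) 0 with hv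
  have hvp : ∀ x, max (v x) 0 = t * max (Φ x) 0 := fun x => max_combination hs0 ht0
  have hvm : ∀ x, max (-v x) 0 = s * max (-Φ x) 0 := fun x => by
    have := max_combination (a := -Φ x) ht0 hs0
    rw [neg_neg] at this
    rw [← this, hv]; congr 1; ring
  have hvlip : ∃ K : NNReal, LipschitzOnWith K v (closedBall 0 1) := by
    have hF : LipschitzWith (t.toNNReal + s.toNNReal) (fun a : ℝ => t * max a 0 - s * max (-a) 0) := by
      refine LipschitzWith.of_dist_le_mul fun a b => ?_
      rw [Real.dist_eq, Real.dist_eq, NNReal.coe_add, Real.coe_toNNReal _ ht0.le, Real.coe_toNNReal _ hs0.le]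
      have h1 := abs_max_sub_max_le_abs a b 0
      have h2 := abs_max_sub_max_le_abs (-a) (-b) 0
      rw [show -a - -b = -(a - b) by ring, abs_neg] at h2
      calc |t * max a 0 - s * max (-a) 0 - (t * max b 0 - s * max (-b) 0)|
          = |t * (max a 0 - max b 0) - s * (max (-a) 0 - max (-b) 0)| := by congr 1; ring
        _ ≤ |t * (max a 0 - max b 0)| + |s * (max (-a) 0 - max (-b) 0)| := abs_sub _ _
        _ ≤ (t + s) * |a - b| := by
            rw [abs_mul, abs_mul, abs_of_pos ht0, abs_of_pos hs0]
            nlinarith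
    exact ⟨_, hF.comp_lipschitzOnWith hK⟩
  obtain ⟨Kv, hKv⟩ := hvlip
  have hN1 : (∫ x in ball (0 : E2) 1, ‖fderiv ℝ (fun y => max (v y) 0) x‖ ^ 2)
      = ∫ x in ball (0 : E2) 1, ‖x‖ ^ α * (max (v x) 0) ^ (p + 1) := by
    simp only [hvp]; rw [hp2, hp3]
  have hN2 : (∫ x in ball (0 : E2) 1, ‖fderiv ℝ (fun y => max (-v y) 0) x‖ ^ 2)
      = ∫ x in ball (0 : E2) 1, ‖x‖ ^ α * (max (-v x) 0) ^ (p + 1) := by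
    simp only [hvm]; rw [hm2, hm3]
  have hcomp : IsNehariCompetitor α p n v := by
    refine ⟨(hΦ ▸ nInvariant_eigPhi hn : nInvariant n Φ).comp fun a => t * max a 0 - s * max (-a) 0, ⟨Kv, hKv⟩, fun x hx => ?_,
      ⟨_, hmem 0, ?_⟩, ⟨_, hmem (π / n), ?_⟩, hN1, hN2⟩
    · simp [hv, hbdry x hx]
    · have := hvp (polar (1 / 2) 0)
      rw [max_eq_left hxp.le] at this
      by_contra hcon
      rw [max_eq_right (not_lt.1 hcon)] at this
      exact (mul_pos ht0 hxp).ne this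
    · have := hvm (polar (1 / 2) (π / n))
      rw [max_eq_left hxn.le] at this
      by_contra hcon
      rw [max_eq_right (by linarith)] at this
      exact (mul_pos hs0 hxn).ne this
  obtain ⟨KU, hKU⟩ := hsol.lipschitz hα hp.le
  obtain ⟨-, hEU⟩ := energy_eq_of_nehari hα hp hKU (hsol.nehari_pos hα hp.le) (hsol.neg.nehari_pos hα hp.le)
  obtain ⟨hsum, hEv⟩ := energy_eq_of_nehari hα hp hKv hN1 hN2
  have hle := hmin v hcomp
  have hcoef : 0 < 1 / 2 - 1 / (p + 1) := by
    rw [sub_pos]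
    exact one_div_lt_one_div_of_lt (by norm_num) (by linarith)
  rw [hEU, hEv] at hle
  have hle' := le_of_mul_le_mul_left hle hcoef
  refine hle'.trans ?_
  rw [hsum]
  simp only [hvp, hvm]
  rw [hp3, hm3]
  have hsq : ∀ a : ℝ, 0 < a → (a ^ (1 / (p - 1))) ^ 2 = a ^ (2 / (p - 1)) := fun a ha => by
    rw [← Real.rpow_natCast, ← Real.rpow_mul ha.le]; congr 1; push_cast; ring
  rw [ht, hs, hsq _ hρp0, hsq _ hρm0]
  have hq : 0 ≤ 2 / (p - 1) := div_nonneg (by norm_num) (by linarith)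
  have b1 := Real.rpow_le_rpow hρp0.le (le_max_left (ρp p) (ρm p)) hq
  have b2 := Real.rpow_le_rpow hρm0.le (le_max_right (ρp p) (ρm p)) hq
  have c1 := mul_le_mul_of_nonneg_right b1 (mul_pos hlam0 hA1).le
  have c2 := mul_le_mul_of_nonneg_right b2 (mul_pos hlam0 hA2).le
  change ρp p ^ (2 / (p - 1)) * (lam * Ap 1) + ρm p ^ (2 / (p - 1)) * (lam * Am 1) ≤ _
  linarith

lemma abs_le_supN {u : E2 → ℝ} (hc : ContinuousOn u (closedBall 0 1)) {x : E2}
    (hx : x ∈ closedBall (0 : E2) 1) : |u x| ≤ supN u :=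
  le_csSup ((isCompact_closedBall 0 1).image_of_continuousOn hc.abs).bddAbove ⟨x, hx, rfl⟩

lemma exists_abs_eq_supN {u : E2 → ℝ} (hc : ContinuousOn u (closedBall 0 1)) :
    ∃ x ∈ closedBall (0 : E2) 1, |u x| = supN u := by
  have h := ((isCompact_closedBall (0 : E2) 1).image_of_continuousOn hc.abs).sSup_mem
    ⟨_, 0, by simp, rfl⟩
  exact h

/-- A nodal solution normalized to have supremum norm `1`, with multiplier `Λ`. -/
structure IsScaledSol (α p Λ : ℝ) (n : ℕ) (w : E2 → ℝ) : Prop where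
  contDiffOn : ContDiffOn ℝ 2 w (ball 0 1)
  continuousOn : ContinuousOn w (closedBall 0 1)
  eq : ∀ x ∈ ball (0 : E2) 1, -lap w x = Λ * ‖x‖ ^ α * |w x| ^ (p - 1) * w x
  bdry : ∀ x : E2, ‖x‖ = 1 → w x = 0
  abs_le : ∀ x ∈ closedBall (0 : E2) 1, |w x| ≤ 1
  exists_abs_eq : ∃ x ∈ closedBall (0 : E2) 1, |w x| = 1
  inv : nInvariant n w
  exists_pos : ∃ x ∈ ball (0 : E2) 1, 0 < w x
  exists_neg : ∃ x ∈ ball (0 : E2) 1, w x < 0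

lemma supN_pos {α p : ℝ} {n : ℕ} {U : E2 → ℝ} (hU : IsLeastEnergyNInvNodal α p n U) : 0 < supN U := by
  obtain ⟨⟨-, hc, -⟩, -, ⟨x, hx, hx0⟩, -⟩ := hU
  exact hx0.trans_le ((le_abs_self _).trans (abs_le_supN hc (ball_subset_closedBall hx)))

lemma IsLeastEnergyNInvNodal.scaled {α p : ℝ} {n : ℕ} {U : E2 → ℝ}
    (hU : IsLeastEnergyNInvNodal α p n U) :
    IsScaledSol α p (supN U ^ (p - 1)) n (fun x => U x / supN U) := by
  have hM := supN_pos hU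
  obtain ⟨⟨h2, hc, heq, h0⟩, hinv, ⟨x, hx, hx0⟩, ⟨y, hy, hy0⟩, -⟩ := hU
  refine ⟨h2.div_const _, hc.div_const _, fun z hz => ?_, fun z hz => by simp [h0 z hz], fun z hz => ?_, ?_,
    hinv.comp fun a => a / supN U, ⟨x, hx, div_pos hx0 hM⟩, ⟨y, hy, div_neg_of_neg_of_pos hy0 hM⟩⟩
  · have h := lap_const_mul (supN U)⁻¹ U z
    have e : (fun y => (supN U)⁻¹ * U y) = fun y => U y / supN U := by
      ext y; rw [div_eq_inv_mul]
    rw [e] at h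
    rw [h, neg_mul_eq_mul_neg, heq z hz, abs_div, abs_of_pos hM, Real.div_rpow (abs_nonneg _) hM.le]
    have := (Real.rpow_pos_of_pos hM (p - 1)).ne'
    field_simp
  · rw [abs_div, abs_of_pos hM]
    exact div_le_one_of_le₀ (abs_le_supN hc hz) hM.le
  · obtain ⟨z, hz, hz1⟩ := exists_abs_eq_supN hc
    exact ⟨z, hz, by rw [abs_div, abs_of_pos hM, hz1, div_self hM.ne']⟩

lemma IsScaledSol.lipschitz {α p Λ L : ℝ} {n : ℕ} {w : E2 → ℝ} (hw : IsScaledSol α p Λ n w)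
    (hα : 0 ≤ α) (hp : 1 ≤ p) (hΛ : 0 ≤ Λ) (hL : 0 < L) (hΛL : Λ ≤ L) {x y : E2}
    (hx : x ∈ closedBall (0 : E2) 1) (hy : y ∈ closedBall (0 : E2) 1) :
    |w x - w y| ≤ 3 * L * ‖x - y‖ := by
  refine abs_sub_le_of_abs_lap_le hL hw.contDiffOn hw.continuousOn hw.bdry (fun z hz => ?_) hx hy
  have hz1 := hw.abs_le z (ball_subset_closedBall hz)
  have a1 : ‖z‖ ^ α ≤ 1 := Real.rpow_le_one (norm_nonneg _) (mem_ball_zero_iff.1 hz).le hα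
  have a2 : |w z| ^ (p - 1) ≤ 1 := Real.rpow_le_one (abs_nonneg _) hz1 (by linarith)
  have b1 : 0 ≤ ‖z‖ ^ α := Real.rpow_nonneg (norm_nonneg _) _
  have b2 : 0 ≤ |w z| ^ (p - 1) := Real.rpow_nonneg (abs_nonneg _) _
  rw [← abs_neg, hw.eq z hz, abs_mul, abs_mul, abs_mul, abs_of_nonneg hΛ, abs_of_nonneg b1, abs_of_nonneg b2]
  calc Λ * ‖z‖ ^ α * |w z| ^ (p - 1) * |w z| ≤ L * 1 * 1 * 1 := by gcongr
    _ = L := by ring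

/-- Near a maximum point a normalized solution carries a definite amount of mass. -/
lemma IsScaledSol.weight_integral_ge {α : ℝ} (hα : 0 ≤ α) :
    ∃ c : ℝ, 0 < c ∧ ∀ (p Λ L : ℝ) (n : ℕ) (w : E2 → ℝ), 1 ≤ p → p ≤ 2 → 0 ≤ Λ → 1 ≤ L → Λ ≤ L →
      IsScaledSol α p Λ n w →
        c ≤ L ^ (2 + α) * ∫ x in ball (0 : E2) 1, ‖x‖ ^ α * |w x| ^ (p + 1) := by
  set V : ℝ := volume.real (ball (0 : E2) 1) with hV
  have hV0 : 0 < V := ENNReal.toReal_pos (measure_ball_pos volume 0 one_pos).ne' measure_ball_lt_top.ne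
  refine ⟨(1 / 24) ^ (2 + α) * V * (1 / 8), by positivity, ?_⟩
  intro p Λ L n w hp hp2 hΛ hL hΛL hw
  have hL0 : 0 < L := by linarith
  obtain ⟨x0, hx0, hwx0⟩ := hw.exists_abs_eq
  have hlip : ∀ x ∈ closedBall (0 : E2) 1, ∀ y ∈ closedBall (0 : E2) 1, |w x - w y| ≤ 3 * L * ‖x - y‖ :=
    fun x hx y hy => hw.lipschitz hα hp hΛ hL0 hΛL hx hy
  obtain ⟨e, he, hxe⟩ : ∃ e : E2, ‖e‖ = 1 ∧ x0 = ‖x0‖ • e := by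
    by_cases h : x0 = 0
    · exact ⟨EuclideanSpace.single 0 1, by simp, by simp [h]⟩
    · have := norm_pos_iff.2 h
      refine ⟨‖x0‖⁻¹ • x0, ?_, ?_⟩
      · rw [norm_smul, norm_inv, norm_norm, inv_mul_cancel₀ this.ne']
      · rw [smul_smul, mul_inv_cancel₀ this.ne', one_smul]
  have hx01 : ‖x0‖ ≤ 1 := mem_closedBall_zero_iff.1 hx0
  have hdist : 1 ≤ 3 * L * (1 - ‖x0‖) := by
    have h := hlip x0 hx0 e (mem_closedBall_zero_iff.2 he.le)
    rw [hw.bdry e he, sub_zero, hwx0] at h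
    have e1 : x0 - e = (‖x0‖ - 1) • e := by rw [sub_smul, one_smul, ← hxe]
    rw [e1, norm_smul, he, mul_one, Real.norm_eq_abs, abs_of_nonpos (by linarith)] at h
    linarith
  set ρ := 1 / (6 * L) with hρ
  have hρ0 : 0 < ρ := by positivity
  have hρL : 6 * L * ρ = 1 := by rw [hρ]; field_simp
  have hdist' : ‖x0‖ + 2 * ρ ≤ 1 := by nlinarith
  set y0 := (‖x0‖ + ρ / 2) • e with hy0
  have hny0 : ‖y0‖ = ‖x0‖ + ρ / 2 := by
    rw [hy0, norm_smul, he, mul_one, Real.norm_of_nonneg (by positivity)]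
  have hxy0 : ‖x0 - y0‖ = ρ / 2 := by
    have e1 : x0 - y0 = (-(ρ / 2)) • e := by
      rw [hy0, add_smul, ← hxe]; simp
    rw [e1, norm_smul, he, mul_one, Real.norm_eq_abs, abs_neg, abs_of_pos (by positivity)]
  have hsub : ball y0 (ρ / 4) ⊆ ball (0 : E2) 1 := by
    intro y hy
    rw [mem_ball_iff_norm] at hy
    rw [mem_ball_zero_iff]
    have : ‖y‖ ≤ ‖y - y0‖ + ‖y0‖ := by simpa using norm_add_le (y - y0) y0
    linarith
  have hpt : ∀ y ∈ ball y0 (ρ / 4), (ρ / 4) ^ α * (1 / 8) ≤ ‖y‖ ^ α * |w y| ^ (p + 1) := by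
    intro y hy
    have hyB := ball_subset_closedBall (hsub hy)
    rw [mem_ball_iff_norm] at hy
    have h1 : ρ / 4 ≤ ‖y‖ := by
      have : ‖y0‖ ≤ ‖y0 - y‖ + ‖y‖ := by simpa using norm_add_le (y0 - y) y
      rw [norm_sub_rev] at this
      have := norm_nonneg x0
      linarith
    have h2 : ‖x0 - y‖ ≤ ρ := by
      have : ‖x0 - y‖ ≤ ‖x0 - y0‖ + ‖y0 - y‖ := norm_sub_le_norm_sub_add_norm_sub _ _ _
      rw [norm_sub_rev y0 y] at this
      linarith
    have h3 : 1 / 2 ≤ |w y| := by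
      have h := hlip x0 hx0 y hyB
      have h' := abs_sub_abs_le_abs_sub (w x0) (w y)
      rw [hwx0] at h'
      nlinarith
    have h4 : (1 / 8 : ℝ) ≤ |w y| ^ (p + 1) := by
      calc (1 / 8 : ℝ) = (1 / 2) ^ (3 : ℝ) := by norm_num
        _ ≤ (1 / 2) ^ (p + 1) := Real.rpow_le_rpow_of_exponent_ge (by norm_num) (by norm_num) (by linarith)
        _ ≤ |w y| ^ (p + 1) := Real.rpow_le_rpow (by norm_num) h3 (by linarith)
    have h5 := Real.rpow_le_rpow (by positivity) h1 hα
    have h6 : 0 ≤ (ρ / 4) ^ α := by positivity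
    nlinarith
  have hcont : ContinuousOn (fun x : E2 => ‖x‖ ^ α * |w x| ^ (p + 1)) (closedBall 0 1) :=
    continuousOn_weight_mul_rpow hα (by linarith) hw.continuousOn.abs
  have hvol : volume.real (ball y0 (ρ / 4)) = (ρ / 4) ^ 2 * V := by
    rw [Measure.real, Measure.addHaar_ball _ _ (by positivity), ENNReal.toReal_mul,
      ENNReal.toReal_ofReal (by positivity)]
    simp [hV, Measure.real]
  have hInt : (ρ / 4) ^ 2 * V * ((ρ / 4) ^ α * (1 / 8))
      ≤ ∫ x in ball (0 : E2) 1, ‖x‖ ^ α * |w x| ^ (p + 1) := by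
    calc (ρ / 4) ^ 2 * V * ((ρ / 4) ^ α * (1 / 8))
        = ∫ _ in ball y0 (ρ / 4), (ρ / 4) ^ α * (1 / 8) := by
          rw [setIntegral_const, hvol, smul_eq_mul]
      _ ≤ ∫ x in ball y0 (ρ / 4), ‖x‖ ^ α * |w x| ^ (p + 1) :=
          setIntegral_mono_on (integrableOn_const measure_ball_lt_top.ne)
            ((integrableOn_ball hcont).mono_set hsub) measurableSet_ball hpt
      _ ≤ _ := setIntegral_mono_set (integrableOn_ball hcont)
          (Eventually.of_forall fun x => by positivity) (Eventually.of_forall hsub)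
  have hcalc : (1 / 24) ^ (2 + α) * V * (1 / 8) = L ^ (2 + α) * ((ρ / 4) ^ 2 * V * ((ρ / 4) ^ α * (1 / 8))) := by
    have e1 : (ρ / 4) ^ 2 * (ρ / 4) ^ α = (ρ / 4) ^ (2 + α) := by
      rw [Real.rpow_add (by positivity)]; norm_num
    have e2 : (1 / 24 : ℝ) ^ (2 + α) = L ^ (2 + α) * (ρ / 4) ^ (2 + α) := by
      rw [← Real.mul_rpow hL0.le (by positivity)]
      congr 1; linarith
    rw [e2, ← e1]; ring
  rw [hcalc]
  exact mul_le_mul_of_nonneg_left hInt (by positivity)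

lemma weight_integral_scaled {α p : ℝ} {U : E2 → ℝ} (hM : 0 < supN U) :
    (∫ x in ball (0 : E2) 1, ‖x‖ ^ α * |U x| ^ (p + 1))
      = supN U ^ (p + 1) * ∫ x in ball (0 : E2) 1, ‖x‖ ^ α * |U x / supN U| ^ (p + 1) := by
  rw [← integral_const_mul]
  refine integral_congr_ae (Eventually.of_forall fun x => ?_)
  simp only
  have := (Real.rpow_pos_of_pos hM (p + 1)).ne'
  rw [abs_div, abs_of_pos hM, Real.div_rpow (abs_nonneg _) hM.le]
  field_simp

/-- Asymptotic upper bound for the sup norms of least energy nodal solutions. -/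
lemma supN_rpow_le {α γ ν Z : ℝ} {n : ℕ} (hα : 0 ≤ α) (hαγ : α = 2 * γ - 2) (hn : 1 ≤ n)
    (hν : 0 ≤ ν) (hγν : γ * ν = n) (hZ : 0 < Z) (hZ0 : besselH ν Z = 0)
    (hpos : ∀ s ∈ Set.Ico 0 Z, 0 < besselH ν s) :
    ∃ b : ℝ → ℝ, Tendsto b (𝓝[>] 1) (𝓝 ((2 * γ) ^ 2 * Z)) ∧
      ∀ᶠ p in 𝓝[>] (1 : ℝ), ∀ U, IsLeastEnergyNInvNodal α p n U → supN U ^ (p - 1) ≤ b p := by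
  obtain ⟨C1, hC1, ρ, hρt, hρ⟩ := weight_integral_le hα hαγ hn hν hγν hZ hZ0 hpos
  obtain ⟨c, hc, hlow⟩ := IsScaledSol.weight_integral_ge hα
  set lam := (2 * γ) ^ 2 * Z with hlam
  have hlam0 : 0 < lam := by
    have : 1 ≤ γ := by linarith
    positivity
  set C := C1 / c with hC
  have hC0 : 0 < C := by positivity
  have hkey : ∀ p, 1 < p → p ≤ 2 → ∀ U, IsLeastEnergyNInvNodal α p n U → ∀ L, 1 ≤ L →
      supN U ^ (p - 1) ≤ L →
      supN U ^ (p - 1) ≤ (C * L ^ (2 + α)) ^ ((p - 1) / (p + 1)) * ρ p ^ (2 / (p + 1)) := by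
    intro p hp hp2 U hU L hL hΛL
    have hM := supN_pos hU
    obtain ⟨hρ0, hρ1⟩ := hρ p hp
    have h1 := hρ1 U hU
    rw [weight_integral_scaled hM] at h1
    have h2 := hlow p _ L n _ hp.le hp2 (Real.rpow_nonneg hM.le _) hL hΛL hU.scaled
    set I := ∫ x in ball (0 : E2) 1, ‖x‖ ^ α * |U x / supN U| ^ (p + 1)
    have hLp : 0 < L ^ (2 + α) := Real.rpow_pos_of_pos (by linarith) _
    have hMp : 0 < supN U ^ (p + 1) := Real.rpow_pos_of_pos hM _
    have h3 : supN U ^ (p + 1) ≤ C * L ^ (2 + α) * ρ p ^ (2 / (p - 1)) := by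
      rw [hC, div_mul_eq_mul_div, div_mul_eq_mul_div, le_div_iff₀ hc]
      calc supN U ^ (p + 1) * c ≤ supN U ^ (p + 1) * (L ^ (2 + α) * I) := by gcongr
        _ = L ^ (2 + α) * (supN U ^ (p + 1) * I) := by ring
        _ ≤ L ^ (2 + α) * (C1 * ρ p ^ (2 / (p - 1))) := by gcongr
        _ = _ := by ring
    have hp1 : p + 1 ≠ 0 := by linarith
    have hp2 : p - 1 ≠ 0 := by linarith
    have h4 := Real.rpow_le_rpow hMp.le h3 (div_nonneg (by linarith) (by linarith) : 0 ≤ (p - 1) / (p + 1))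
    rw [← Real.rpow_mul hM.le, mul_div_cancel₀ _ hp1, Real.mul_rpow (by positivity) (by positivity),
      ← Real.rpow_mul hρ0.le, show 2 / (p - 1) * ((p - 1) / (p + 1)) = 2 / (p + 1) by field_simp] at h4
    exact h4
  have hq : Tendsto (fun p : ℝ => (p - 1) / (p + 1)) (𝓝[>] 1) (𝓝 0) := by
    have : ContinuousAt (fun p : ℝ => (p - 1) / (p + 1)) 1 :=
      (continuousAt_id.sub continuousAt_const).div (continuousAt_id.add continuousAt_const) (by norm_num)
    simpa [ContinuousAt] using this.tendsto.mono_left nhdsWithin_le_nhds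
  have hr : Tendsto (fun p : ℝ => 2 / (p + 1)) (𝓝[>] 1) (𝓝 1) := by
    have : ContinuousAt (fun p : ℝ => 2 / (p + 1)) 1 :=
      continuousAt_const.div (continuousAt_id.add continuousAt_const) (by norm_num)
    have h := this.tendsto.mono_left (nhdsWithin_le_nhds (s := Set.Ioi 1))
    norm_num at h
    exact h
  have hrhs : ∀ D : ℝ, 0 < D →
      Tendsto (fun p => D ^ ((p - 1) / (p + 1)) * ρ p ^ (2 / (p + 1))) (𝓝[>] 1) (𝓝 lam) := by
    intro D hD
    have h1 : Tendsto (fun p : ℝ => D ^ ((p - 1) / (p + 1))) (𝓝[>] 1) (𝓝 (D ^ (0 : ℝ))) :=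
      (Real.continuousAt_const_rpow hD.ne').tendsto.comp hq
    have h2 := hρt.rpow hr (Or.inl hlam0.ne')
    have := h1.mul h2
    rwa [Real.rpow_zero, Real.rpow_one, one_mul] at this
  set C0 := (lam + 1) ^ 2 with hC0def
  have hC01 : 1 ≤ C0 := by nlinarith
  have hbound : ∀ᶠ p in 𝓝[>] (1 : ℝ), ∀ U, IsLeastEnergyNInvNodal α p n U → supN U ^ (p - 1) ≤ C0 := by
    have hα' : 0 < 1 / (2 * (2 + α)) := by positivity
    filter_upwards [self_mem_nhdsWithin, nhdsWithin_le_nhds (eventually_lt_nhds (by norm_num : (1:ℝ) < 2)),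
      hq.eventually (eventually_lt_nhds hα'), (hrhs C hC0).eventually (eventually_lt_nhds (lt_add_one lam))]
      with p hp hp2 hqp hrp U hU
    have hp : 1 < p := hp
    set Λ := supN U ^ (p - 1) with hΛ
    rcases le_total Λ 1 with h | h
    · exact h.trans hC01
    · have h1 := hkey p hp hp2.le U hU Λ h le_rfl
      have hΛ0 : 0 < Λ := by linarith
      have hρ0 := (hρ p hp).1
      rw [Real.mul_rpow hC0.le (by positivity), ← Real.rpow_mul hΛ0.le] at h1
      have h2 : Λ ^ ((2 + α) * ((p - 1) / (p + 1))) ≤ Λ ^ (1 / 2 : ℝ) := by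
        refine Real.rpow_le_rpow_of_exponent_le h ?_
        calc (2 + α) * ((p - 1) / (p + 1)) ≤ (2 + α) * (1 / (2 * (2 + α))) := by gcongr
          _ = 1 / 2 := by field_simp
      rw [← Real.sqrt_eq_rpow] at h2
      have h3 : Λ ≤ Real.sqrt Λ * (lam + 1) := by
        calc Λ ≤ C ^ ((p - 1) / (p + 1)) * Λ ^ ((2 + α) * ((p - 1) / (p + 1))) * ρ p ^ (2 / (p + 1)) := h1
          _ ≤ C ^ ((p - 1) / (p + 1)) * Real.sqrt Λ * ρ p ^ (2 / (p + 1)) := by gcongr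
          _ = Real.sqrt Λ * (C ^ ((p - 1) / (p + 1)) * ρ p ^ (2 / (p + 1))) := by ring
          _ ≤ Real.sqrt Λ * (lam + 1) := by gcongr
      have h4 := Real.mul_self_sqrt hΛ0.le
      have h5 : 0 < Real.sqrt Λ := Real.sqrt_pos.2 hΛ0
      have h6 : Real.sqrt Λ ≤ lam + 1 := by
        by_contra hcon
        nlinarith
      rw [hC0def]; nlinarith
  refine ⟨_, hrhs (C * C0 ^ (2 + α)) (by positivity), ?_⟩
  filter_upwards [hbound, self_mem_nhdsWithin, nhdsWithin_le_nhds (eventually_lt_nhds (by norm_num : (1:ℝ) < 2))]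
    with p hb hp hp2 U hU
  exact hkey p hp hp2.le U hU C0 hC01 (hb U hU)

lemma polar_eq_smul (r θ : ℝ) : polar r θ = r • polar 1 θ := by
  ext i; fin_cases i <;> simp [polar]

lemma polar_eq_add (r θ : ℝ) : polar r θ
    = (r * Real.cos θ) • EuclideanSpace.single 0 (1 : ℝ) + (r * Real.sin θ) • EuclideanSpace.single 1 (1 : ℝ) := by
  have := E2_eq (polar r θ)
  rwa [polar_zero, polar_one] at this

lemma continuous_polar : Continuous fun q : ℝ × ℝ => polar q.1 q.2 := by
  simp only [polar_eq_add]
  fun_prop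

lemma rot2_polar (φ r θ : ℝ) : rot2 φ (polar r θ) = polar r (θ + φ) := by
  ext i
  fin_cases i
  · simp [rot2, polar, Real.cos_add]; ring
  · simp [rot2, polar, Real.sin_add]; ring

lemma reflX_polar (r θ : ℝ) : reflX (polar r θ) = polar r (-θ) := by
  ext i; fin_cases i <;> simp [reflX, polar]

lemma perp_polar (r θ : ℝ) : perp (polar r θ)
    = (r * -Real.sin θ) • EuclideanSpace.single 0 (1 : ℝ) + (r * Real.cos θ) • EuclideanSpace.single 1 (1 : ℝ) := by
  ext i; fin_cases i <;> simp [perp, polar]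

lemma hasDerivAt_polar_angle (r θ : ℝ) :
    HasDerivAt (fun θ => polar r θ) (perp (polar r θ)) θ := by
  rw [perp_polar]
  simp only [polar_eq_add]
  exact ((((Real.hasDerivAt_cos θ).const_mul r).smul_const _).add
    (((Real.hasDerivAt_sin θ).const_mul r).smul_const _))

lemma hasDerivAt_perp_polar_angle (r θ : ℝ) :
    HasDerivAt (fun θ => perp (polar r θ)) (-polar r θ) θ := by
  have h := ((((Real.hasDerivAt_sin θ).neg.const_mul r).smul_const (EuclideanSpace.single 0 (1 : ℝ) : E2)).add
    (((Real.hasDerivAt_cos θ).const_mul r).smul_const (EuclideanSpace.single 1 (1 : ℝ))))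
  have e : (fun θ => perp (polar r θ)) = ((fun y => (r * (-Real.sin) y) • (EuclideanSpace.single 0 (1 : ℝ) : E2))
      + fun y => (r * Real.cos y) • EuclideanSpace.single 1 (1 : ℝ)) := by
    ext1 θ; rw [perp_polar]; rfl
  rw [e]
  refine h.congr_deriv ?_
  rw [polar_eq_add]
  simp only [mul_neg, neg_smul]
  abel

lemma hasDerivAt_polar_radius (r θ : ℝ) : HasDerivAt (fun r => polar r θ) (polar 1 θ) r := by
  have h := (hasDerivAt_id r).smul_const (polar 1 θ)
  rw [one_smul] at h
  have e : (fun r => polar r θ) = fun y => id y • polar 1 θ := by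
    ext1 s; exact polar_eq_smul s θ
  rw [e]; exact h

lemma perp_smul (c : ℝ) (x : E2) : perp (c • x) = c • perp x := by
  ext i; fin_cases i <;> simp [perp]

lemma polar_mem_ball {r : ℝ} (hr0 : 0 ≤ r) (hr : r < 1) (θ : ℝ) : polar r θ ∈ ball (0 : E2) 1 := by
  rw [mem_ball_zero_iff, norm_polar, abs_of_nonneg hr0]; exact hr

lemma polar_mem_closedBall {r : ℝ} (hr0 : 0 ≤ r) (hr : r ≤ 1) (θ : ℝ) :
    polar r θ ∈ closedBall (0 : E2) 1 := by
  rw [mem_closedBall_zero_iff, norm_polar, abs_of_nonneg hr0]; exact hr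

/-- Differentiation of a parametric integral with jointly continuous derivative. -/
lemma hasDerivAt_integral_of_continuousOn {F F' : ℝ → ℝ → ℝ} {r ε T : ℝ} (hε : 0 < ε)
    (hF : ∀ s ∈ closedBall r ε, Continuous (F s))
    (hF' : ContinuousOn (fun q : ℝ × ℝ => F' q.1 q.2) (closedBall r ε ×ˢ Set.univ))
    (hd : ∀ s ∈ closedBall r ε, ∀ θ, HasDerivAt (fun s => F s θ) (F' s θ) s) :
    HasDerivAt (fun s => ∫ θ in (0 : ℝ)..T, F s θ) (∫ θ in (0 : ℝ)..T, F' r θ) r := by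
  have hr : r ∈ closedBall r ε := mem_closedBall_self hε.le
  have hcF' : Continuous (F' r) := by
    have : Continuous fun θ : ℝ => (r, θ) := by fun_prop
    exact hF'.comp_continuous this fun θ => ⟨hr, trivial⟩
  obtain ⟨C, hC⟩ := ((isCompact_closedBall r ε).prod (isCompact_uIcc (a := (0 : ℝ)) (b := T))).exists_bound_of_continuousOn
    (hF'.mono (Set.prod_mono_right (Set.subset_univ _)))
  refine (intervalIntegral.hasDerivAt_integral_of_dominated_loc_of_deriv_le (F := F) (F' := F')
    (bound := fun _ => C) (closedBall_mem_nhds r hε) ?_ ((hF r hr).intervalIntegrable _ _)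
    hcF'.aestronglyMeasurable ?_ intervalIntegrable_const ?_).2
  · filter_upwards [closedBall_mem_nhds r hε] with s hs
    exact (hF s hs).aestronglyMeasurable
  · exact Eventually.of_forall fun t ht s hs => hC (s, t) ⟨hs, Set.uIoc_subset_uIcc ht⟩
  · exact Eventually.of_forall fun t ht s hs => hd s hs t

lemma integral_deriv_two_mul_cos {g g' g'' : ℝ → ℝ} {T k : ℝ} (hg : ∀ θ, HasDerivAt g (g' θ) θ)
    (hg' : ∀ θ, HasDerivAt g' (g'' θ) θ) (hc : Continuous g'') (per : g' T = g' 0)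
    (hcos : Real.cos (k * T) = 1) (hsin : Real.sin (k * T) = 0) :
    ∫ θ in (0 : ℝ)..T, (g'' θ + k ^ 2 * g θ) * Real.cos (k * θ) = 0 := by
  have hgc : Continuous g := continuous_iff_continuousAt.2 fun θ => (hg θ).continuousAt
  have hk : ∀ θ : ℝ, HasDerivAt (fun θ : ℝ => k * θ) k θ := fun θ => by
    have := (hasDerivAt_id θ).const_mul k
    rw [mul_one] at this; exact this
  have hd : ∀ θ, HasDerivAt (fun θ => g' θ * Real.cos (k * θ) + k * (g θ * Real.sin (k * θ)))
      ((g'' θ + k ^ 2 * g θ) * Real.cos (k * θ)) θ := by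
    intro θ
    have h1 := (hg' θ).mul ((hk θ).cos)
    have h2 := ((hg θ).mul ((hk θ).sin)).const_mul k
    refine (h1.add h2).congr_deriv ?_
    ring
  rw [intervalIntegral.integral_eq_sub_of_hasDerivAt (fun θ _ => hd θ)
    (((hc.add (continuous_const.mul hgc)).mul (Real.continuous_cos.comp
      (continuous_const.mul continuous_id))).intervalIntegrable _ _)]
  rw [hcos, hsin, per]; simp

/-- The angular Fourier coefficient of a function on the disc. -/
def coef (w : E2 → ℝ) (k T r : ℝ) : ℝ := ∫ θ in (0 : ℝ)..T, w (polar r θ) * Real.cos (k * θ)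

/-- The radial derivative of `coef`. -/
def coefD (w : E2 → ℝ) (k T r : ℝ) : ℝ :=
  ∫ θ in (0 : ℝ)..T, fderiv ℝ w (polar r θ) (polar 1 θ) * Real.cos (k * θ)

section ode

variable {w : E2 → ℝ} {k T r : ℝ}

lemma exists_closedBall_subset_Ioo (hr : r ∈ Set.Ioo (0 : ℝ) 1) :
    ∃ ε > 0, closedBall r ε ⊆ Set.Ioo (0 : ℝ) 1 := by
  obtain ⟨ε, hε, h⟩ := Metric.nhds_basis_closedBall.mem_iff.1 (isOpen_Ioo.mem_nhds hr)
  exact ⟨ε, hε, h⟩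

lemma continuousOn_comp_polar {F : Type*} [TopologicalSpace F] {f : E2 → F}
    (hf : ContinuousOn f (ball 0 1)) :
    ContinuousOn (fun q : ℝ × ℝ => f (polar q.1 q.2)) (Set.Ico (0 : ℝ) 1 ×ˢ Set.univ) :=
  hf.comp continuous_polar.continuousOn fun q hq => polar_mem_ball hq.1.1 hq.1.2 q.2

lemma continuous_comp_polar {F : Type*} [TopologicalSpace F] {f : E2 → F}
    (hf : ContinuousOn f (ball 0 1)) (hr : r ∈ Set.Ico (0 : ℝ) 1) : Continuous fun θ => f (polar r θ) := by
  have h : Continuous fun θ : ℝ => (r, θ) := by fun_prop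
  exact (continuousOn_comp_polar hf).comp_continuous h fun θ => ⟨hr, trivial⟩

lemma continuousOn_fderiv (hw : ContDiffOn ℝ 2 w (ball 0 1)) :
    ContinuousOn (fderiv ℝ w) (ball 0 1) :=
  hw.continuousOn_fderiv_of_isOpen isOpen_ball (by norm_num)

lemma continuousOn_hess (hw : ContDiffOn ℝ 2 w (ball 0 1)) : ContinuousOn (hess w) (ball 0 1) :=
  (hw.fderiv_of_isOpen isOpen_ball (m := 1) (by norm_num)).continuousOn_fderiv_of_isOpen isOpen_ball
    (by norm_num)

lemma hasDerivAt_coef (hw : ContDiffOn ℝ 2 w (ball 0 1)) (hr : r ∈ Set.Ioo (0 : ℝ) 1) :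
    HasDerivAt (coef w k T) (coefD w k T r) r := by
  obtain ⟨ε, hε, hsub⟩ := exists_closedBall_subset_Ioo hr
  have hIco : ∀ s ∈ closedBall r ε, s ∈ Set.Ico (0 : ℝ) 1 := fun s hs => ⟨(hsub hs).1.le, (hsub hs).2⟩
  have hcos : Continuous fun q : ℝ × ℝ => Real.cos (k * q.2) := by fun_prop
  have hcos1 : Continuous fun θ : ℝ => Real.cos (k * θ) := by fun_prop
  have hpol : Continuous fun q : ℝ × ℝ => polar 1 q.2 :=
    continuous_polar.comp (by fun_prop : Continuous fun q : ℝ × ℝ => ((1 : ℝ), q.2))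
  refine hasDerivAt_integral_of_continuousOn (T := T)
    (F := fun s θ => w (polar s θ) * Real.cos (k * θ))
    (F' := fun s θ => fderiv ℝ w (polar s θ) (polar 1 θ) * Real.cos (k * θ)) hε
    (fun s hs => (continuous_comp_polar hw.continuousOn (hIco s hs)).mul hcos1) ?_ fun s hs θ => ?_
  · refine ContinuousOn.mul (ContinuousOn.clm_apply
      ((continuousOn_comp_polar (continuousOn_fderiv hw)).mono (Set.prod_mono_left hIco)) hpol.continuousOn)
      hcos.continuousOn
  · have hmem := polar_mem_ball (hsub hs).1.le (hsub hs).2 θ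
    have hdw : HasFDerivAt w (fderiv ℝ w (polar s θ)) (polar s θ) :=
      ((hw.contDiffAt (isOpen_ball.mem_nhds hmem)).differentiableAt (by norm_num)).hasFDerivAt
    exact (hdw.comp_hasDerivAt s (hasDerivAt_polar_radius s θ)).mul_const _

lemma hasDerivAt_coefD (hw : ContDiffOn ℝ 2 w (ball 0 1)) (hr : r ∈ Set.Ioo (0 : ℝ) 1) :
    HasDerivAt (coefD w k T)
      (∫ θ in (0 : ℝ)..T, hess w (polar r θ) (polar 1 θ) (polar 1 θ) * Real.cos (k * θ)) r := by
  obtain ⟨ε, hε, hsub⟩ := exists_closedBall_subset_Ioo hr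
  have hIco : ∀ s ∈ closedBall r ε, s ∈ Set.Ico (0 : ℝ) 1 := fun s hs => ⟨(hsub hs).1.le, (hsub hs).2⟩
  have hcos : Continuous fun q : ℝ × ℝ => Real.cos (k * q.2) := by fun_prop
  have hcos1 : Continuous fun θ : ℝ => Real.cos (k * θ) := by fun_prop
  have hpol : Continuous fun q : ℝ × ℝ => polar 1 q.2 :=
    continuous_polar.comp (by fun_prop : Continuous fun q : ℝ × ℝ => ((1 : ℝ), q.2))
  have hpol1 : Continuous fun θ : ℝ => polar 1 θ :=
    continuous_polar.comp (by fun_prop : Continuous fun θ : ℝ => ((1 : ℝ), θ))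
  refine hasDerivAt_integral_of_continuousOn (T := T)
    (F := fun s θ => fderiv ℝ w (polar s θ) (polar 1 θ) * Real.cos (k * θ))
    (F' := fun s θ => hess w (polar s θ) (polar 1 θ) (polar 1 θ) * Real.cos (k * θ)) hε
    (fun s hs => ((continuous_comp_polar (continuousOn_fderiv hw) (hIco s hs)).clm_apply hpol1).mul hcos1)
    ?_ fun s hs θ => ?_
  · refine ContinuousOn.mul (ContinuousOn.clm_apply (ContinuousOn.clm_apply
      ((continuousOn_comp_polar (continuousOn_hess hw)).mono (Set.prod_mono_left hIco)) hpol.continuousOn)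
      hpol.continuousOn) hcos.continuousOn
  · have hmem := polar_mem_ball (hsub hs).1.le (hsub hs).2 θ
    have hdw := hasFDerivAt_fderiv_apply (hw.contDiffAt (isOpen_ball.mem_nhds hmem)) (polar 1 θ)
    exact ((hdw.comp_hasDerivAt s (hasDerivAt_polar_radius s θ)).mul_const _)

/-- The equation satisfied by the angular Fourier coefficients. -/
lemma hasDerivAt_mul_coefD (hw : ContDiffOn ℝ 2 w (ball 0 1))
    (hlap : ContinuousOn (lap w) (ball 0 1))
    (hper : ∀ r θ, w (polar r (θ + T)) = w (polar r θ))
    (hcos : Real.cos (k * T) = 1) (hsin : Real.sin (k * T) = 0) (hr : r ∈ Set.Ioo (0 : ℝ) 1) :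
    HasDerivAt (fun r => r * coefD w k T r)
      (k ^ 2 * coef w k T r / r + r * ∫ θ in (0 : ℝ)..T, lap w (polar r θ) * Real.cos (k * θ)) r := by
  have hr0 : r ≠ 0 := hr.1.ne'
  have hrI : r ∈ Set.Ico (0 : ℝ) 1 := ⟨hr.1.le, hr.2⟩
  have hat : ∀ θ, ContDiffAt ℝ 2 w (polar r θ) := fun θ =>
    hw.contDiffAt (isOpen_ball.mem_nhds (polar_mem_ball hr.1.le hr.2 θ))
  have hcos1 : Continuous fun θ : ℝ => Real.cos (k * θ) := by fun_prop
  have hpol : ∀ s : ℝ, Continuous fun θ : ℝ => polar s θ := fun s =>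
    continuous_polar.comp (by fun_prop : Continuous fun θ : ℝ => (s, θ))
  have hperp : Continuous fun θ : ℝ => perp (polar r θ) := by
    simp only [perp_polar]; fun_prop
  set g : ℝ → ℝ := fun θ => w (polar r θ) with hg
  set g1 : ℝ → ℝ := fun θ => fderiv ℝ w (polar r θ) (perp (polar r θ)) with hg1
  set g2 : ℝ → ℝ := fun θ => hess w (polar r θ) (perp (polar r θ)) (perp (polar r θ))
    - fderiv ℝ w (polar r θ) (polar r θ) with hg2
  have hd1 : ∀ θ, HasDerivAt g (g1 θ) θ := fun θ =>
    ((hat θ).differentiableAt (by norm_num)).hasFDerivAt.comp_hasDerivAt θ (hasDerivAt_polar_angle r θ)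
  have hd2 : ∀ θ, HasDerivAt g1 (g2 θ) θ := fun θ => by
    have h1 := (hasFDerivAt_fderiv (hat θ)).comp_hasDerivAt θ (hasDerivAt_polar_angle r θ)
    have h2 := h1.clm_apply (hasDerivAt_perp_polar_angle r θ)
    refine h2.congr_deriv ?_
    simp [hg2, sub_eq_add_neg]
  have hfc := continuous_comp_polar (continuousOn_fderiv hw) hrI
  have hhc := continuous_comp_polar (continuousOn_hess hw) hrI
  have hc2 : Continuous g2 :=
    ((hhc.clm_apply hperp).clm_apply hperp).sub (hfc.clm_apply (hpol r))
  have hper1 : g1 T = g1 0 := by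
    have h1 : HasDerivAt (fun θ => g (θ + T)) (g1 T) 0 := by
      have := hd1 (0 + T)
      rw [zero_add] at this
      exact HasDerivAt.comp_add_const 0 T (by rw [zero_add]; exact this)
    have h2 : (fun θ => g (θ + T)) = g := by ext θ; exact hper r θ
    rw [h2] at h1
    exact h1.unique (hd1 0)
  have hibp := integral_deriv_two_mul_cos hd1 hd2 hc2 hper1 hcos hsin
  refine ((hasDerivAt_id r).mul (hasDerivAt_coefD hw hr)).congr_deriv ?_
  have hpt : ∀ θ, r * (fderiv ℝ w (polar r θ) (polar 1 θ) * Real.cos (k * θ))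
      + r ^ 2 * (hess w (polar r θ) (polar 1 θ) (polar 1 θ) * Real.cos (k * θ))
      + (g2 θ + k ^ 2 * g θ) * Real.cos (k * θ)
      = k ^ 2 * (g θ * Real.cos (k * θ)) + r ^ 2 * (lap w (polar r θ) * Real.cos (k * θ)) := by
    intro θ
    have hn : ‖polar 1 θ‖ = 1 := by rw [norm_polar]; simp
    rw [lap_eq_hess (hat θ) hn]
    have e1 : g2 θ = r ^ 2 * hess w (polar r θ) (perp (polar 1 θ)) (perp (polar 1 θ))
        - r * fderiv ℝ w (polar r θ) (polar 1 θ) := by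
      have e2 : perp (polar r θ) = r • perp (polar 1 θ) := by rw [polar_eq_smul r, perp_smul]
      have e3 : fderiv ℝ w (polar r θ) (polar r θ) = r * fderiv ℝ w (polar r θ) (polar 1 θ) := by
        conv_lhs => rw [show polar r θ = r • polar 1 θ from polar_eq_smul r θ]
        rw [map_smul, smul_eq_mul, ← polar_eq_smul]
      rw [hg2]; simp only
      rw [e3, e2]
      simp only [map_smul, _root_.smul_apply, smul_eq_mul]
      ring
    rw [e1]; ring
  have i1 : IntervalIntegrable (fun θ => r * (fderiv ℝ w (polar r θ) (polar 1 θ) * Real.cos (k * θ))) volume 0 T :=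
    (continuous_const.mul ((hfc.clm_apply (hpol 1)).mul hcos1)).intervalIntegrable _ _
  have i2 : IntervalIntegrable (fun θ => r ^ 2 * (hess w (polar r θ) (polar 1 θ) (polar 1 θ) * Real.cos (k * θ))) volume 0 T :=
    (continuous_const.mul (((hhc.clm_apply (hpol 1)).clm_apply (hpol 1)).mul hcos1)).intervalIntegrable _ _
  have hgc : Continuous g := continuous_comp_polar hw.continuousOn hrI
  have i3 : IntervalIntegrable (fun θ => (g2 θ + k ^ 2 * g θ) * Real.cos (k * θ)) volume 0 T :=
    ((hc2.add (continuous_const.mul hgc)).mul hcos1).intervalIntegrable _ _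
  have i4 : IntervalIntegrable (fun θ => k ^ 2 * (g θ * Real.cos (k * θ))) volume 0 T :=
    (continuous_const.mul (hgc.mul hcos1)).intervalIntegrable _ _
  have i5 : IntervalIntegrable (fun θ => r ^ 2 * (lap w (polar r θ) * Real.cos (k * θ))) volume 0 T :=
    (continuous_const.mul ((continuous_comp_polar hlap hrI).mul hcos1)).intervalIntegrable _ _
  have hInt := intervalIntegral.integral_congr (μ := volume) (a := 0) (b := T) fun θ _ => hpt θ
  rw [intervalIntegral.integral_add (i1.add i2) i3, intervalIntegral.integral_add i1 i2,
    intervalIntegral.integral_add i4 i5] at hInt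
  simp only [intervalIntegral.integral_const_mul] at hInt
  rw [hibp, add_zero] at hInt
  simp only [id]
  rw [coefD, coef]
  field_simp
  linarith

end ode

lemma abs_abs_rpow_mul_sub_le {t p : ℝ} (ht : |t| ≤ 1) (hp : 1 ≤ p) :
    |(|t| ^ (p - 1) * t - t)| ≤ p - 1 := by
  rcases eq_or_ne t 0 with rfl | h0
  · simp; linarith
  have hs : 0 < |t| := abs_pos.2 h0
  have e : |t| ^ (p - 1) * t - t = (|t| ^ (p - 1) - 1) * t := by ring
  have h1 : |t| ^ (p - 1) ≤ 1 := Real.rpow_le_one hs.le ht (by linarith)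
  have h2 : 1 + Real.log |t| * (p - 1) ≤ |t| ^ (p - 1) := by
    rw [Real.rpow_def_of_pos hs]
    linarith [Real.add_one_le_exp (Real.log |t| * (p - 1))]
  have h3 : 1 - |t|⁻¹ ≤ Real.log |t| := Real.one_sub_inv_le_log_of_pos hs
  have h4 : |t| - 1 ≤ |t| * Real.log |t| := by
    have := mul_le_mul_of_nonneg_left h3 hs.le
    rwa [mul_sub, mul_one, mul_inv_cancel₀ hs.ne'] at this
  rw [e, abs_mul, abs_of_nonpos (by linarith)]
  nlinarith [mul_le_mul_of_nonneg_left h2 hs.le, mul_le_mul_of_nonneg_right h4 (sub_nonneg.2 hp)]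

section single

variable {α p Λ L : ℝ} {n : ℕ} {w : E2 → ℝ}

lemma IsScaledSol.continuousOn_lap (hw : IsScaledSol α p Λ n w) (hα : 0 ≤ α) (hp : 1 ≤ p) :
    ContinuousOn (lap w) (ball 0 1) := by
  have hc : ContinuousOn w (ball 0 1) := hw.contDiffOn.continuousOn
  have h : ContinuousOn (fun x => -(Λ * ‖x‖ ^ α * |w x| ^ (p - 1) * w x)) (ball 0 1) :=
    (((continuous_const.mul (continuous_norm_rpow hα)).continuousOn.mul
      (hc.abs.rpow_const fun x _ => Or.inr (by linarith))).mul hc).neg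
  refine h.congr fun x hx => ?_
  have := hw.eq x hx
  simp only
  linarith

lemma IsScaledSol.abs_lap_add_le (hw : IsScaledSol α p Λ n w) (hα : 0 ≤ α) (hp : 1 ≤ p)
    (hΛ : 0 ≤ Λ) (l : ℝ) {x : E2} (hx : x ∈ ball (0 : E2) 1) :
    |lap w x + l * ‖x‖ ^ α * w x| ≤ |l - Λ| + Λ * (p - 1) := by
  have hx1 : ‖x‖ ≤ 1 := (mem_ball_zero_iff.1 hx).le
  have ha : |w x| ≤ 1 := hw.abs_le x (ball_subset_closedBall hx)
  have h0 : 0 ≤ ‖x‖ ^ α := Real.rpow_nonneg (norm_nonneg x) α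
  have h1 : ‖x‖ ^ α ≤ 1 := Real.rpow_le_one (norm_nonneg x) hx1 hα
  have e : lap w x + l * ‖x‖ ^ α * w x
      = ‖x‖ ^ α * ((l - Λ) * w x - Λ * (|w x| ^ (p - 1) * w x - w x)) := by
    linear_combination -(hw.eq x hx)
  rw [e, abs_mul, abs_of_nonneg h0]
  calc ‖x‖ ^ α * |(l - Λ) * w x - Λ * (|w x| ^ (p - 1) * w x - w x)|
      ≤ 1 * |(l - Λ) * w x - Λ * (|w x| ^ (p - 1) * w x - w x)| := by gcongr
    _ ≤ |(l - Λ) * w x| + |Λ * (|w x| ^ (p - 1) * w x - w x)| := by rw [one_mul]; exact abs_sub _ _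
    _ ≤ |l - Λ| * 1 + Λ * (p - 1) := by
        rw [abs_mul, abs_mul, abs_of_nonneg hΛ]
        gcongr
        exact abs_abs_rpow_mul_sub_le ha hp
    _ = _ := by ring

lemma IsScaledSol.abs_lap_le (hw : IsScaledSol α p Λ n w) (hα : 0 ≤ α) (hp : 1 ≤ p)
    (hΛ : 0 ≤ Λ) {x : E2} (hx : x ∈ ball (0 : E2) 1) : |lap w x| ≤ Λ := by
  have hx1 : ‖x‖ ≤ 1 := (mem_ball_zero_iff.1 hx).le
  have ha : |w x| ≤ 1 := hw.abs_le x (ball_subset_closedBall hx)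
  rw [← abs_neg, hw.eq x hx, abs_mul, abs_mul, abs_mul, abs_of_nonneg hΛ,
    abs_of_nonneg (Real.rpow_nonneg (norm_nonneg x) α),
    abs_of_nonneg (Real.rpow_nonneg (abs_nonneg (w x)) (p - 1))]
  calc Λ * ‖x‖ ^ α * |w x| ^ (p - 1) * |w x| ≤ Λ * 1 * 1 * 1 := by
        gcongr
        · exact Real.rpow_le_one (norm_nonneg x) hx1 hα
        · exact Real.rpow_le_one (abs_nonneg _) ha (by linarith)
    _ = Λ := by ring

lemma IsScaledSol.norm_fderiv_le (hw : IsScaledSol α p Λ n w)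
    (hα : 0 ≤ α) (hp : 1 ≤ p) (hΛ : 0 ≤ Λ) (hL : 0 < L) (hΛL : Λ ≤ L) {x : E2}
    (hx : x ∈ ball (0 : E2) 1) : ‖fderiv ℝ w x‖ ≤ 3 * L := by
  have h : LipschitzOnWith (3 * L).toNNReal w (ball 0 1) := by
    refine LipschitzOnWith.of_dist_le_mul fun y hy z hz => ?_
    rw [Real.dist_eq, dist_eq_norm, Real.coe_toNNReal _ (by positivity)]
    exact hw.lipschitz hα hp hΛ hL hΛL (ball_subset_closedBall hy) (ball_subset_closedBall hz)
  have := norm_fderiv_le_of_lipschitzOn ℝ (isOpen_ball.mem_nhds hx) h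
  rwa [Real.coe_toNNReal _ (by positivity)] at this

lemma abs_integral_mul_cos_le {g : ℝ → ℝ} {C T k : ℝ} (hT : 0 ≤ T) (hg : ∀ θ, |g θ| ≤ C) :
    |∫ θ in (0 : ℝ)..T, g θ * Real.cos (k * θ)| ≤ C * T := by
  have h := intervalIntegral.norm_integral_le_of_norm_le_const (a := 0) (b := T) (C := C)
    (f := fun θ => g θ * Real.cos (k * θ)) fun θ _ => by
      rw [Real.norm_eq_abs, abs_mul]
      calc |g θ| * |Real.cos (k * θ)| ≤ |g θ| * 1 := by
            gcongr; exact Real.abs_cos_le_one _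
        _ ≤ C := by rw [mul_one]; exact hg θ
  rwa [sub_zero, abs_of_nonneg hT, Real.norm_eq_abs] at h

variable {k T γ μ κ C r : ℝ}

lemma IsScaledSol.abs_coef_le (hw : IsScaledSol α p Λ n w) (hT : 0 ≤ T) (hr : r ∈ Set.Icc (0 : ℝ) 1) :
    |coef w k T r| ≤ T := by
  have := abs_integral_mul_cos_le (k := k) hT fun θ => hw.abs_le _ (polar_mem_closedBall hr.1 hr.2 θ)
  rwa [one_mul] at this

lemma IsScaledSol.abs_coefD_le (hw : IsScaledSol α p Λ n w)
    (hα : 0 ≤ α) (hp : 1 ≤ p) (hΛ : 0 ≤ Λ) (hL : 0 < L) (hΛL : Λ ≤ L) (hT : 0 ≤ T)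
    (hr : r ∈ Set.Ico (0 : ℝ) 1) : |coefD w k T r| ≤ 3 * L * T := by
  refine abs_integral_mul_cos_le hT fun θ => ?_
  have h1 := (fderiv ℝ w (polar r θ)).le_opNorm (polar 1 θ)
  rw [norm_polar, abs_one, mul_one, Real.norm_eq_abs] at h1
  exact h1.trans (hw.norm_fderiv_le hα hp hΛ hL hΛL (polar_mem_ball hr.1 hr.2 θ))

/-- The Wronskian of an angular Fourier coefficient and a radial profile. -/
def wronsk (w : E2 → ℝ) (k T γ μ κ r : ℝ) : ℝ :=
  r * coefD w k T r * radR γ μ κ r - coef w k T r * radQ γ μ κ r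

lemma hasDerivAt_wronsk (hw : ContDiffOn ℝ 2 w (ball 0 1))
    (hlap : ContinuousOn (lap w) (ball 0 1))
    (hper : ∀ r θ, w (polar r (θ + T)) = w (polar r θ))
    (hcos : Real.cos (k * T) = 1) (hsin : Real.sin (k * T) = 0) (hαγ : α = 2 * γ - 2)
    (hκ : 0 ≤ κ) (hγκ : γ * κ = k) (hr : r ∈ Set.Ioo (0 : ℝ) 1) :
    HasDerivAt (wronsk w k T γ μ κ) (r * radR γ μ κ r * ∫ θ in (0 : ℝ)..T,
      (lap w (polar r θ) + (2 * γ) ^ 2 * μ * ‖polar r θ‖ ^ α * w (polar r θ)) * Real.cos (k * θ)) r := by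
  have hrI : r ∈ Set.Ico (0 : ℝ) 1 := ⟨hr.1.le, hr.2⟩
  have hP := hasDerivAt_mul_coefD hw hlap hper hcos hsin hr
  have ha := hasDerivAt_coef (k := k) (T := T) hw hr
  have hR := hasDerivAt_radR (γ := γ) hκ μ hr.1
  have hQ := hasDerivAt_radQ (γ := γ) hκ μ hr.1
  have hcos1 : Continuous fun θ : ℝ => Real.cos (k * θ) := by fun_prop
  have e : ∫ θ in (0 : ℝ)..T,
      (lap w (polar r θ) + (2 * γ) ^ 2 * μ * ‖polar r θ‖ ^ α * w (polar r θ)) * Real.cos (k * θ)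
      = (∫ θ in (0 : ℝ)..T, lap w (polar r θ) * Real.cos (k * θ))
        + (2 * γ) ^ 2 * μ * r ^ α * coef w k T r := by
    rw [coef, ← intervalIntegral.integral_const_mul, ← intervalIntegral.integral_add]
    · refine intervalIntegral.integral_congr fun θ _ => ?_
      rw [norm_polar, abs_of_pos hr.1]; ring
    · exact ((continuous_comp_polar hlap hrI).mul hcos1).intervalIntegrable _ _
    · exact (continuous_const.mul ((continuous_comp_polar hw.continuousOn hrI).mul
        hcos1)).intervalIntegrable _ _
  rw [e]
  refine ((hP.mul hR).sub (ha.mul hQ)).congr_deriv ?_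
  have hr0 : r ≠ 0 := hr.1.ne'
  have e2 : r ^ (2 * γ) = r ^ α * r ^ 2 := by
    rw [← Real.rpow_natCast r 2, ← Real.rpow_add hr.1, hαγ]; norm_num
  rw [e2, hγκ]
  field_simp
  ring

lemma IsScaledSol.abs_wronsk_le (hw : IsScaledSol α p Λ n w)
    (hα : 0 ≤ α) (hp : 1 ≤ p) (hΛ : 0 ≤ Λ) (hT : 0 ≤ T)
    (hper : ∀ r θ, w (polar r (θ + T)) = w (polar r θ))
    (hcos : Real.cos (k * T) = 1) (hsin : Real.sin (k * T) = 0) (hαγ : α = 2 * γ - 2)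
    (hκ : 0 ≤ κ) (hγκ : γ * κ = k) (hC : ∀ s ∈ Set.Icc (0 : ℝ) 1, |radR γ μ κ s| ≤ C)
    (hr : r ∈ Set.Ioo (0 : ℝ) 1) :
    |wronsk w k T γ μ κ r| ≤ C * T * (|(2 * γ) ^ 2 * μ - Λ| + Λ * (p - 1)) := by
  have hγ : 0 < γ := by linarith
  have hC0 : 0 ≤ C := (abs_nonneg _).trans (hC 0 ⟨le_rfl, zero_le_one⟩)
  obtain ⟨δ, hδ⟩ : ∃ δ, δ = |(2 * γ) ^ 2 * μ - Λ| + Λ * (p - 1) := ⟨_, rfl⟩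
  have hδ0 : 0 ≤ δ := by
    rw [hδ]; exact add_nonneg (abs_nonneg _) (mul_nonneg hΛ (by linarith))
  rw [← hδ]
  have hd : ∀ s ∈ Set.Ioo (0 : ℝ) 1, HasDerivWithinAt (wronsk w k T γ μ κ) _ (Set.Ioo 0 1) s :=
    fun s hs => (hasDerivAt_wronsk (μ := μ) hw.contDiffOn (hw.continuousOn_lap hα hp) hper hcos hsin hαγ hκ
      hγκ hs).hasDerivWithinAt
  have hb : ∀ s ∈ Set.Ioo (0 : ℝ) r, |wronsk w k T γ μ κ r - wronsk w k T γ μ κ s| ≤ C * T * δ := by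
    intro s hs
    have hs1 : s ∈ Set.Ioo (0 : ℝ) 1 := ⟨hs.1, hs.2.trans hr.2⟩
    have h := (convex_Ioo (0 : ℝ) 1).norm_image_sub_le_of_norm_hasDerivWithin_le (C := C * T * δ) hd
      (fun t ht => ?_) hs1 hr
    · rw [Real.norm_eq_abs, Real.norm_eq_abs] at h
      refine h.trans ?_
      have : |r - s| ≤ 1 := by rw [_root_.abs_le]; constructor <;> linarith [hs.1, hs.2, hr.2]
      calc C * T * δ * |r - s| ≤ C * T * δ * 1 := by gcongr
        _ = _ := mul_one _
    · have h1 := abs_integral_mul_cos_le (k := k) hT fun θ =>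
        hw.abs_lap_add_le hα hp hΛ ((2 * γ) ^ 2 * μ) (polar_mem_ball ht.1.le ht.2 θ)
      rw [← hδ] at h1
      rw [Real.norm_eq_abs, abs_mul, abs_mul, abs_of_pos ht.1]
      calc t * |radR γ μ κ t| * _ ≤ 1 * C * (δ * T) := by
            gcongr
            · exact ht.2.le
            · exact hC t ⟨ht.1.le, ht.2.le⟩
        _ = _ := by ring
  have hlim : Tendsto (fun s => s * (3 * (Λ + 1) * T) * C + T * |radQ γ μ κ s|) (𝓝[>] 0) (𝓝 0) := by
    have hc : Continuous fun s => s * (3 * (Λ + 1) * T) * C + T * |radQ γ μ κ s| := by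
      have := continuous_radQ hγ hκ μ
      fun_prop
    have := (hc.tendsto 0).mono_left (nhdsWithin_le_nhds (s := Set.Ioi 0))
    rw [radQ_zero hγ hκ] at this
    simpa using this
  have hlim2 : Tendsto (fun s => C * T * δ + (s * (3 * (Λ + 1) * T) * C + T * |radQ γ μ κ s|)) (𝓝[>] 0)
      (𝓝 (C * T * δ)) := by
    have := hlim.const_add (C * T * δ)
    rwa [add_zero] at this
  refine ge_of_tendsto hlim2 ?_
  filter_upwards [Ioo_mem_nhdsGT hr.1] with s hs
  have h1 := hb s hs
  have hs1 : s ∈ Set.Ico (0 : ℝ) 1 := ⟨hs.1.le, hs.2.trans hr.2⟩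
  have h2 : |wronsk w k T γ μ κ s| ≤ s * (3 * (Λ + 1) * T) * C + T * |radQ γ μ κ s| := by
    refine (abs_sub _ _).trans ?_
    rw [abs_mul, abs_mul, abs_mul, abs_of_pos hs.1]
    have h3 := hw.abs_coefD_le (k := k) hα hp hΛ (by linarith : 0 < Λ + 1) (by linarith) hT hs1
    have h4 := hw.abs_coef_le (k := k) hT ⟨hs1.1, hs1.2.le⟩
    have h5 := hC s ⟨hs1.1, hs1.2.le⟩
    have h6 := hs.1.le
    gcongr
  have h3 : |wronsk w k T γ μ κ r|
      ≤ |wronsk w k T γ μ κ r - wronsk w k T γ μ κ s| + |wronsk w k T γ μ κ s| := by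
    have := abs_add_le (wronsk w k T γ μ κ r - wronsk w k T γ μ κ s) (wronsk w k T γ μ κ s)
    rwa [sub_add_cancel] at this
  linarith

lemma abs_coef_div_sub_le {r1 r2 K m : ℝ} (hw : ContDiffOn ℝ 2 w (ball 0 1)) (hκ : 0 ≤ κ)
    (h1 : 0 < r1) (h2 : r2 < 1) (h12 : r1 ≤ r2) (hm : 0 < m)
    (hR : ∀ r ∈ Set.Icc r1 r2, m ≤ |radR γ μ κ r|)
    (hK : ∀ r ∈ Set.Ioo (0 : ℝ) 1, |wronsk w k T γ μ κ r| ≤ K) :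
    |coef w k T r2 / radR γ μ κ r2 - coef w k T r1 / radR γ μ κ r1| ≤ K / (r1 * m ^ 2) := by
  have hK0 : 0 ≤ K := (abs_nonneg _).trans (hK (1 / 2) ⟨by norm_num, by norm_num⟩)
  have hsub : ∀ r ∈ Set.Icc r1 r2, r ∈ Set.Ioo (0 : ℝ) 1 := fun r hr =>
    ⟨h1.trans_le hr.1, hr.2.trans_lt h2⟩
  have hne : ∀ r ∈ Set.Icc r1 r2, radR γ μ κ r ≠ 0 := fun r hr h0 => by
    have := hR r hr; rw [h0, abs_zero] at this; linarith
  have hd : ∀ r ∈ Set.Icc r1 r2, HasDerivWithinAt (fun r => coef w k T r / radR γ μ κ r)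
      (wronsk w k T γ μ κ r / (r * radR γ μ κ r ^ 2)) (Set.Icc r1 r2) r := by
    intro r hr
    have h := (hasDerivAt_coef (k := k) (T := T) hw (hsub r hr)).div
      (hasDerivAt_radR (γ := γ) hκ μ (hsub r hr).1) (hne r hr)
    refine (h.congr_deriv ?_).hasDerivWithinAt
    have := hne r hr
    have := (hsub r hr).1.ne'
    rw [wronsk]
    field_simp
  have h := (convex_Icc r1 r2).norm_image_sub_le_of_norm_hasDerivWithin_le (C := K / (r1 * m ^ 2)) hd
    (fun r hr => ?_) (Set.left_mem_Icc.2 h12) (Set.right_mem_Icc.2 h12)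
  · rw [Real.norm_eq_abs, Real.norm_eq_abs] at h
    refine h.trans ?_
    have : |r2 - r1| ≤ 1 := by rw [_root_.abs_le]; constructor <;> linarith
    calc K / (r1 * m ^ 2) * |r2 - r1| ≤ K / (r1 * m ^ 2) * 1 := by gcongr
      _ = _ := mul_one _
  · have hr0 := (hsub r hr).1
    rw [Real.norm_eq_abs, abs_div, abs_mul, abs_of_pos hr0, abs_pow]
    gcongr
    · exact hK r (hsub r hr)
    · exact hr.1
    · exact hR r hr

end single

/-- An even periodic function with a single nonvanishing cosine coefficient is a multiple of the
corresponding cosine. -/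
lemma eq_mul_cos_of_integral_eq_zero {G : ℝ → ℝ} {T : ℝ} (hT : 0 < T) (hG : Continuous G)
    (heven : ∀ θ, G (-θ) = G θ) (hper : Function.Periodic G T) (m : ℕ)
    (h : ∀ j : ℕ, j ≠ m → ∫ θ in (0 : ℝ)..T, G θ * Real.cos (2 * π / T * j * θ) = 0) (θ : ℝ) :
    G θ = (if m = 0 then 1 else 2) / T *
      (∫ θ in (0 : ℝ)..T, G θ * Real.cos (2 * π / T * m * θ)) * Real.cos (2 * π / T * m * θ) := by
  have : Fact (0 < T) := ⟨hT⟩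
  have hperC : Function.Periodic (fun θ => (G θ : ℂ)) T := fun x => by simp only [hper x]
  have hcl : Continuous (hperC.lift : AddCircle T → ℂ) :=
    continuous_coinduced_dom.mpr (by
      change Continuous fun θ => (G θ : ℂ)
      exact Complex.continuous_ofReal.comp hG)
  obtain ⟨f, hf⟩ : ∃ f : C(AddCircle T, ℂ), ∀ x : ℝ, f x = G x :=
    ⟨⟨hperC.lift, hcl⟩, fun x => rfl⟩
  obtain ⟨a, ha⟩ : ∃ a : ℕ → ℝ, ∀ j, a j = ∫ θ in (0 : ℝ)..T, G θ * Real.cos (2 * π / T * j * θ) :=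
    ⟨_, fun j => rfl⟩
  have hsin : ∀ j : ℤ, ∫ θ in (0 : ℝ)..T, G θ * Real.sin (2 * π / T * j * θ) = 0 := by
    intro j
    have h1 := intervalIntegral.integral_comp_sub_left (a := 0) (b := T)
      (fun θ => G θ * Real.sin (2 * π / T * j * θ)) T
    rw [sub_self, sub_zero] at h1
    have h2 : ∀ x : ℝ, G (T - x) * Real.sin (2 * π / T * j * (T - x))
        = -(G x * Real.sin (2 * π / T * j * x)) := by
      intro x
      have e1 : G (T - x) = G x := by rw [← heven x, ← hper (-x)]; congr 1; ring
      have e2 : 2 * π / T * j * (T - x) = -(2 * π / T * j * x) + j * (2 * π) := by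
        field_simp; ring
      rw [e1, e2, Real.sin_add_int_mul_two_pi, Real.sin_neg]; ring
    simp only [h2, intervalIntegral.integral_neg] at h1
    linarith
  have hcoef : ∀ j : ℤ, fourierCoeff f j = ((a j.natAbs / T : ℝ) : ℂ) := by
    intro j
    rw [fourierCoeff_eq_intervalIntegral f j 0, zero_add]
    have e : ∀ x : ℝ, (fourier (-j)) (x : AddCircle T) • f x
        = ((G x * Real.cos (2 * π / T * (j.natAbs : ℕ) * x) : ℝ) : ℂ)
          - ((G x * Real.sin (2 * π / T * j * x) : ℝ) : ℂ) * Complex.I := by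
      intro x
      have e1 : Real.cos (2 * π / T * (j.natAbs : ℕ) * x) = Real.cos (2 * π / T * j * x) := by
        rw [Nat.cast_natAbs, Int.cast_abs, ← Real.cos_abs (2 * π / T * j * x), ← Real.cos_abs]
        congr 1
        simp only [abs_mul, abs_abs]
      rw [fourier_coe_apply, hf, smul_eq_mul, e1]
      have e2 : 2 * (π : ℂ) * Complex.I * ((-j : ℤ) : ℂ) * x / T
          = ((-(2 * π / T * j * x) : ℝ) : ℂ) * Complex.I := by
        push_cast; ring
      rw [e2, Complex.exp_mul_I, ← Complex.ofReal_cos, ← Complex.ofReal_sin, Real.cos_neg, Real.sin_neg]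
      push_cast
      ring
    simp only [e]
    rw [intervalIntegral.integral_sub, intervalIntegral.integral_ofReal,
      intervalIntegral.integral_mul_const, intervalIntegral.integral_ofReal, hsin, ← ha]
    · simp; ring
    · exact (Complex.continuous_ofReal.comp (by fun_prop)).intervalIntegrable _ _
    · exact ((Complex.continuous_ofReal.comp (by fun_prop)).mul continuous_const).intervalIntegrable _ _
  have hz : ∀ j : ℤ, j ∉ ({(m : ℤ), -(m : ℤ)} : Finset ℤ) → fourierCoeff f j = 0 := by
    intro j hj
    rw [hcoef, ha, h]
    · simp
    · intro hjm
      apply hj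
      simp only [Finset.mem_insert, Finset.mem_singleton]
      omega
  have hsum : Summable (fourierCoeff f) :=
    summable_of_ne_finset_zero (s := {(m : ℤ), -(m : ℤ)}) hz
  have h1 := has_pointwise_sum_fourier_series_of_summable hsum (θ : AddCircle T)
  have h2 : HasSum (fun i => fourierCoeff f i • fourier i (θ : AddCircle T)) _ :=
    hasSum_sum_of_ne_finset_zero (s := {(m : ℤ), -(m : ℤ)}) fun j hj => by
      simp only [hz j hj, zero_smul]
  have h3 := h1.unique h2
  rw [hf] at h3
  rw [← ha]
  have e2 : ∀ j : ℤ, fourier j (θ : AddCircle T)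
      = Real.cos (2 * π / T * j * θ) + Real.sin (2 * π / T * j * θ) * Complex.I := by
    intro j
    rw [fourier_coe_apply]
    have e2 : 2 * (π : ℂ) * Complex.I * (j : ℂ) * θ / T
        = ((2 * π / T * j * θ : ℝ) : ℂ) * Complex.I := by
      push_cast; ring
    rw [e2, Complex.exp_mul_I, ← Complex.ofReal_cos, ← Complex.ofReal_sin]
  rcases Nat.eq_zero_or_pos m with rfl | hm
  · simp only [Nat.cast_zero, neg_zero, Finset.pair_eq_singleton, Finset.sum_singleton, hcoef] at h3
    have h4 : (G θ : ℂ) = ((a 0 / T : ℝ) : ℂ) := by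
      rw [h3]; simp
    rw [Complex.ofReal_injective h4]; simp; ring
  · have hne : (m : ℤ) ≠ -(m : ℤ) := by omega
    rw [Finset.sum_pair hne, hcoef, hcoef, e2, e2, if_neg hm.ne'] at *
    simp only [Int.natAbs_neg, Int.natAbs_natCast, smul_eq_mul] at h3
    have e3 : 2 * π / T * ((-(m : ℤ) : ℤ) : ℝ) * θ = -(2 * π / T * ((m : ℤ) : ℝ) * θ) := by push_cast; ring
    rw [e3, Real.cos_neg, Real.sin_neg] at h3
    have h4 : (G θ : ℂ) = ((2 / T * a m * Real.cos (2 * π / T * ((m : ℤ) : ℝ) * θ) : ℝ) : ℂ) := by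
      rw [h3]; push_cast; ring
    have h5 := Complex.ofReal_injective h4
    simpa using h5

/-- `W` is the uniform limit of normalized nodal solutions whose exponents tend to `1` and whose
multipliers tend to `l`. -/
structure IsNodalLimit (α l : ℝ) (n : ℕ) (p Λ : ℕ → ℝ) (w : ℕ → E2 → ℝ) (W : E2 → ℝ) : Prop where
  sol : ∀ i, IsScaledSol α (p i) (Λ i) n (w i)
  one_lt : ∀ i, 1 < p i
  tendsto_exponent : Tendsto p atTop (𝓝 1)
  nonneg : ∀ i, 0 ≤ Λ i
  tendsto_multiplier : Tendsto Λ atTop (𝓝 l)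
  unif : TendstoUniformlyOn w W atTop (closedBall 0 1)

lemma nInvariant.polar_add {n : ℕ} {u : E2 → ℝ} (hu : nInvariant n u) (r θ : ℝ) :
    u (polar r (θ + 2 * π / n)) = u (polar r θ) := by
  rw [← rot2_polar, hu.2]

lemma nInvariant.polar_neg {n : ℕ} {u : E2 → ℝ} (hu : nInvariant n u) (r θ : ℝ) :
    u (polar r (-θ)) = u (polar r θ) := by
  rw [← reflX_polar, hu.1]

lemma continuous_comp_polar_of_closedBall {f : E2 → ℝ} (hf : ContinuousOn f (closedBall 0 1)) {r : ℝ}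
    (hr : r ∈ Set.Icc (0 : ℝ) 1) : Continuous fun θ => f (polar r θ) := by
  have h : Continuous fun θ : ℝ => polar r θ :=
    continuous_polar.comp (by fun_prop : Continuous fun θ : ℝ => (r, θ))
  exact hf.comp_continuous h fun θ => polar_mem_closedBall hr.1 hr.2 θ

lemma abs_coef_sub_le {f g : E2 → ℝ} (hf : ContinuousOn f (closedBall 0 1))
    (hg : ContinuousOn g (closedBall 0 1)) {r s k T C : ℝ} (hT : 0 ≤ T) (hr : r ∈ Set.Icc (0 : ℝ) 1)
    (hs : s ∈ Set.Icc (0 : ℝ) 1) (h : ∀ θ, |f (polar r θ) - g (polar s θ)| ≤ C) :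
    |coef f k T r - coef g k T s| ≤ C * T := by
  have hcos : Continuous fun θ : ℝ => Real.cos (k * θ) := by fun_prop
  have h1 := abs_integral_mul_cos_le (k := k) hT h
  simp only [sub_mul] at h1
  have i1 : IntervalIntegrable (fun θ => f (polar r θ) * Real.cos (k * θ)) volume 0 T :=
    ((continuous_comp_polar_of_closedBall hf hr).mul hcos).intervalIntegrable _ _
  have i2 : IntervalIntegrable (fun θ => g (polar s θ) * Real.cos (k * θ)) volume 0 T :=
    ((continuous_comp_polar_of_closedBall hg hs).mul hcos).intervalIntegrable _ _
  rwa [intervalIntegral.integral_sub i1 i2] at h1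

namespace IsNodalLimit

variable {α l γ μ κ k : ℝ} {n : ℕ} {p Λ : ℕ → ℝ} {w : ℕ → E2 → ℝ} {W : E2 → ℝ}

lemma tendsto (h : IsNodalLimit α l n p Λ w W) {x : E2} (hx : x ∈ closedBall (0 : E2) 1) :
    Tendsto (fun i => w i x) atTop (𝓝 (W x)) := h.unif.tendsto_at hx

lemma continuousOn (h : IsNodalLimit α l n p Λ w W) : ContinuousOn W (closedBall 0 1) :=
  h.unif.continuousOn (Eventually.of_forall fun i => (h.sol i).continuousOn).frequently

lemma eventually_abs_sub_lt (h : IsNodalLimit α l n p Λ w W) {ε : ℝ} (hε : 0 < ε) :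
    ∀ᶠ i in atTop, ∀ x ∈ closedBall (0 : E2) 1, |w i x - W x| < ε := by
  filter_upwards [Metric.tendstoUniformlyOn_iff.1 h.unif ε hε] with i hi x hx
  rw [abs_sub_comm]; exact hi x hx

lemma abs_le (h : IsNodalLimit α l n p Λ w W) {x : E2} (hx : x ∈ closedBall (0 : E2) 1) : |W x| ≤ 1 :=
  le_of_tendsto (h.tendsto hx).abs (Eventually.of_forall fun i => (h.sol i).abs_le x hx)

lemma exists_abs_eq (h : IsNodalLimit α l n p Λ w W) : ∃ x ∈ closedBall (0 : E2) 1, |W x| = 1 := by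
  obtain ⟨x, hx, hmax⟩ := (isCompact_closedBall (0 : E2) 1).exists_isMaxOn
    ⟨0, mem_closedBall_self zero_le_one⟩ h.continuousOn.abs
  refine ⟨x, hx, (h.abs_le hx).antisymm (not_lt.1 fun hlt => ?_)⟩
  obtain ⟨i, hi⟩ := (h.eventually_abs_sub_lt (sub_pos.2 hlt)).exists
  obtain ⟨y, hy, hy1⟩ := (h.sol i).exists_abs_eq
  have h1 := hi y hy
  have h2 : |W y| ≤ |W x| := hmax hy
  have h3 := abs_sub_abs_le_abs_sub (w i y) (W y)
  linarith

lemma bdry (h : IsNodalLimit α l n p Λ w W) {x : E2} (hx : ‖x‖ = 1) : W x = 0 := by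
  refine tendsto_nhds_unique (h.tendsto (mem_closedBall_zero_iff.2 hx.le)) ?_
  simp only [fun i => (h.sol i).bdry x hx, tendsto_const_nhds]

lemma polar_add (h : IsNodalLimit α l n p Λ w W) {r : ℝ} (hr : r ∈ Set.Icc (0 : ℝ) 1) (θ : ℝ) :
    W (polar r (θ + 2 * π / n)) = W (polar r θ) := by
  refine tendsto_nhds_unique (h.tendsto (polar_mem_closedBall hr.1 hr.2 _)) ?_
  simp only [fun i => (h.sol i).inv.polar_add r θ]
  exact h.tendsto (polar_mem_closedBall hr.1 hr.2 _)

lemma polar_neg (h : IsNodalLimit α l n p Λ w W) {r : ℝ} (hr : r ∈ Set.Icc (0 : ℝ) 1) (θ : ℝ) :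
    W (polar r (-θ)) = W (polar r θ) := by
  refine tendsto_nhds_unique (h.tendsto (polar_mem_closedBall hr.1 hr.2 _)) ?_
  simp only [fun i => (h.sol i).inv.polar_neg r θ]
  exact h.tendsto (polar_mem_closedBall hr.1 hr.2 _)

lemma l_nonneg (h : IsNodalLimit α l n p Λ w W) : 0 ≤ l :=
  ge_of_tendsto h.tendsto_multiplier (Eventually.of_forall h.nonneg)

lemma tendsto_coef (h : IsNodalLimit α l n p Λ w W) {T r : ℝ} (hT : 0 < T) (hr : r ∈ Set.Icc (0 : ℝ) 1) :
    Tendsto (fun i => coef (w i) k T r) atTop (𝓝 (coef W k T r)) := by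
  rw [Metric.tendsto_nhds]
  intro ε hε
  filter_upwards [h.eventually_abs_sub_lt (by positivity : 0 < ε / (2 * T))] with i hi
  have := abs_coef_sub_le (k := k) (h.sol i).continuousOn h.continuousOn hT.le hr hr fun θ =>
    (hi _ (polar_mem_closedBall hr.1 hr.2 θ)).le
  rw [Real.dist_eq]
  have e : ε / (2 * T) * T = ε / 2 := by field_simp
  linarith

lemma abs_coef_sub_le (h : IsNodalLimit α l n p Λ w W) (hα : 0 ≤ α) {T r s : ℝ} (hT : 0 < T)
    (hr : r ∈ Set.Icc (0 : ℝ) 1) (hs : s ∈ Set.Icc (0 : ℝ) 1) :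
    |coef W k T r - coef W k T s| ≤ 3 * (l + 1) * |r - s| * T := by
  refine le_of_tendsto ((h.tendsto_coef hT hr).sub (h.tendsto_coef hT hs)).abs ?_
  filter_upwards [h.tendsto_multiplier.eventually_le_const (lt_add_one l)] with i hi
  refine _root_.abs_coef_sub_le (h.sol i).continuousOn (h.sol i).continuousOn hT.le hr hs fun θ => ?_
  have hl := h.l_nonneg
  refine ((h.sol i).lipschitz hα (h.one_lt i).le (h.nonneg i) (by linarith) hi
    (polar_mem_closedBall hr.1 hr.2 θ) (polar_mem_closedBall hs.1 hs.2 θ)).trans_eq ?_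
  rw [polar_eq_smul r, polar_eq_smul s, ← sub_smul, norm_smul, norm_polar, abs_one, mul_one,
    Real.norm_eq_abs]

lemma continuousOn_coef (h : IsNodalLimit α l n p Λ w W) (hα : 0 ≤ α) {T : ℝ} (hT : 0 < T) :
    ContinuousOn (coef W k T) (Set.Icc 0 1) := by
  have hl := h.l_nonneg
  have : LipschitzOnWith (3 * (l + 1) * T).toNNReal (coef W k T) (Set.Icc 0 1) := by
    refine LipschitzOnWith.of_dist_le_mul fun r hr s hs => ?_
    rw [Real.dist_eq, Real.dist_eq, Real.coe_toNNReal _ (by positivity)]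
    refine (h.abs_coef_sub_le hα hT hr hs).trans_eq (by ring)
  exact this.continuousOn

lemma coef_one (h : IsNodalLimit α l n p Λ w W) (T : ℝ) : coef W k T 1 = 0 := by
  have : ∀ θ, W (polar 1 θ) = 0 := fun θ => h.bdry (by rw [norm_polar, abs_one])
  simp [coef, this]

/-- The Wronskians tend to `0` uniformly. -/
lemma exists_wronsk_bound (h : IsNodalLimit α ((2 * γ) ^ 2 * μ) n p Λ w W) (hα : 0 ≤ α)
    (hαγ : α = 2 * γ - 2) (hn : 1 ≤ n) {j : ℕ} (hκ : 0 ≤ κ) (hγκ : γ * κ = n * j) :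
    ∃ K : ℕ → ℝ, Tendsto K atTop (𝓝 0) ∧ ∀ i, ∀ r ∈ Set.Ioo (0 : ℝ) 1,
      |wronsk (w i) (n * j) (2 * π / n) γ μ κ r| ≤ K i := by
  have hn0 : (n : ℝ) ≠ 0 := by positivity
  have hT : 0 ≤ 2 * π / n := by positivity
  have hγ : 0 < γ := by linarith
  obtain ⟨C, hC⟩ := isCompact_Icc.exists_bound_of_continuousOn (s := Set.Icc (0 : ℝ) 1)
    (continuous_radR hγ hκ μ).continuousOn
  have hkT : (n * j : ℝ) * (2 * π / n) = j * (2 * π) := by field_simp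
  refine ⟨fun i => C * (2 * π / n) * (|(2 * γ) ^ 2 * μ - Λ i| + Λ i * (p i - 1)), ?_, fun i r hr =>
    (h.sol i).abs_wronsk_le hα (h.one_lt i).le (h.nonneg i) hT (h.sol i).inv.polar_add ?_ ?_ hαγ hκ hγκ
      hC hr⟩
  · have h1 := (h.tendsto_multiplier.const_sub ((2 * γ) ^ 2 * μ)).abs
    have h2 := h.tendsto_multiplier.mul (h.tendsto_exponent.sub_const 1)
    have h3 := (h1.add h2).const_mul (C * (2 * π / n))
    simpa using h3
  · rw [hkT, Real.cos_nat_mul_two_pi]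
  · rw [hkT]
    have := Real.sin_nat_mul_pi (2 * j)
    push_cast at this
    rw [← this]; congr 1; ring

lemma coef_div_eq (h : IsNodalLimit α ((2 * γ) ^ 2 * μ) n p Λ w W) (hα : 0 ≤ α)
    (hαγ : α = 2 * γ - 2) (hn : 1 ≤ n) {j : ℕ} (hκ : 0 ≤ κ) (hγκ : γ * κ = n * j) {r1 r2 : ℝ}
    (h1 : 0 < r1) (h2 : r2 < 1) (h12 : r1 ≤ r2) (hR : ∀ r ∈ Set.Icc r1 r2, radR γ μ κ r ≠ 0) :
    coef W (n * j) (2 * π / n) r2 / radR γ μ κ r2 = coef W (n * j) (2 * π / n) r1 / radR γ μ κ r1 := by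
  have hT : 0 < 2 * π / n := by positivity
  have hγ : 0 < γ := by linarith
  obtain ⟨K, hK, hKb⟩ := h.exists_wronsk_bound hα hαγ hn hκ hγκ
  obtain ⟨r, hr, hmin⟩ := isCompact_Icc.exists_isMinOn (s := Set.Icc r1 r2) ⟨r1, le_rfl, h12⟩
    (continuous_radR hγ hκ μ).abs.continuousOn
  have hm : 0 < |radR γ μ κ r| := abs_pos.2 (hR r hr)
  have hlim := (((h.tendsto_coef (k := n * j) hT ⟨(h1.trans_le h12).le, h2.le⟩).div_const (radR γ μ κ r2)).sub
    ((h.tendsto_coef (k := n * j) hT ⟨h1.le, (h12.trans_lt h2).le⟩).div_const (radR γ μ κ r1))).abs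
  have h0 := le_of_tendsto_of_tendsto hlim (hK.div_const (r1 * |radR γ μ κ r| ^ 2))
    (Eventually.of_forall fun i =>
      abs_coef_div_sub_le (h.sol i).contDiffOn hκ h1 h2 h12 hm (fun s hs => hmin hs) (hKb i))
  rw [zero_div] at h0
  exact sub_eq_zero.1 (abs_eq_zero.1 (le_antisymm h0 (abs_nonneg _)))

/-- On an interval where the radial profile does not vanish, the Fourier coefficient of the limit is
a multiple of it. -/
lemma exists_coef_eq (h : IsNodalLimit α ((2 * γ) ^ 2 * μ) n p Λ w W) (hα : 0 ≤ α)
    (hαγ : α = 2 * γ - 2) (hn : 1 ≤ n) {j : ℕ} (hκ : 0 ≤ κ) (hγκ : γ * κ = n * j) {a b : ℝ}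
    (ha : 0 ≤ a) (hb : b ≤ 1) (hab : a < b) (hR : ∀ r ∈ Set.Ioo a b, radR γ μ κ r ≠ 0) :
    ∃ c, ∀ r ∈ Set.Icc a b, coef W (n * j) (2 * π / n) r = c * radR γ μ κ r := by
  have hT : 0 < 2 * π / n := by positivity
  have hγ : 0 < γ := by linarith
  have hm : (a + b) / 2 ∈ Set.Ioo a b := ⟨by linarith, by linarith⟩
  refine ⟨coef W (n * j) (2 * π / n) ((a + b) / 2) / radR γ μ κ ((a + b) / 2), ?_⟩
  have hIoo : Set.EqOn (coef W (n * j) (2 * π / n)) (fun r => coef W (n * j) (2 * π / n) ((a + b) / 2)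
      / radR γ μ κ ((a + b) / 2) * radR γ μ κ r) (Set.Ioo a b) := by
    intro r hr
    simp only
    rw [← div_eq_iff (hR r hr)]
    rcases le_total r ((a + b) / 2) with hle | hle
    · exact (h.coef_div_eq hα hαγ hn hκ hγκ (ha.trans_lt hr.1) (hm.2.trans_le hb) hle fun s hs =>
        hR s ⟨hr.1.trans_le hs.1, hs.2.trans_lt hm.2⟩).symm
    · exact h.coef_div_eq hα hαγ hn hκ hγκ (ha.trans_lt hm.1) (hr.2.trans_le hb) hle fun s hs =>
        hR s ⟨hm.1.trans_le hs.1, hs.2.trans_lt hr.2⟩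
  refine hIoo.of_subset_closure ((h.continuousOn_coef hα hT).mono (Set.Icc_subset_Icc ha hb))
    (continuous_const.mul (continuous_radR hγ hκ μ)).continuousOn Set.Ioo_subset_Icc_self ?_
  rw [closure_Ioo hab.ne]

lemma coef_eq_zero (h : IsNodalLimit α ((2 * γ) ^ 2 * μ) n p Λ w W) (hα : 0 ≤ α)
    (hαγ : α = 2 * γ - 2) (hn : 1 ≤ n) {j : ℕ} (hκ : 0 ≤ κ) (hγκ : γ * κ = n * j) {a : ℝ}
    (ha : 0 ≤ a) (ha1 : a < 1) (hR : ∀ r ∈ Set.Ioc a 1, radR γ μ κ r ≠ 0) {r : ℝ} (hr : r ∈ Set.Icc a 1) :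
    coef W (n * j) (2 * π / n) r = 0 := by
  obtain ⟨c, hc⟩ := h.exists_coef_eq hα hαγ hn hκ hγκ ha le_rfl ha1 fun r hr => hR r ⟨hr.1, hr.2.le⟩
  have h1 := hc 1 ⟨ha1.le, le_rfl⟩
  rw [h.coef_one] at h1
  have hc0 : c = 0 := (mul_eq_zero.1 h1.symm).resolve_right (hR 1 ⟨ha1, le_rfl⟩)
  rw [hc r hr, hc0, zero_mul]

/-- The radial coefficient of the limit vanishes if the radial profile has a single zero, which is
interior and simple. -/
lemma coef_zero_eq_zero (h : IsNodalLimit α ((2 * γ) ^ 2 * μ) n p Λ w W) (hα : 0 ≤ α)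
    (hαγ : α = 2 * γ - 2) (hn : 1 ≤ n) {r0 : ℝ} (hr0 : r0 ∈ Set.Ioo (0 : ℝ) 1)
    (hQ : radQ γ μ 0 r0 ≠ 0) (hR : ∀ r ∈ Set.Ioc (0 : ℝ) 1, r ≠ r0 → radR γ μ 0 r ≠ 0) {r : ℝ}
    (hr : r ∈ Set.Icc (0 : ℝ) 1) : coef W 0 (2 * π / n) r = 0 := by
  have hT : 0 < 2 * π / n := by positivity
  have hγ : 0 < γ := by linarith
  have hγκ : γ * 0 = n * (0 : ℕ) := by simp
  have hright : ∀ r ∈ Set.Icc r0 1, coef W 0 (2 * π / n) r = 0 := fun r hr => by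
    have := h.coef_eq_zero hα hαγ hn le_rfl hγκ hr0.1.le hr0.2
      (fun s hs => hR s ⟨hr0.1.trans hs.1, hs.2⟩ hs.1.ne') hr
    simpa using this
  obtain ⟨c, hc⟩ := h.exists_coef_eq hα hαγ hn le_rfl hγκ le_rfl hr0.2.le hr0.1 fun s hs =>
    hR s ⟨hs.1, (hs.2.trans hr0.2).le⟩ hs.2.ne
  simp only [Nat.cast_zero, mul_zero] at hc
  obtain ⟨K, hK, hKb⟩ := h.exists_wronsk_bound hα hαγ hn le_rfl hγκ
  simp only [Nat.cast_zero, mul_zero] at hKb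
  -- the limit of the fluxes
  have hflux : ∀ s ∈ Set.Ioo (0 : ℝ) 1, s ≠ r0 → ∀ c', coef W 0 (2 * π / n) s = c' * radR γ μ 0 s →
      Tendsto (fun i => s * coefD (w i) 0 (2 * π / n) s) atTop (𝓝 (c' * radQ γ μ 0 s)) := by
    intro s hs hne c' hc'
    have hRs := hR s ⟨hs.1, hs.2.le⟩ hne
    have h1 : Tendsto (fun i => wronsk (w i) 0 (2 * π / n) γ μ 0 s) atTop (𝓝 0) :=
      squeeze_zero_norm (fun i => hKb i s hs) hK
    have h2 := (h1.add ((h.tendsto_coef (k := 0) hT ⟨hs.1.le, hs.2.le⟩).mul_const (radQ γ μ 0 s))).div_const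
      (radR γ μ 0 s)
    refine (h2.congr fun i => ?_).trans_eq ?_
    · rw [wronsk]; field_simp; ring
    · congr 1; rw [hc']; field_simp; ring
  have hL : ∀ s ∈ Set.Ioo (0 : ℝ) r0, ∀ t ∈ Set.Ioo r0 1,
      |c * radQ γ μ 0 s| ≤ ((2 * γ) ^ 2 * μ + 1) * (2 * π / n) * (t - s) := by
    intro s hs t ht
    have hs1 : s ∈ Set.Ioo (0 : ℝ) 1 := ⟨hs.1, hs.2.trans hr0.2⟩
    have ht1 : t ∈ Set.Ioo (0 : ℝ) 1 := ⟨hr0.1.trans ht.1, ht.2⟩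
    have f1 := hflux s hs1 hs.2.ne c (hc s ⟨hs.1.le, hs.2.le⟩)
    have f2 := hflux t ht1 ht.1.ne' 0 (by rw [hright t ⟨ht.1.le, ht.2.le⟩, zero_mul])
    have f3 := (f2.sub f1).abs
    rw [zero_mul, zero_sub, abs_neg] at f3
    refine le_of_tendsto f3 ?_
    filter_upwards [h.tendsto_multiplier.eventually_le_const (lt_add_one _)] with i hi
    have hl := h.l_nonneg
    have hd : ∀ x ∈ Set.Ioo (0 : ℝ) 1,
        HasDerivWithinAt (fun r => r * coefD (w i) 0 (2 * π / n) r) _ (Set.Ioo 0 1) x := fun x hx =>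
      (hasDerivAt_mul_coefD (h.sol i).contDiffOn ((h.sol i).continuousOn_lap hα (h.one_lt i).le)
        (h.sol i).inv.polar_add (k := 0) (by simp) (by simp) hx).hasDerivWithinAt
    have hmv := (convex_Ioo (0 : ℝ) 1).norm_image_sub_le_of_norm_hasDerivWithin_le
      (C := ((2 * γ) ^ 2 * μ + 1) * (2 * π / n)) hd (fun x hx => ?_) hs1 ht1
    · rwa [Real.norm_eq_abs, Real.norm_eq_abs, abs_of_pos (sub_pos.2 (hs.2.trans ht.1))] at hmv
    · have h5 := abs_integral_mul_cos_le (k := 0) hT.le fun θ =>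
        (h.sol i).abs_lap_le hα (h.one_lt i).le (h.nonneg i) (polar_mem_ball hx.1.le hx.2 θ)
      rw [Real.norm_eq_abs]
      simp only [ne_eq, OfNat.ofNat_ne_zero, not_false_eq_true, zero_pow, zero_mul, zero_div, zero_add,
        abs_mul, abs_of_pos hx.1] at h5 ⊢
      have h6 : |∫ θ in (0 : ℝ)..2 * π / n, lap (w i) (polar x θ) * Real.cos 0|
          ≤ ((2 * γ) ^ 2 * μ + 1) * (2 * π / n) := h5.trans (by gcongr)
      calc _ ≤ 1 * (((2 * γ) ^ 2 * μ + 1) * (2 * π / n)) := by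
            gcongr
            exact hx.2.le
        _ = _ := one_mul _
  have hL0 : ∀ t ∈ Set.Ioo r0 1, |c * radQ γ μ 0 r0| ≤ ((2 * γ) ^ 2 * μ + 1) * (2 * π / n) * (t - r0) := by
    intro t ht
    have hcq := continuous_radQ hγ le_rfl μ
    have c1 : Continuous fun s => |c * radQ γ μ 0 s| := by fun_prop
    have c2 : Continuous fun s => ((2 * γ) ^ 2 * μ + 1) * (2 * π / n) * (t - s) := by fun_prop
    refine le_of_tendsto_of_tendsto ((c1.tendsto r0).mono_left (nhdsWithin_le_nhds (s := Set.Iio r0)))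
      ((c2.tendsto r0).mono_left nhdsWithin_le_nhds) ?_
    filter_upwards [Ioo_mem_nhdsLT hr0.1] with s hs using hL s hs t ht
  have hzero : |c * radQ γ μ 0 r0| ≤ 0 := by
    have c2 : Continuous fun t => ((2 * γ) ^ 2 * μ + 1) * (2 * π / n) * (t - r0) := by fun_prop
    have c3 := (c2.tendsto r0).mono_left (nhdsWithin_le_nhds (s := Set.Ioi r0))
    rw [sub_self, mul_zero] at c3
    refine ge_of_tendsto c3 ?_
    filter_upwards [Ioo_mem_nhdsGT hr0.2] with t ht using hL0 t ht
  have hc0 : c = 0 := (mul_eq_zero.1 (abs_nonpos_iff.1 hzero)).resolve_right hQ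
  rcases le_total r r0 with hle | hle
  · rw [hc r ⟨hr.1, hle⟩, hc0, zero_mul]
  · exact hright r ⟨hle, hr.2⟩

end IsNodalLimit

lemma radR_ne_zero {γ μ κ r : ℝ} (hr : 0 < r) (h : besselH κ (μ * r ^ (2 * γ)) ≠ 0) :
    radR γ μ κ r ≠ 0 :=
  mul_ne_zero (Real.rpow_pos_of_pos hr _).ne' h

lemma mul_rpow_mem_Icc {γ μ r : ℝ} (hγ : 0 < γ) (hμ : 0 ≤ μ) (hr : r ∈ Set.Icc (0 : ℝ) 1) :
    μ * r ^ (2 * γ) ∈ Set.Icc 0 μ := by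
  have h1 := Real.rpow_nonneg hr.1 (2 * γ)
  have h2 := Real.rpow_le_one hr.1 hr.2 (by linarith : 0 ≤ 2 * γ)
  exact ⟨mul_nonneg hμ h1, mul_le_of_le_one_right hμ h2⟩

lemma mul_rpow_mem_Ico {γ μ r : ℝ} (hγ : 0 < γ) (hμ : 0 < μ) (hr : r ∈ Set.Ico (0 : ℝ) 1) :
    μ * r ^ (2 * γ) ∈ Set.Ico 0 μ := by
  have h1 := Real.rpow_nonneg hr.1 (2 * γ)
  have h2 := Real.rpow_lt_one hr.1 hr.2 (by linarith : 0 < 2 * γ)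
  exact ⟨mul_nonneg hμ.le h1, mul_lt_of_lt_one_right hμ h2⟩

namespace IsNodalLimit

variable {α l γ μ κ : ℝ} {n : ℕ} {p Λ : ℕ → ℝ} {w : ℕ → E2 → ℝ} {W : E2 → ℝ}

lemma eq_mul_cos (h : IsNodalLimit α l n p Λ w W) (hn : 1 ≤ n) (m : ℕ)
    (h0 : ∀ j : ℕ, j ≠ m → ∀ r ∈ Set.Icc (0 : ℝ) 1, coef W (n * j) (2 * π / n) r = 0)
    {r : ℝ} (hr : r ∈ Set.Icc (0 : ℝ) 1) (θ : ℝ) :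
    W (polar r θ) = (if m = 0 then 1 else 2) / (2 * π / n) * coef W (n * m) (2 * π / n) r
      * Real.cos (n * m * θ) := by
  have hT : 0 < 2 * π / n := by positivity
  have e : 2 * π / (2 * π / n) = (n : ℝ) := by field_simp
  have h1 := eq_mul_cos_of_integral_eq_zero hT (continuous_comp_polar_of_closedBall h.continuousOn hr)
    (h.polar_neg hr) (h.polar_add hr) m (fun j hj => by rw [e]; exact h0 j hj r hr) θ
  rw [e] at h1
  exact h1

/-- The limit of sign-changing solutions cannot be positive inside the disc. -/
lemma not_pos (h : IsNodalLimit α l n p Λ w W) (hα : 0 ≤ α) {σ : ℝ} (hσ : σ = 1 ∨ σ = -1)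
    (hpos : ∀ x ∈ ball (0 : E2) 1, 0 < σ * W x) : False := by
  have hl := h.l_nonneg
  obtain ⟨L, hL⟩ : ∃ L, L = l + 1 := ⟨_, rfl⟩
  have hL1 : 1 ≤ L := by linarith
  have hη : 1 / (4 * L) ≤ 1 / 4 := by
    rw [div_le_div_iff₀ (by positivity) (by norm_num)]; linarith
  have hη0 : 0 < 1 / (4 * L) := by positivity
  have hs2 : √(1 - 1 / (4 * L)) ^ 2 = 1 - 1 / (4 * L) := Real.sq_sqrt (by linarith)
  obtain ⟨s, hs⟩ : ∃ s, s = √(1 - 1 / (4 * L)) := ⟨_, rfl⟩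
  have hs0 : 0 ≤ s := hs ▸ Real.sqrt_nonneg _
  rw [← hs] at hs2
  have hs1 : s < 1 := by nlinarith
  have hthin : (1 - s ^ 2) ^ 2 < 1 / (2 * L) := by
    have e : 1 / (2 * L) = 2 * (1 / (4 * L)) := by field_simp; norm_num
    rw [hs2, e]; nlinarith
  have hsub : closedBall (0 : E2) s ⊆ ball 0 1 := closedBall_subset_ball hs1
  obtain ⟨x, hx, hmin⟩ := (isCompact_closedBall (0 : E2) s).exists_isMinOn
    ⟨0, mem_closedBall_self hs0⟩ (continuousOn_const.mul
      (h.continuousOn.mono (hsub.trans ball_subset_closedBall)) : ContinuousOn (fun x => σ * W x) _)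
  have hm := hpos x (hsub hx)
  obtain ⟨i, hi, hΛ⟩ := ((h.eventually_abs_sub_lt hm).and
    (h.tendsto_multiplier.eventually_le_const (lt_add_one l))).exists
  have hw := h.sol i
  have hp := (h.one_lt i).le
  have habs : |σ| = 1 := by rcases hσ with rfl | rfl <;> simp
  have hin : ∀ y ∈ closedBall (0 : E2) s, 0 ≤ σ * w i y := by
    intro y hy
    have h1 := hi y (ball_subset_closedBall (hsub hy))
    have h2 : σ * W x ≤ σ * W y := hmin hy
    have h3 : |σ * (w i y - W y)| < σ * W x := by rw [abs_mul, habs, one_mul]; exact h1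
    have h4 := (abs_lt.1 h3).1
    linarith
  have hall : ∀ y ∈ closedBall (0 : E2) 1, 0 ≤ σ * w i y := by
    intro y hy
    rcases le_total ‖y‖ s with hys | hys
    · exact hin y (mem_closedBall_zero_iff.2 hys)
    refine nonneg_of_thin_annulus (u := fun y => σ * w i y)
      (V := fun y => Λ i * ‖y‖ ^ α * |w i y| ^ (p i - 1)) hL1 hs0 hthin (by linarith)
      (contDiffOn_const.mul hw.contDiffOn) (continuousOn_const.mul hw.continuousOn)
      (fun y hy => by rw [hw.bdry y hy, mul_zero]) ?_ ?_
      (fun y hy => hin y (mem_closedBall_zero_iff.2 hy.le)) hy hys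
    · intro y hy
      have hy1 := (mem_ball_zero_iff.1 hy).le
      have a1 := Real.rpow_nonneg (norm_nonneg y) α
      have a2 := Real.rpow_nonneg (abs_nonneg (w i y)) (p i - 1)
      have a3 := Real.rpow_le_one (norm_nonneg y) hy1 hα
      have a4 := Real.rpow_le_one (abs_nonneg (w i y)) (hw.abs_le y (ball_subset_closedBall hy))
        (by linarith : 0 ≤ p i - 1)
      have a5 := h.nonneg i
      refine ⟨by positivity, ?_⟩
      calc Λ i * ‖y‖ ^ α * |w i y| ^ (p i - 1) ≤ Λ i * 1 * 1 := by gcongr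
        _ ≤ L := by linarith
    · intro y hy
      have := lap_const_mul σ (w i) y
      rw [this, ← mul_neg, hw.eq y hy]; ring
  obtain ⟨y, hy, hy0⟩ := hw.exists_pos
  obtain ⟨z, hz, hz0⟩ := hw.exists_neg
  have h1 := hall y (ball_subset_closedBall hy)
  have h2 := hall z (ball_subset_closedBall hz)
  rcases hσ with rfl | rfl <;> linarith

lemma not_forall_eq_zero (h : IsNodalLimit α l n p Λ w W)
    (h0 : ∀ r ∈ Set.Icc (0 : ℝ) 1, ∀ θ, W (polar r θ) = 0) : False := by
  obtain ⟨x, hx, hx1⟩ := h.exists_abs_eq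
  obtain ⟨θ, hθ⟩ := exists_eq_polar x
  rw [hθ, h0 _ ⟨norm_nonneg x, mem_closedBall_zero_iff.1 hx⟩, abs_zero] at hx1
  exact zero_ne_one hx1

/-- The only possible limit is the second eigenvalue with the nonradial eigenfunction. -/
lemma eq_eigenfunction {ν Z Z0 : ℝ} (h : IsNodalLimit α l n p Λ w W) (hα : 0 ≤ α) (hαγ : α = 2 * γ - 2)
    (hn : 1 ≤ n) (hν : 0 < ν) (hγν : γ * ν = n) (hpos : ∀ s ∈ Set.Ico 0 Z, 0 < besselH ν s)
    (hZ0 : Z0 ∈ Set.Ioo 0 Z) (hZ00 : besselH 0 Z0 = 0) (huniq : ∀ s ∈ Set.Icc 0 Z, besselH 0 s = 0 → s = Z0)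
    (hl : l ≤ (2 * γ) ^ 2 * Z) :
    l = (2 * γ) ^ 2 * Z ∧ ∃ c, ∀ r ∈ Set.Icc (0 : ℝ) 1, ∀ θ,
      W (polar r θ) = c * (radR γ Z ν r * Real.cos (n * θ)) := by
  have hγ : 0 < γ := by linarith
  have hγ2 : 0 < (2 * γ) ^ 2 := by positivity
  have hn0 : (0 : ℝ) < n := by positivity
  obtain ⟨μ, rfl⟩ : ∃ μ, l = (2 * γ) ^ 2 * μ := ⟨l / (2 * γ) ^ 2, by field_simp⟩
  have hμ0 : 0 ≤ μ := nonneg_of_mul_nonneg_right h.l_nonneg hγ2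
  have hμZ : μ ≤ Z := le_of_mul_le_mul_left hl hγ2
  -- higher modes
  have hhigh : ∀ j : ℕ, 2 ≤ j → ∀ r ∈ Set.Icc (0 : ℝ) 1, coef W (n * j) (2 * π / n) r = 0 := by
    intro j hj r hr
    have hj' : (2 : ℝ) ≤ j := by exact_mod_cast hj
    have hlt : ν < j * ν := by nlinarith
    refine h.coef_eq_zero hα hαγ hn (κ := j * ν) (by positivity) (by rw [← hγν]; ring) le_rfl zero_lt_one
      (fun s hs => radR_ne_zero hs.1 (besselH_pos_of_lt hν.le hlt hpos ?_).ne') hr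
    have := mul_rpow_mem_Icc hγ hμ0 ⟨hs.1.le, hs.2⟩
    exact ⟨this.1, this.2.trans hμZ⟩
  have hone : μ < Z → ∀ r ∈ Set.Icc (0 : ℝ) 1, coef W (n * (1 : ℕ)) (2 * π / n) r = 0 := by
    intro hlt r hr
    refine h.coef_eq_zero hα hαγ hn hν.le (by rw [hγν]; simp) le_rfl zero_lt_one
      (fun s hs => radR_ne_zero hs.1 (hpos _ ?_).ne') hr
    have := mul_rpow_mem_Icc hγ hμ0 ⟨hs.1.le, hs.2⟩
    exact ⟨this.1, this.2.trans_lt hlt⟩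
  have hpos0 : ∀ s ∈ Set.Ico 0 Z0, 0 < besselH 0 s := by
    intro s hs
    by_contra hneg
    rcases hs.1.eq_or_lt with rfl | hs0
    · exact hneg (besselH_zero_pos le_rfl)
    obtain ⟨z, hz, hz0, -⟩ := exists_first_zero (continuous_besselH le_rfl) (besselH_zero_pos le_rfl)
      hs0.le (not_lt.1 hneg)
    have := huniq z ⟨hz.1.le, (hz.2.trans hs.2.le).trans hZ0.2.le⟩ hz0
    linarith [hz.2, hs.2]
  have hzero : μ ≠ Z0 → ∀ r ∈ Set.Icc (0 : ℝ) 1, coef W (n * (0 : ℕ)) (2 * π / n) r = 0 := by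
    intro hne r hr
    rcases hne.lt_or_gt with hlt | hgt
    · refine h.coef_eq_zero hα hαγ hn le_rfl (by simp) le_rfl zero_lt_one
        (fun s hs => radR_ne_zero hs.1 (hpos0 _ ?_).ne') hr
      have := mul_rpow_mem_Icc hγ hμ0 ⟨hs.1.le, hs.2⟩
      exact ⟨this.1, this.2.trans_lt hlt⟩
    · have hμ : 0 < μ := hZ0.1.trans hgt
      have hq : Z0 / μ ∈ Set.Ioo (0 : ℝ) 1 := ⟨div_pos hZ0.1 hμ, (div_lt_one hμ).2 hgt⟩
      have hr0 : (Z0 / μ) ^ (2 * γ)⁻¹ ∈ Set.Ioo (0 : ℝ) 1 :=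
        ⟨Real.rpow_pos_of_pos hq.1 _, Real.rpow_lt_one hq.1.le hq.2 (by positivity)⟩
      have e : μ * ((Z0 / μ) ^ (2 * γ)⁻¹) ^ (2 * γ) = Z0 := by
        rw [Real.rpow_inv_rpow hq.1.le (by positivity)]; field_simp
      have h1 := h.coef_zero_eq_zero hα hαγ hn hr0 ?_ ?_ hr
      · simpa using h1
      · have h1 : 0 < besselH (0 + 1) Z0 :=
          besselH_pos_of_lt le_rfl (by norm_num) hpos0 ⟨hZ0.1.le, le_rfl⟩
        rw [radQ, e, mul_zero, zero_mul, zero_sub, Real.rpow_zero, one_mul, neg_ne_zero]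
        have := hZ0.1
        positivity
      · intro s hs hsne
        refine radR_ne_zero hs.1 fun h0 => hsne ?_
        have hm := mul_rpow_mem_Icc hγ hμ0 ⟨hs.1.le, hs.2⟩
        have h2 := huniq _ ⟨hm.1, hm.2.trans hμZ⟩ h0
        rw [← h2, mul_div_cancel_left₀ _ hμ.ne', Real.rpow_rpow_inv hs.1.le (by positivity)]
  rcases hμZ.eq_or_lt with rfl | hlt
  · refine ⟨rfl, ?_⟩
    have hμ : 0 < μ := hZ0.1.trans hZ0.2
    obtain ⟨c, hc⟩ := h.exists_coef_eq hα hαγ hn hν.le (j := 1) (by rw [hγν]; simp) le_rfl le_rfl zero_lt_one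
      fun s hs => radR_ne_zero hs.1 (hpos _ (mul_rpow_mem_Ico hγ hμ ⟨hs.1.le, hs.2⟩)).ne'
    refine ⟨2 / (2 * π / n) * c, fun r hr θ => ?_⟩
    rw [h.eq_mul_cos hn 1 ?_ hr θ, hc r hr]
    · simp; ring
    · intro j hj r hr
      rcases Nat.lt_or_ge j 1 with h1 | h1
      · obtain rfl : j = 0 := by omega
        exact hzero hZ0.2.ne' r hr
      · exact hhigh j (by omega) r hr
  · exfalso
    have hj0 : ∀ j : ℕ, j ≠ 0 → ∀ r ∈ Set.Icc (0 : ℝ) 1, coef W (n * j) (2 * π / n) r = 0 := by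
      intro j hj r hr
      rcases Nat.lt_or_ge j 2 with h1 | h1
      · obtain rfl : j = 1 := by omega
        exact hone hlt r hr
      · exact hhigh j h1 r hr
    have hW := fun {r : ℝ} (hr : r ∈ Set.Icc (0 : ℝ) 1) (θ : ℝ) => h.eq_mul_cos hn 0 hj0 hr θ
    by_cases hne : μ = Z0
    · subst hne
      have hprof : ∀ s ∈ Set.Ico (0 : ℝ) 1, 0 < radR γ μ 0 s := by
        intro s hs
        rw [radR, mul_zero, Real.rpow_zero, one_mul]
        exact hpos0 _ (mul_rpow_mem_Ico hγ hZ0.1 hs)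
      obtain ⟨c, hc⟩ := h.exists_coef_eq hα hαγ hn le_rfl (j := 0) (by simp) le_rfl le_rfl zero_lt_one
        fun s hs => (hprof s ⟨hs.1.le, hs.2⟩).ne'
      obtain ⟨d, hd⟩ : ∃ d, d = 1 / (2 * π / n) * c := ⟨_, rfl⟩
      have hWd : ∀ r ∈ Set.Icc (0 : ℝ) 1, ∀ θ, W (polar r θ) = d * radR γ μ 0 r := by
        intro r hr θ
        rw [hW hr θ, hc r hr, hd]; simp; ring
      have hd0 : d ≠ 0 := by
        rintro h0
        exact h.not_forall_eq_zero fun r hr θ => by rw [hWd r hr θ, h0, zero_mul]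
      have hball : ∀ σ, 0 < σ * d → ∀ x ∈ ball (0 : E2) 1, 0 < σ * W x := by
        intro σ hσ x hx
        have hx1 := mem_ball_zero_iff.1 hx
        obtain ⟨θ, hθ⟩ := exists_eq_polar x
        rw [hθ, hWd _ ⟨norm_nonneg x, hx1.le⟩, ← mul_assoc]
        exact mul_pos hσ (hprof _ ⟨norm_nonneg x, hx1⟩)
      rcases hd0.lt_or_gt with h1 | h1
      · exact h.not_pos hα (Or.inr rfl) (hball (-1) (by linarith))
      · exact h.not_pos hα (Or.inl rfl) (hball 1 (by linarith))
    · exact h.not_forall_eq_zero fun r hr θ => by rw [hW hr θ, hzero hne r hr]; ring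

end IsNodalLimit

/-- Sequential compactness of normalized nodal solutions with bounded multipliers. -/
lemma exists_subseq_isNodalLimit {α L : ℝ} {n : ℕ} {p Λ : ℕ → ℝ} {w : ℕ → E2 → ℝ} (hα : 0 ≤ α)
    (hw : ∀ i, IsScaledSol α (p i) (Λ i) n (w i)) (hp1 : ∀ i, 1 < p i) (hp : Tendsto p atTop (𝓝 1))
    (hΛ : ∀ i, 0 ≤ Λ i) (hL : 0 < L) (hΛL : ∀ i, Λ i ≤ L) :
    ∃ φ : ℕ → ℕ, StrictMono φ ∧ ∃ l W,
      IsNodalLimit α l n (fun i => p (φ i)) (fun i => Λ (φ i)) (fun i => w (φ i)) W := by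
  have : CompactSpace (closedBall (0 : E2) 1) := isCompact_iff_compactSpace.1 (isCompact_closedBall 0 1)
  obtain ⟨f, hf⟩ : ∃ f : ℕ → BoundedContinuousFunction (closedBall (0 : E2) 1) ℝ, ∀ i x, f i x = w i x :=
    ⟨fun i => BoundedContinuousFunction.mkOfCompact ⟨_, (hw i).continuousOn.domRestrict⟩, fun i x => rfl⟩
  have hlip : ∀ i, LipschitzWith (3 * L).toNNReal (f i) := fun i => by
    refine LipschitzWith.of_dist_le_mul fun x y => ?_
    rw [hf, hf, Real.dist_eq, Subtype.dist_eq, dist_eq_norm, Real.coe_toNNReal _ (by positivity)]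
    exact (hw i).lipschitz hα (hp1 i).le (hΛ i) hL (hΛL i) x.2 y.2
  have hcomp : IsCompact (closure (Set.range f)) := by
    refine BoundedContinuousFunction.arzela_ascoli (Set.Icc (-1) 1) isCompact_Icc _ ?_ ?_
    · rintro _ x ⟨i, rfl⟩
      rw [hf]
      exact _root_.abs_le.1 ((hw i).abs_le x x.2)
    · refine (LipschitzWith.uniformEquicontinuous _ (3 * L).toNNReal ?_).equicontinuous
      rintro ⟨_, i, rfl⟩
      exact hlip i
  obtain ⟨l, -, φ, hφ, hl⟩ := isCompact_Icc.tendsto_subseq (x := Λ) fun i => ⟨hΛ i, hΛL i⟩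
  obtain ⟨g, -, ψ, hψ, hg⟩ := hcomp.tendsto_subseq (x := fun i => f (φ i))
    fun i => subset_closure ⟨φ i, rfl⟩
  have hφψ : StrictMono fun i => φ (ψ i) := hφ.comp hψ
  classical
  refine ⟨fun i => φ (ψ i), hφψ, l, fun x => if hx : x ∈ closedBall (0 : E2) 1 then g ⟨x, hx⟩ else 0,
    fun i => hw _, fun i => hp1 _, hp.comp hφψ.tendsto_atTop, fun i => hΛ _,
    hl.comp hψ.tendsto_atTop, ?_⟩
  rw [tendstoUniformlyOn_iff_tendstoUniformly_comp_coe]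
  have h1 := BoundedContinuousFunction.tendsto_iff_tendstoUniformly.1 hg
  have e1 : (fun i (x : closedBall (0 : E2) 1) => w (φ (ψ i)) x) = fun i => ⇑(f (φ (ψ i))) := by
    ext i x; rw [hf]
  have e2 : ((fun x => if hx : x ∈ closedBall (0 : E2) 1 then g ⟨x, hx⟩ else 0)
      ∘ (Subtype.val : closedBall (0 : E2) 1 → E2)) = g := by
    ext x; simp only [Function.comp, dif_pos x.2]
  rw [e1, e2]
  exact h1

lemma besselJ_mul_rpow {γ ν z r : ℝ} (hz : 0 < z) (hr : 0 ≤ r) :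
    besselJ ν (z * r ^ γ) = z ^ ν * radR γ (z ^ 2 / 4) ν r := by
  have e : r ^ (2 * γ) = (r ^ γ) ^ 2 := by
    rw [← Real.rpow_natCast (r ^ γ) 2, ← Real.rpow_mul hr]; congr 1; push_cast; ring
  rw [besselJ_eq, radR, Real.mul_rpow hz.le (Real.rpow_nonneg hr γ), ← Real.rpow_mul hr, e, mul_assoc]
  congr 3
  ring

lemma sSup_abs_besselJ {ν t : ℝ} (ht : 0 ≤ t) (hpos : 0 < besselJ ν t)
    (hmax : ∀ s, 0 ≤ s → |besselJ ν s| ≤ besselJ ν t) :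
    sSup ((fun s => |besselJ ν s|) '' Set.Ici 0) = besselJ ν t := by
  refine IsGreatest.csSup_eq ⟨⟨t, ht, abs_of_pos hpos⟩, ?_⟩
  rintro _ ⟨s, hs, rfl⟩
  exact hmax s hs

/-- Normalization of the limit profile. -/
lemma IsNodalLimit.exists_sign {α l γ ν z c : ℝ} {n : ℕ} {p Λ : ℕ → ℝ} {w : ℕ → E2 → ℝ} {W : E2 → ℝ}
    (h : IsNodalLimit α l n p Λ w W) (hγ : 0 < γ) (hν : 0 < ν) (hz : 0 < z) (hz1 : IsNthZero ν 1 z)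
    (hW : ∀ r ∈ Set.Icc (0 : ℝ) 1, ∀ θ,
      W (polar r θ) = c * (radR γ (z ^ 2 / 4) ν r * Real.cos (n * θ))) :
    ∃ ε : ℝ, (ε = 1 ∨ ε = -1) ∧ ∀ r ∈ Set.Icc (0 : ℝ) 1, ∀ θ, W (polar r θ) = ε *
      (besselJ ν (z * r ^ γ) / sSup ((fun s => |besselJ ν s|) '' Set.Ici 0)) * Real.cos (n * θ) := by
  obtain ⟨t, ht, hJ, hmax⟩ := exists_max_besselJ hν hz1
  rw [sSup_abs_besselJ ht.1.le hJ hmax]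
  have hzν : 0 < z ^ ν := Real.rpow_pos_of_pos hz ν
  obtain ⟨d, rfl⟩ : ∃ d, c = d * z ^ ν := ⟨c / z ^ ν, by field_simp⟩
  have hWd : ∀ r ∈ Set.Icc (0 : ℝ) 1, ∀ θ,
      W (polar r θ) = d * besselJ ν (z * r ^ γ) * Real.cos (n * θ) := by
    intro r hr θ
    rw [hW r hr θ, besselJ_mul_rpow hz hr.1]; ring
  have hle : |d| * besselJ ν t ≤ 1 := by
    have hq : t / z ∈ Set.Ioo (0 : ℝ) 1 := ⟨div_pos ht.1 hz, (div_lt_one hz).2 ht.2⟩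
    have hr : (t / z) ^ γ⁻¹ ∈ Set.Icc (0 : ℝ) 1 :=
      ⟨Real.rpow_nonneg hq.1.le _, Real.rpow_le_one hq.1.le hq.2.le (by positivity)⟩
    have h1 := h.abs_le (polar_mem_closedBall hr.1 hr.2 0)
    rw [hWd _ hr, Real.rpow_inv_rpow hq.1.le hγ.ne', mul_div_cancel₀ _ hz.ne', mul_zero, Real.cos_zero,
      mul_one, abs_mul, abs_of_pos hJ] at h1
    exact h1
  have hge : 1 ≤ |d| * besselJ ν t := by
    obtain ⟨x, hx, hx1⟩ := h.exists_abs_eq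
    obtain ⟨θ, hθ⟩ := exists_eq_polar x
    have hr : ‖x‖ ∈ Set.Icc (0 : ℝ) 1 := ⟨norm_nonneg x, mem_closedBall_zero_iff.1 hx⟩
    rw [hθ, hWd _ hr, abs_mul, abs_mul] at hx1
    rw [← hx1]
    calc |d| * |besselJ ν (z * ‖x‖ ^ γ)| * |Real.cos (n * θ)| ≤ |d| * besselJ ν t * 1 := by
          gcongr
          · exact hmax _ (mul_nonneg hz.le (Real.rpow_nonneg hr.1 _))
          · exact Real.abs_cos_le_one _
      _ = _ := mul_one _
  have heq : |d * besselJ ν t| = 1 := by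
    rw [abs_mul, abs_of_pos hJ]; exact hle.antisymm hge
  refine ⟨d * besselJ ν t, (abs_eq zero_le_one).1 heq, fun r hr θ => ?_⟩
  rw [hWd r hr θ]
  field_simp

/-- Every sequence of exponents tending to `1` has a subsequence along which the least energy nodal
solutions converge to the nonradial second eigenfunction. -/
lemma exists_subseq_tendsto {α β γ ν z20 z : ℝ} {n : ℕ} (hα : 0 ≤ α) (hαγ : α = 2 * γ - 2) (hn : 1 ≤ n)
    (hz20 : IsNthZero 0 2 z20) (hβz : IsNthZero β 1 z20) (hν : 0 < ν) (hνβ : ν < β) (hγν : γ * ν = n)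
    (hz : IsNthZero ν 1 z) {pk : ℕ → ℝ} {V : ℕ → E2 → ℝ} (hV : ∀ k, IsLeastEnergyNInvNodal α (pk k) n (V k))
    (hpk1 : ∀ k, 1 < pk k) (hpk : Tendsto pk atTop (𝓝 1)) :
    ∃ φ : ℕ → ℕ, StrictMono φ ∧
      Tendsto (fun k => supN (V (φ k)) ^ (pk (φ k) - 1)) atTop (𝓝 ((γ * z) ^ 2)) ∧
      ∃ ε : ℝ, (ε = 1 ∨ ε = -1) ∧ ∃ ω : E2 → ℝ,
        (∀ r ∈ Set.Icc (0 : ℝ) 1, ∀ θ : ℝ, ω (polar r θ) = ε *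
          (besselJ ν (z * r ^ γ) / sSup ((fun s => |besselJ ν s|) '' Set.Ici 0)) * Real.cos (n * θ)) ∧
        TendstoUniformlyOn (fun k x => V (φ k) x / supN (V (φ k))) ω atTop (closedBall 0 1) := by
  have hγ : 0 < γ := by linarith
  have hz0 : 0 < z := hz.1
  obtain ⟨hZ0, hpos⟩ := isNthZero_one hν.le hz
  have hZ : 0 < z ^ 2 / 4 := by positivity
  obtain ⟨Z0, hZ0m, hZ00, huniq⟩ := exists_first_zero_besselH_zero hν hνβ hz20 hβz hz
  obtain ⟨b, hb, hbound⟩ := supN_rpow_le hα hαγ hn hν.le hγν hZ hZ0 hpos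
  have hpk' : Tendsto pk atTop (𝓝[>] 1) :=
    tendsto_nhdsWithin_iff.2 ⟨hpk, Eventually.of_forall hpk1⟩
  have hbk := hb.comp hpk'
  have hev : ∀ᶠ k in atTop, supN (V k) ^ (pk k - 1) ≤ b (pk k) := by
    filter_upwards [hpk'.eventually hbound] with k hk using hk _ (hV k)
  obtain ⟨N, hN⟩ := eventually_atTop.1 (hev.and (hbk.eventually_le_const (lt_add_one _)))
  have hshift : StrictMono fun k : ℕ => k + N := fun a b hab => Nat.add_lt_add_right hab N
  obtain ⟨φ, hφ, l, W, hlim⟩ := exists_subseq_isNodalLimit (L := (2 * γ) ^ 2 * (z ^ 2 / 4) + 1)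
    (p := fun k => pk (k + N)) hα (fun k => (hV (k + N)).scaled) (fun k => hpk1 _)
    (hpk.comp hshift.tendsto_atTop)
    (fun k => Real.rpow_nonneg (supN_pos (hV _)).le _) (by positivity)
    (fun k => (hN (k + N) (Nat.le_add_left _ _)).1.trans (hN (k + N) (Nat.le_add_left _ _)).2)
  have hmono : StrictMono fun k => φ k + N := hshift.comp hφ
  have hl : l ≤ (2 * γ) ^ 2 * (z ^ 2 / 4) :=
    le_of_tendsto_of_tendsto hlim.tendsto_multiplier (hbk.comp hmono.tendsto_atTop)
      (Eventually.of_forall fun k => (hN (φ k + N) (Nat.le_add_left _ _)).1)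
  obtain ⟨rfl, c, hc⟩ := hlim.eq_eigenfunction hα hαγ hn hν hγν hpos hZ0m hZ00 huniq hl
  obtain ⟨ε, hε, hW⟩ := hlim.exists_sign hγ hν hz0 hz hc
  refine ⟨fun k => φ k + N, hmono, ?_, ε, hε, W, hW, hlim.unif⟩
  have e : (γ * z) ^ 2 = (2 * γ) ^ 2 * (z ^ 2 / 4) := by ring
  rw [e]
  exact hlim.tendsto_multiplier

/-- asymptotic profile of least energy `n`-invariant nodal solutions as
`p → 1`, in the case `n < (2+α)β/2` (where `z_1(β) = z_2(0)`): the limit profile is the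
nonradial eigenfunction `J_ν(z_1(ν) r^{(2+α)/2}) cos(nθ) / ‖J_ν‖_∞` with `ν = 2n/(2+α)`. -/
theorem stmt_15 (α : ℝ) (hα : 0 ≤ α) (n : ℕ) (hn : 1 ≤ n)
    (β : ℝ) (hβ : 0 < β) (z20 : ℝ) (hz20 : IsNthZero 0 2 z20) (hβz : IsNthZero β 1 z20)
    (hsmall : (n : ℝ) < (2 + α) * β / 2)
    (z1ν : ℝ) (hz1ν : IsNthZero (2 * (n : ℝ) / (2 + α)) 1 z1ν)
    (p0 : ℝ) (hp0 : 1 < p0) (U : ℝ → E2 → ℝ)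
    (hU : ∀ p ∈ Set.Ioo (1 : ℝ) p0, IsLeastEnergyNInvNodal α p n (U p)) :
    Tendsto (fun p => supN (U p) ^ (p - 1)) (𝓝[Set.Ioo (1 : ℝ) p0] 1)
      (𝓝 (((2 + α) / 2 * z1ν) ^ 2)) ∧
    ∀ pk : ℕ → ℝ, (∀ k, pk k ∈ Set.Ioo (1 : ℝ) p0) → Tendsto pk atTop (𝓝 1) →
      ∃ φ : ℕ → ℕ, StrictMono φ ∧ ∃ ε : ℝ, (ε = 1 ∨ ε = -1) ∧ ∃ ω : E2 → ℝ,
        (∀ r ∈ Set.Icc (0 : ℝ) 1, ∀ θ : ℝ,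
          ω (polar r θ) = ε *
            (besselJ (2 * (n : ℝ) / (2 + α)) (z1ν * r ^ ((2 + α) / 2)) /
              sSup ((fun s => |besselJ (2 * (n : ℝ) / (2 + α)) s|) '' Set.Ici 0)) *
            Real.cos (n * θ)) ∧
        TendstoUniformlyOn (fun k x => U (pk (φ k)) x / supN (U (pk (φ k)))) ω atTop
          (closedBall 0 1) := by
  have hα2 : 0 < 2 + α := by linarith
  have hν : 0 < 2 * (n : ℝ) / (2 + α) := by positivity
  have hνβ : 2 * (n : ℝ) / (2 + α) < β := by
    rw [div_lt_iff₀ hα2]; linarith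
  have hγν : (2 + α) / 2 * (2 * (n : ℝ) / (2 + α)) = n := by field_simp
  have key : ∀ pk : ℕ → ℝ, (∀ k, pk k ∈ Set.Ioo (1 : ℝ) p0) → Tendsto pk atTop (𝓝 1) → _ :=
    fun pk hpk hlim => exists_subseq_tendsto hα (by ring : α = 2 * ((2 + α) / 2) - 2) hn hz20 hβz hν hνβ
      hγν hz1ν (fun k => hU _ (hpk k)) (fun k => (hpk k).1) hlim
  refine ⟨tendsto_of_seq_tendsto fun pk hpk => ?_, fun pk hpk hlim => ?_⟩
  · rw [tendsto_nhdsWithin_iff] at hpk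
    obtain ⟨N, hN⟩ := eventually_atTop.1 hpk.2
    rw [← tendsto_add_atTop_iff_nat N]
    refine tendsto_of_subseq_tendsto fun ns hns => ?_
    have hns' : Tendsto (fun k => ns k + N) atTop atTop := (tendsto_add_atTop_nat N).comp hns
    obtain ⟨φ, -, hφ, -⟩ := key (fun k => pk (ns k + N)) (fun k => hN _ (Nat.le_add_left _ _))
      (hpk.1.comp hns')
    exact ⟨φ, hφ⟩
  · obtain ⟨φ, hφ, -, h⟩ := key pk hpk hlim
    exact ⟨φ, hφ, h⟩
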